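/- Projecting a smooth space curve C ⊂ P^3 from a general point Q ∉ C yields a plane curve birational to C whose only singularities are nodes. -/

import Mathlib

open MvPolynomial

variable {k : Type} [Field k]

/-- Iterated partial derivatives along a list of variable indices. -/
noncomputable def pderivList {n : ℕ} (s : List (Fin n)) (F : MvPolynomial (Fin n) k) :
    MvPolynomial (Fin n) k :=
  s.foldr (fun i G => pderiv i G) F

/-- The `m`-th directional derivative of `F` at `v` in direction `w`
(`m!` times the degree-`m` Taylor form). -/
noncomputable def dirDeriv {n : ℕ} (F : MvPolynomial (Fin n) k)
    (v w : Fin n → k) (m : ℕ) : k :=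
  ∑ s : Fin m → Fin n, eval v (pderivList (List.ofFn s) F) * ∏ j, w (s j)

/-- `F` has multiplicity (exactly) `m` at the point `v`: all partial derivatives of
order `< m` vanish at `v`, while some order-`m` derivative does not. -/
def HasMultiplicityAt {n : ℕ} (F : MvPolynomial (Fin n) k) (v : Fin n → k) (m : ℕ) : Prop :=
  (∀ s : List (Fin n), s.length < m → eval v (pderivList s F) = 0) ∧
    ∃ s : List (Fin n), s.length = m ∧ eval v (pderivList s F) ≠ 0

/-- A singular point of the projective plane curve `F = 0`. -/
def IsSingularAt (F : MvPolynomial (Fin 3) k) (v : Fin 3 → k) : Prop :=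
  v ≠ 0 ∧ eval v F = 0 ∧ ∀ i, eval v (pderiv i F) = 0

/-- A node (ordinary double point): multiplicity two with two distinct tangent
directions, i.e. the degree-2 tangent cone is not (a multiple of) a square of a linear form. -/
def IsNodeAt (F : MvPolynomial (Fin 3) k) (v : Fin 3 → k) : Prop :=
  v ≠ 0 ∧ eval v F = 0 ∧ HasMultiplicityAt F v 2 ∧
    ¬ ∃ (c : k) (l : Fin 3 → k), ∀ w : Fin 3 → k,
        dirDeriv F v w 2 = c * (∑ i, l i * w i) ^ 2

/-- An ordinary point of multiplicity `m`: the degree-`m` tangent cone factors into `m`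
pairwise distinct linear forms. -/
def IsOrdinaryAt (F : MvPolynomial (Fin 3) k) (v : Fin 3 → k) (m : ℕ) : Prop :=
  HasMultiplicityAt F v m ∧
    ∃ (c : k) (L : Fin m → (Fin 3 → k)), c ≠ 0 ∧
      (∀ i j, i ≠ j → ¬ ∃ t : k, L j = t • L i) ∧
      ∀ w : Fin 3 → k, dirDeriv F v w m = c * ∏ i, (∑ j, L i j * w j)

/-- An (irreducible) plane algebraic curve of degree `n` in `ℙ²`. -/
structure PlaneCurve (k : Type) [Field k] where
  n : ℕ
  F : MvPolynomial (Fin 3) k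
  homog : F.IsHomogeneous n
  irred : Irreducible F

/-- Birational equivalence of the projective curves `F = 0` and `G = 0`, expressed by a
pair of mutually inverse rational maps given by homogeneous polynomial triples. -/
def BirEquiv (F G : MvPolynomial (Fin 3) k) : Prop :=
  ∃ φ ψ : Fin 3 → MvPolynomial (Fin 3) k,
    (∃ d, ∀ i, (φ i).IsHomogeneous d) ∧
    (∃ e, ∀ i, (ψ i).IsHomogeneous e) ∧
    bind₁ φ G ∈ Ideal.span {F} ∧
    bind₁ ψ F ∈ Ideal.span {G} ∧
    (∃ lam : MvPolynomial (Fin 3) k, lam ∉ Ideal.span {F} ∧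
      ∀ i, bind₁ φ (ψ i) - lam * X i ∈ Ideal.span {F}) ∧
    (∃ mu : MvPolynomial (Fin 3) k, mu ∉ Ideal.span {G} ∧
      ∀ i, bind₁ ψ (φ i) - mu * X i ∈ Ideal.span {G})


/-- The (affine cone over the) zero locus in `ℙ^{N-1}` of an ideal of polynomials. -/
def projZeros {k : Type} [Field k] {N : ℕ} (I : Ideal (MvPolynomial (Fin N) k)) :
    Set (Fin N → k) :=
  {v | ∀ f ∈ I, eval v f = 0}

/-- The (cone over the) Zariski tangent space of `V(I)` at `v`. -/
noncomputable def tangentSpace {k : Type} [Field k] {N : ℕ}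
    (I : Ideal (MvPolynomial (Fin N) k)) (v : Fin N → k) : Submodule k (Fin N → k) :=
  ⨅ f ∈ I, LinearMap.ker (∑ i, eval v (pderiv i f) • (LinearMap.proj i : (Fin N → k) →ₗ[k] k))

/-- `I` defines an irreducible curve in `ℙ^{N-1}`: it is a homogeneous prime ideal whose
affine cone has Krull dimension 2. -/
structure IsProjCurveIdeal {k : Type} [Field k] {N : ℕ}
    (I : Ideal (MvPolynomial (Fin N) k)) : Prop where
  prime : I.IsPrime
  homog : ∃ S : Set (MvPolynomial (Fin N) k), I = Ideal.span S ∧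
    ∀ g ∈ S, ∃ d, g.IsHomogeneous d
  dim : ringKrullDim (MvPolynomial (Fin N) k ⧸ I) = 2

/-- `v` is a singular point of the curve `V(I)` (the tangent space is too big). -/
def IsSingularCurvePoint {k : Type} [Field k] {N : ℕ}
    (I : Ideal (MvPolynomial (Fin N) k)) (v : Fin N → k) : Prop :=
  v ≠ 0 ∧ v ∈ projZeros I ∧ Module.finrank k (tangentSpace I v) ≠ 2

/-- The curve `V(I)` is smooth. -/
def IsSmoothCurve {k : Type} [Field k] {N : ℕ}
    (I : Ideal (MvPolynomial (Fin N) k)) : Prop :=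
  ∀ v ∈ projZeros I, v ≠ 0 → Module.finrank k (tangentSpace I v) = 2

/-- The line `W` (a 2-dimensional subspace of `k⁴`) is a secant of `V(I)`:
it meets the curve in at least two distinct points of `ℙ³`. -/
def IsSecantOf {k : Type} [Field k] (I : Ideal (MvPolynomial (Fin 4) k))
    (W : Submodule k (Fin 4 → k)) : Prop :=
  Module.finrank k W = 2 ∧ ∃ v₁ v₂ : Fin 4 → k,
    v₁ ≠ 0 ∧ v₂ ≠ 0 ∧ v₁ ∈ W ∧ v₂ ∈ W ∧ v₁ ∈ projZeros I ∧ v₂ ∈ projZeros I ∧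
      ¬ ∃ c : k, v₂ = c • v₁

/-- The line `W` is a trisecant of `V(I)`: it meets the curve in at least three distinct
points of `ℙ³`. -/
def IsTrisecantOf {k : Type} [Field k] (I : Ideal (MvPolynomial (Fin 4) k))
    (W : Submodule k (Fin 4 → k)) : Prop :=
  Module.finrank k W = 2 ∧ ∃ v₁ v₂ v₃ : Fin 4 → k,
    v₁ ≠ 0 ∧ v₂ ≠ 0 ∧ v₃ ≠ 0 ∧ v₁ ∈ W ∧ v₂ ∈ W ∧ v₃ ∈ W ∧
    v₁ ∈ projZeros I ∧ v₂ ∈ projZeros I ∧ v₃ ∈ projZeros I ∧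
    (¬ ∃ c : k, v₂ = c • v₁) ∧ (¬ ∃ c : k, v₃ = c • v₁) ∧ (¬ ∃ c : k, v₃ = c • v₂)

/-- The line `W` is tangent to `V(I)` at some point. -/
def IsTangentLineOf {k : Type} [Field k] (I : Ideal (MvPolynomial (Fin 4) k))
    (W : Submodule k (Fin 4 → k)) : Prop :=
  Module.finrank k W = 2 ∧ ∃ v : Fin 4 → k,
    v ≠ 0 ∧ v ∈ projZeros I ∧ v ∈ W ∧ W ≤ tangentSpace I v

/-- Birational equivalence between the projective varieties `V(I) ⊆ ℙ^{N-1}` and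
`V(J) ⊆ ℙ^{M-1}`, given by mutually inverse rational maps with homogeneous polynomial
components. -/
def IdealBirEquiv {k : Type} [Field k] {N M : ℕ}
    (I : Ideal (MvPolynomial (Fin N) k)) (J : Ideal (MvPolynomial (Fin M) k)) : Prop :=
  ∃ (φ : Fin M → MvPolynomial (Fin N) k) (ψ : Fin N → MvPolynomial (Fin M) k),
    (∃ d, ∀ i, (φ i).IsHomogeneous d) ∧ (∃ e, ∀ i, (ψ i).IsHomogeneous e) ∧
    (∀ g ∈ J, bind₁ φ g ∈ I) ∧ (∀ f ∈ I, bind₁ ψ f ∈ J) ∧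
    (∃ lam, lam ∉ I ∧ ∀ i, bind₁ φ (ψ i) - lam * X i ∈ I) ∧
    (∃ mu, mu ∉ J ∧ ∀ i, bind₁ ψ (φ i) - mu * X i ∈ J)


namespace GP

/-- first derivative -/
noncomputable def d1 {k L : Type} [Field k] [CommRing L] [Algebra k L] {n : ℕ}
    (f : MvPolynomial (Fin n) k) (v w : Fin n → L) : L :=
  ∑ i, aeval v (pderiv i f) * w i

/-- second derivative -/
noncomputable def d2 {k L : Type} [Field k] [CommRing L] [Algebra k L] {n : ℕ}
    (f : MvPolynomial (Fin n) k) (v w w' : Fin n → L) : L :=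
  ∑ i, ∑ j, aeval v (pderiv i (pderiv j f)) * w i * w' j

section
variable {k L : Type} [Field k] [CommRing L] [Algebra k L] {n : ℕ}

lemma d1_add (f g : MvPolynomial (Fin n) k) (v w : Fin n → L) :
    d1 (f + g) v w = d1 f v w + d1 g v w := by
  simp [d1, add_mul, Finset.sum_add_distrib]

lemma d1_mul (f g : MvPolynomial (Fin n) k) (v w : Fin n → L) :
    d1 (f * g) v w = aeval v f * d1 g v w + aeval v g * d1 f v w := by
  simp only [d1, Derivation.leibniz, smul_eq_mul, map_add, map_mul, add_mul,
    Finset.sum_add_distrib, Finset.mul_sum, mul_assoc]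

lemma d1_add_right (f : MvPolynomial (Fin n) k) (v w w' : Fin n → L) :
    d1 f v (w + w') = d1 f v w + d1 f v w' := by
  simp [d1, mul_add, Finset.sum_add_distrib]

lemma d1_smul_right (f : MvPolynomial (Fin n) k) (v w : Fin n → L) (c : L) :
    d1 f v (c • w) = c * d1 f v w := by
  simp only [d1, Finset.mul_sum, Pi.smul_apply, smul_eq_mul]
  exact Finset.sum_congr rfl fun i _ => by ring

lemma d1_zero_right (f : MvPolynomial (Fin n) k) (v : Fin n → L) :
    d1 f v 0 = 0 := by simp [d1]

lemma d1_C (a : k) (v w : Fin n → L) : d1 (C a) v w = 0 := by simp [d1]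

lemma d1_X (i : Fin n) (v w : Fin n → L) : d1 (X i : MvPolynomial (Fin n) k) v w = w i := by
  simp only [d1, pderiv_X, Pi.single_apply]
  simp [apply_ite]

lemma d1_zero (v w : Fin n → L) : d1 (0 : MvPolynomial (Fin n) k) v w = 0 := by simp [d1]

/-- zero set with values in an algebra -/
def Z (L : Type) [CommRing L] [Algebra k L] (I : Ideal (MvPolynomial (Fin n) k)) :
    Set (Fin n → L) := {v | ∀ f ∈ I, aeval v f = 0}

/-- tangent space with values in an algebra -/
def T (I : Ideal (MvPolynomial (Fin n) k)) (v : Fin n → L) : Submodule L (Fin n → L) where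
  carrier := {w | ∀ f ∈ I, d1 f v w = 0}
  add_mem' := fun ha hb f hf => by rw [d1_add_right, ha f hf, hb f hf, add_zero]
  zero_mem' := fun f _ => d1_zero_right f v
  smul_mem' := fun c x hx f hf => by rw [d1_smul_right, hx f hf, mul_zero]

lemma mem_T {I : Ideal (MvPolynomial (Fin n) k)} {v w : Fin n → L} :
    w ∈ T I v ↔ ∀ f ∈ I, d1 f v w = 0 := Iff.rfl

lemma mem_Z {I : Ideal (MvPolynomial (Fin n) k)} {v : Fin n → L} :
    v ∈ Z L I ↔ ∀ f ∈ I, aeval v f = 0 := Iff.rfl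

lemma Z_eq (I : Ideal (MvPolynomial (Fin n) k)) : Z k I = projZeros I := by
  ext v; simp [Z, projZeros, aeval_eq_eval]

lemma T_eq (I : Ideal (MvPolynomial (Fin n) k)) (v : Fin n → k) :
    T I v = tangentSpace I v := by
  ext w; simp [T, tangentSpace, d1, aeval_eq_eval, Submodule.mem_iInf]

lemma mem_Z_span {S : Set (MvPolynomial (Fin n) k)} {v : Fin n → L} :
    v ∈ Z L (Ideal.span S) ↔ ∀ f ∈ S, aeval v f = 0 := by
  constructor
  · exact fun h f hf => h f (Ideal.subset_span hf)
  · intro h f hf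
    have : Ideal.span S ≤ RingHom.ker (aeval v : MvPolynomial (Fin n) k →ₐ[k] L) :=
      Ideal.span_le.2 fun s hs => h s hs
    exact this hf

lemma mem_T_span {S : Set (MvPolynomial (Fin n) k)} {v w : Fin n → L}
    (hv : v ∈ Z L (Ideal.span S)) :
    w ∈ T (Ideal.span S) v ↔ ∀ f ∈ S, d1 f v w = 0 := by
  constructor
  · exact fun h f hf => h f (Ideal.subset_span hf)
  · intro h f hf
    induction hf using Submodule.span_induction with
    | mem x hx => exact h x hx
    | zero => exact d1_zero v w
    | add x y _ _ hx hy => rw [d1_add, hx, hy, add_zero]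
    | smul a x hx ih => rw [smul_eq_mul, d1_mul, ih, hv x hx]; simp

lemma taylor1 {S : Type} [CommRing S] [Algebra k S] (N : Ideal S) (a : Fin n → S) (v : Fin n → k)
    (h : ∀ j, a j - algebraMap k S (v j) ∈ N) (f : MvPolynomial (Fin n) k) :
    aeval a f - algebraMap k S (eval v f)
      - ∑ j, algebraMap k S (eval v (pderiv j f)) * (a j - algebraMap k S (v j)) ∈ N ^ 2 := by
  induction f using MvPolynomial.induction_on with
  | C c => simp
  | add p q hp hq =>
    convert! add_mem hp hq using 1
    simp only [map_add, add_mul, Finset.sum_add_distrib]; ring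
  | mul_X p i hp =>
    set s := ∑ j, algebraMap k S (eval v (pderiv j p)) * (a j - algebraMap k S (v j)) with hs
    have hsN : s ∈ N := Ideal.sum_mem _ fun j _ => Ideal.mul_mem_left _ _ (h j)
    have e : ∑ j, algebraMap k S (eval v (pderiv j (p * X i))) * (a j - algebraMap k S (v j))
        = algebraMap k S (eval v p) * (a i - algebraMap k S (v i)) + algebraMap k S (v i) * s := by
      simp only [hs, Derivation.leibniz, pderiv_X, smul_eq_mul, map_add, map_mul, add_mul,
        Finset.sum_add_distrib, Finset.mul_sum, mul_assoc, eval_X, Pi.single_apply]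
      simp [apply_ite]
    rw [e]
    have h1 : s * (a i - algebraMap k S (v i)) ∈ N ^ 2 := by
      rw [pow_two]; exact Ideal.mul_mem_mul hsN (h i)
    convert! add_mem (Ideal.mul_mem_right (a i) _ hp) h1 using 1
    simp only [map_mul, aeval_X, eval_X]; ring

lemma taylor2 {S : Type} [CommRing S] [Algebra k S] (N : Ideal S) (a : Fin n → S) (v : Fin n → k)
    (h : ∀ j, a j - algebraMap k S (v j) ∈ N) (f : MvPolynomial (Fin n) k) :
    2 * aeval a f - 2 * algebraMap k S (eval v f)
      - 2 * ∑ j, algebraMap k S (eval v (pderiv j f)) * (a j - algebraMap k S (v j))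
      - ∑ i, ∑ j, algebraMap k S (eval v (pderiv i (pderiv j f))) * (a i - algebraMap k S (v i))
        * (a j - algebraMap k S (v j)) ∈ N ^ 3 := by
  induction f using MvPolynomial.induction_on with
  | C c => simp
  | add p q hp hq =>
    convert! add_mem hp hq using 1
    simp only [map_add, add_mul, Finset.sum_add_distrib]; ring
  | mul_X p i hp =>
    set s := ∑ j, algebraMap k S (eval v (pderiv j p)) * (a j - algebraMap k S (v j)) with hs
    set t := ∑ i, ∑ j, algebraMap k S (eval v (pderiv i (pderiv j p)))
      * (a i - algebraMap k S (v i)) * (a j - algebraMap k S (v j)) with ht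
    have htN : t ∈ N ^ 2 := Ideal.sum_mem _ fun i _ => Ideal.sum_mem _ fun j _ => by
      rw [pow_two, mul_assoc]; exact Ideal.mul_mem_left _ _ (Ideal.mul_mem_mul (h i) (h j))
    have e : ∑ j, algebraMap k S (eval v (pderiv j (p * X i))) * (a j - algebraMap k S (v j))
        = algebraMap k S (eval v p) * (a i - algebraMap k S (v i)) + algebraMap k S (v i) * s := by
      simp only [hs, Derivation.leibniz, pderiv_X, smul_eq_mul, map_add, map_mul, add_mul,
        Finset.sum_add_distrib, Finset.mul_sum, mul_assoc, eval_X, Pi.single_apply]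
      simp [apply_ite]
    have e2 : ∑ l, ∑ j, algebraMap k S (eval v (pderiv l (pderiv j (p * X i))))
        * (a l - algebraMap k S (v l)) * (a j - algebraMap k S (v j))
        = algebraMap k S (v i) * t + 2 * (a i - algebraMap k S (v i)) * s := by
      have : ∀ l j, eval v (pderiv l (pderiv j (p * X i))) =
          eval v (pderiv l (pderiv j p)) * v i + (if j = i then eval v (pderiv l p) else 0)
          + (if l = i then eval v (pderiv j p) else 0) := by
        intro l j
        simp only [Derivation.leibniz, pderiv_X, smul_eq_mul, map_add, map_mul, eval_X,
          Pi.single_apply]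
        by_cases h1 : j = i
        · subst h1
          by_cases h2 : l = j
          · subst h2; simp; ring
          · simp [h2, Ne.symm h2]; ring
        · by_cases h2 : l = i
          · subst h2; simp [h1, Ne.symm h1]; ring
          · simp [h1, h2, Ne.symm h1, Ne.symm h2]; ring
      simp only [this, map_add, map_mul, add_mul, Finset.sum_add_distrib, hs, ht, Finset.mul_sum]
      rw [add_assoc]
      congr 1
      · exact Finset.sum_congr rfl fun _ _ => Finset.sum_congr rfl fun _ _ => by ring
      · rw [Finset.sum_comm (s := Finset.univ) (t := Finset.univ) (f := fun x y => algebraMap k S (if x = i then eval v (pderiv y p) else 0) * _ * _)]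
        rw [← Finset.sum_add_distrib]
        refine Finset.sum_congr rfl fun l _ => ?_
        simp only [apply_ite (algebraMap k S), map_zero, ite_mul, zero_mul, Finset.sum_ite_eq',
          Finset.mem_univ, if_true]
        ring
    rw [e, e2]
    have h1 : t * (a i - algebraMap k S (v i)) ∈ N ^ 3 := by
      rw [pow_succ]; exact Ideal.mul_mem_mul htN (h i)
    convert! add_mem (Ideal.mul_mem_right (a i) _ hp) h1 using 1
    simp only [map_mul, aeval_X, eval_X]; ring

end
end GP

namespace GP

section
variable {k L : Type} [Field k] [Field L] [Algebra k L] [CharZero k]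

open scoped IntermediateField.algebraAdjoinAdjoin in
lemma exists_derivation_basis {ι : Type} {v : ι → L} (hv : IsTranscendenceBasis k v) (c : ι → L) :
    ∃ D : Derivation k L L, ∀ i, D (v i) = c i := by
  have : CharZero L := charZero_of_injective_algebraMap (algebraMap k L).injective
  have halg := hv.isAlgebraic_field
  have e1 : Algebra.FormallyEtale (IntermediateField.adjoin k (Set.range v)) L :=
    Algebra.FormallyEtale.of_isSeparable _ L
  have e2 : Algebra.FormallyEtale (Algebra.adjoin k (Set.range v))
      (IntermediateField.adjoin k (Set.range v)) := .of_isLocalization (nonZeroDivisors _)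
  have e3 : Algebra.FormallyEtale (Algebra.adjoin k (Set.range v)) L :=
    .comp _ (IntermediateField.adjoin k (Set.range v)) _
  let e := hv.1.aevalEquiv
  let ρ : MvPolynomial ι k →ₐ[k] TrivSqZeroExt L L :=
    aeval (fun i => TrivSqZeroExt.inl (v i) + TrivSqZeroExt.inr (c i))
  have hρ : ∀ f, (ρ f).fst = aeval v f := by
    intro f
    have : (TrivSqZeroExt.fstHom k L L).comp ρ = aeval v := by
      ext i; simp [ρ]
    exact congrArg (fun g => g f) this
  have he : ∀ s, aeval v (e.symm s) = (s : L) := by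
    intro s
    rw [← AlgebraicIndependent.algebraMap_aevalEquiv hv.1, AlgEquiv.apply_symm_apply]
    rfl
  let d : Derivation k (Algebra.adjoin k (Set.range v)) L := Derivation.mk'
    ((TrivSqZeroExt.sndHom L L).restrictScalars k ∘ₗ ρ.toLinearMap ∘ₗ e.symm.toLinearMap) (by
      intro a b
      simp [hρ, he]
      simp [Algebra.smul_def]
      exact mul_comm _ _)
  let φ := (d.liftKaehlerDifferential).liftBaseChange L
  let ψ := φ ∘ₗ (KaehlerDifferential.tensorKaehlerEquivOfFormallyEtale k
    (Algebra.adjoin k (Set.range v)) L).symm.toLinearMap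
  refine ⟨ψ.compDer (KaehlerDifferential.D k L), fun i => ?_⟩
  have hi : v i ∈ Algebra.adjoin k (Set.range v) := Algebra.subset_adjoin ⟨i, rfl⟩
  have h1 := KaehlerDifferential.tensorKaehlerEquivOfFormallyEtale_symm_D_algebraMap k
    (Algebra.adjoin k (Set.range v)) L ⟨v i, hi⟩
  have h3 : e.symm ⟨v i, hi⟩ = X i := by
    rw [AlgEquiv.symm_apply_eq]
    apply Subtype.ext
    exact ((AlgebraicIndependent.algebraMap_aevalEquiv hv.1 (X i)).trans (by simp)).symm
  have h2 : d ⟨v i, hi⟩ = c i := by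
    simp [d, h3, ρ]
  have h4 : (algebraMap (Algebra.adjoin k (Set.range v)) L ⟨v i, hi⟩) = v i := rfl
  rw [h4] at h1
  simp [ψ, φ, h1, h2]

lemma exists_derivation {n : ℕ} {q : Fin n → L} (hq : AlgebraicIndependent k q) (c : Fin n → L) :
    ∃ D : Derivation k L L, ∀ i, D (q i) = c i := by
  obtain ⟨t, hst, ht⟩ := exists_isTranscendenceBasis_superset (R := k) (A := L)
    (s := Set.range q) hq.coe_range
  classical
  obtain ⟨D, hD⟩ := exists_derivation_basis ht
    (fun x => if h : ∃ i, q i = x then c h.choose else 0)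
  refine ⟨D, fun i => ?_⟩
  have := hD ⟨q i, hst ⟨i, rfl⟩⟩
  have hex : ∃ j, q j = q i := ⟨i, rfl⟩
  simp only [hex, dif_pos] at this
  rw [this]
  congr 1
  exact hq.injective hex.choose_spec

end

section
variable {k L : Type} [Field k] [CommRing L] [Algebra k L] {n : ℕ}

lemma chain (D : Derivation k L L) (v : Fin n → L) (f : MvPolynomial (Fin n) k) :
    D (aeval v f) = d1 f v (fun i => D (v i)) := by
  induction f using MvPolynomial.induction_on with
  | C a => simp [d1_C]
  | add p q hp hq => simp [d1_add, hp, hq]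
  | mul_X p i hp => 
    rw [d1_mul, d1_X, map_mul, D.leibniz, hp]; simp

lemma chain2 (D : Derivation k L L) (v w : Fin n → L) (f : MvPolynomial (Fin n) k) :
    D (d1 f v w) = d2 f v (fun i => D (v i)) w + d1 f v (fun i => D (w i)) := by
  simp only [d1, map_sum, D.leibniz, chain, smul_eq_mul, Finset.sum_add_distrib, d2]
  rw [add_comm]
  congr 1
  rw [Finset.sum_comm]
  refine Finset.sum_congr rfl fun i _ => ?_
  rw [Finset.mul_sum]
  exact Finset.sum_congr rfl fun j _ => by ring

lemma d2_add_left (f : MvPolynomial (Fin n) k) (v w w' u : Fin n → L) :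
    d2 f v (w + w') u = d2 f v w u + d2 f v w' u := by
  simp [d2, mul_add, add_mul, Finset.sum_add_distrib]

lemma d2_add_right (f : MvPolynomial (Fin n) k) (v w w' u : Fin n → L) :
    d2 f v u (w + w') = d2 f v u w + d2 f v u w' := by
  simp [d2, mul_add, Finset.sum_add_distrib]

lemma d2_smul_left (f : MvPolynomial (Fin n) k) (v w u : Fin n → L) (c : L) :
    d2 f v (c • w) u = c * d2 f v w u := by
  simp only [d2, Finset.mul_sum, Pi.smul_apply, smul_eq_mul]
  exact Finset.sum_congr rfl fun i _ => Finset.sum_congr rfl fun i _ => by ring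

lemma d2_smul_right (f : MvPolynomial (Fin n) k) (v w u : Fin n → L) (c : L) :
    d2 f v u (c • w) = c * d2 f v u w := by
  simp only [d2, Finset.mul_sum, Pi.smul_apply, smul_eq_mul]
  exact Finset.sum_congr rfl fun i _ => Finset.sum_congr rfl fun i _ => by ring

lemma d2_comm (f : MvPolynomial (Fin n) k) (v w u : Fin n → L) :
    d2 f v w u = d2 f v u w := by
  unfold d2
  rw [Finset.sum_comm]
  refine Finset.sum_congr rfl fun i _ => Finset.sum_congr rfl fun j _ => ?_
  have : pderiv j (pderiv i f) = pderiv i (pderiv j f) := by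
    have h : ⁅(pderiv j : Derivation k (MvPolynomial (Fin n) k) (MvPolynomial (Fin n) k)),
        (pderiv i : Derivation k (MvPolynomial (Fin n) k) (MvPolynomial (Fin n) k))⁆ = 0 := by
      apply MvPolynomial.derivation_ext
      intro l
      by_cases h1 : l = i <;> by_cases h2 : l = j <;>
        simp [Derivation.commutator_apply, pderiv_X, Pi.single_apply, h1, h2, apply_ite]
    have := congrArg (fun D => D f) h
    simpa [Derivation.commutator_apply, sub_eq_zero] using this
  rw [this]; ring

lemma euler1 {f : MvPolynomial (Fin n) k} {d : ℕ} (hf : f.IsHomogeneous d) (v : Fin n → L) :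
    d1 f v v = d * aeval v f := by
  have := congrArg (aeval v) hf.sum_X_mul_pderiv
  simp only [map_sum, map_mul, aeval_X, map_nsmul] at this
  rw [nsmul_eq_mul] at this
  rw [← this, d1]
  exact Finset.sum_congr rfl fun i _ => by ring

lemma euler2 {f : MvPolynomial (Fin n) k} {d : ℕ} (hf : f.IsHomogeneous d) (v w : Fin n → L) :
    d2 f v v w = (d - 1 : ℕ) * d1 f v w := by
  unfold d2 
  rw [Finset.sum_comm]
  rw [d1, Finset.mul_sum]
  refine Finset.sum_congr rfl fun j _ => ?_
  rw [← mul_assoc, ← euler1 (hf.pderiv (i := j)) v, d1, Finset.sum_mul]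

lemma d2_eq_d1 (f : MvPolynomial (Fin n) k) (v w u : Fin n → L) :
    d2 f v w u = ∑ j, d1 (pderiv j f) v w * u j := by
  unfold d2 d1
  rw [Finset.sum_comm]
  simp [Finset.sum_mul]

lemma D_mem_T {I : Ideal (MvPolynomial (Fin n) k)} (D : Derivation k L L) {v : Fin n → L}
    (hv : v ∈ Z L I) : (fun i => D (v i)) ∈ T I v := fun f hf => by
  rw [← chain, hv f hf, map_zero]

/-- homogeneous generation -/
def Hom (I : Ideal (MvPolynomial (Fin n) k)) : Prop :=
  ∃ S : Set (MvPolynomial (Fin n) k), I = Ideal.span S ∧ ∀ g ∈ S, ∃ d, g.IsHomogeneous d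

lemma self_mem_T {I : Ideal (MvPolynomial (Fin n) k)} (hI : Hom I) {v : Fin n → L}
    (hv : v ∈ Z L I) : v ∈ T I v := by
  obtain ⟨S, rfl, hS⟩ := hI
  rw [mem_T_span hv]
  intro f hf
  obtain ⟨d, hd⟩ := hS f hf
  rw [euler1 hd, hv f (Ideal.subset_span hf), mul_zero]

end
end GP

namespace GP

section
variable {L : Type} [Field L]

lemma le_span_pair {V : Type} [AddCommGroup V] [Module L V] [FiniteDimensional L V]
    {T : Submodule L V} (hT : Module.finrank L T ≤ 2) {v w : V} (hv : v ∈ T) (hv0 : v ≠ 0)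
    (hw : w ∈ T) (hvw : ∀ c : L, w ≠ c • v) : T ≤ Submodule.span L {v, w} := by
  have hli : LinearIndependent L ![v, w] := by
    rw [LinearIndependent.pair_iff' hv0]
    exact fun c h => hvw c h.symm
  have h2 : Module.finrank L (Submodule.span L {v, w}) = 2 := by
    have := finrank_span_eq_card hli
    rw [Matrix.range_cons, Matrix.range_cons, Matrix.range_empty, Set.union_empty] at this
    exact this
  refine (Submodule.eq_of_le_of_finrank_le (Submodule.span_le.2 ?_) (by omega)).ge
  rintro x (rfl | rfl)
  · exact hv
  · exact hw

lemma finrank_le_two_of {V : Type} [AddCommGroup V] [Module L V] [FiniteDimensional L V]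
    {T : Submodule L V}
    (h : ∀ w : Fin 3 → V, (∀ i, w i ∈ T) → ¬ LinearIndependent L w) : Module.finrank L T ≤ 2 := by
  by_contra hlt
  push Not at hlt
  let b := Module.finBasis L T
  let e : Fin 3 → Fin (Module.finrank L T) := Fin.castLE hlt
  refine h (fun i => (b (e i) : V)) (fun i => (b (e i)).2) ?_
  have h1 : LinearIndependent L (b ∘ e) := b.linearIndependent.comp e (Fin.castLE_injective hlt)
  exact h1.map' T.subtype T.ker_subtype

lemma finrank_span_le_one {V : Type} [AddCommGroup V] [Module L V] (v : V) :
    Module.finrank L (Submodule.span L {v}) ≤ 1 := by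
  simpa using finrank_span_le_card (R := L) ({v} : Set V)

lemma exists_not_mem {V : Type} [AddCommGroup V] [Module L V] [FiniteDimensional L V]
    (W : Submodule L V) (h : Module.finrank L W < Module.finrank L V) : ∃ c, c ∉ W := by
  by_contra hc
  push Not at hc
  have : W = ⊤ := eq_top_iff.2 fun x _ => hc x
  rw [this, finrank_top] at h
  exact lt_irrefl _ h

end

section
variable {k L : Type} [Field k] [Field L] [Algebra k L] [CharZero k]
  {I : Ideal (MvPolynomial (Fin 4) k)} {q : Fin 4 → L}

lemma L2 (hI : Hom I) (hq : AlgebraicIndependent k q) {v1 v2 : Fin 4 → L} (h1 : v1 ∈ Z L I)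
    (h2 : v2 ∈ Z L I) {a b : L} (hab : q = a • v1 + b • v2) : T I v1 ⊔ T I v2 = ⊤ := by
  rw [eq_top_iff]
  intro c _
  obtain ⟨D, hD⟩ := exists_derivation hq c
  have : c = (D a • v1 + a • (fun i => D (v1 i))) + (D b • v2 + b • (fun i => D (v2 i))) := by
    ext i
    rw [← hD i, hab]
    simp; ring
  rw [this]
  refine Submodule.add_mem_sup (add_mem ?_ ?_) (add_mem ?_ ?_)
  · exact Submodule.smul_mem _ _ (self_mem_T hI h1)
  · exact Submodule.smul_mem _ _ (D_mem_T D h1)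
  · exact Submodule.smul_mem _ _ (self_mem_T hI h2)
  · exact Submodule.smul_mem _ _ (D_mem_T D h2)

lemma not_prop (hI : Hom I) (hq : AlgebraicIndependent k q) {v : Fin 4 → L} (h1 : v ∈ Z L I)
    (hT : Module.finrank L (T I v) ≤ 2) (a : L) : q ≠ a • v := by
  intro h
  have := L2 hI hq h1 h1 (a := a) (b := 0) (by simp [h])
  rw [sup_idem] at this
  rw [this, finrank_top] at hT
  simp at hT

lemma L1 (hI : Hom I) (hq : AlgebraicIndependent k q) {v : Fin 4 → L} (h1 : v ∈ Z L I)
    (hv0 : v ≠ 0) (hT : Module.finrank L (T I v) ≤ 2) : q ∉ T I v := by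
  intro hqT
  have hspan := le_span_pair hT (self_mem_T hI h1) hv0 hqT (not_prop hI hq h1 hT)
  obtain ⟨S, hS, hSh⟩ := id hI
  have key : ∀ c : Fin 4 → L, ∃ β : L, ∀ f ∈ S, d1 f v c = β * d2 f v q q := by
    intro c
    obtain ⟨D, hD⟩ := exists_derivation hq c
    obtain ⟨α, β, h⟩ := Submodule.mem_span_pair.1 (hspan (D_mem_T D h1))
    refine ⟨-β, fun f hf => ?_⟩
    have hfI : f ∈ I := hS ▸ Ideal.subset_span hf
    obtain ⟨d, hd⟩ := hSh f hf
    have e := chain2 D v q f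
    rw [hqT f hfI, map_zero, ← h, d2_add_left, d2_smul_left, d2_smul_left, euler2 hd,
      hqT f hfI] at e
    have : (fun i => D (q i)) = c := funext hD
    rw [this] at e
    linear_combination -e
  have memT : ∀ w, (∀ f ∈ S, d1 f v w = 0) → w ∈ T I v := by
    intro w hw
    subst hS
    exact (mem_T_span h1).2 hw
  obtain ⟨c1, hc1⟩ := exists_not_mem (T I v) (by simp; omega)
  obtain ⟨c2, hc2⟩ := exists_not_mem (T I v ⊔ Submodule.span L {c1}) (by
    have := Submodule.finrank_add_le_finrank_add_finrank (T I v) (Submodule.span L {c1})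
    have := finrank_span_le_one (L := L) c1
    simp; omega)
  obtain ⟨β1, h1'⟩ := key c1
  obtain ⟨β2, h2'⟩ := key c2
  by_cases hb : β1 = 0
  · exact hc1 (memT c1 fun f hf => by rw [h1' f hf, hb, zero_mul])
  · have hm : c2 - (β2 / β1) • c1 ∈ T I v := memT _ fun f hf => by
      rw [sub_eq_add_neg, ← neg_smul, d1_add_right, d1_smul_right, h1' f hf, h2' f hf]
      field_simp; ring
    apply hc2
    have := Submodule.add_mem_sup hm (Submodule.smul_mem (Submodule.span L {c1}) (β2 / β1)
      (Submodule.mem_span_singleton_self c1))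
    simpa using this

lemma L3 (hI : Hom I) (hq : AlgebraicIndependent k q) {v1 v2 v3 : Fin 4 → L} (h1 : v1 ∈ Z L I)
    (h2 : v2 ∈ Z L I) (h3 : v3 ∈ Z L I) (h20 : v2 ≠ 0) (h30 : v3 ≠ 0)
    (hT1 : Module.finrank L (T I v1) ≤ 2) (hT2 : Module.finrank L (T I v2) ≤ 2)
    (hT3 : Module.finrank L (T I v3) ≤ 2)
    {a b c d : L} (hab : q = a • v1 + b • v2) (hcd : v3 = c • v1 + d • v2)
    (h31 : ∀ t : L, v3 ≠ t • v1) (h32 : ∀ t : L, v3 ≠ t • v2) : False := by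
  have hc : c ≠ 0 := fun h => h32 d (by simp [hcd, h])
  have hd : d ≠ 0 := fun h => h31 c (by simp [hcd, h])
  have ha : a ≠ 0 := fun h => not_prop hI hq h2 hT2 b (by simp [hab, h])
  have hb : b ≠ 0 := fun h => not_prop hI hq h1 hT1 a (by simp [hab, h])
  have t12 := L2 hI hq h1 h2 hab
  have t23 : T I v2 ⊔ T I v3 = ⊤ := L2 hI hq h2 h3 (a := b - a * d / c) (b := a / c) (by
    rw [hcd, hab]; ext i; simp; field_simp; ring)
  have hdim := Submodule.finrank_sup_add_finrank_inf_eq (T I v1) (T I v2)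
  rw [t12, finrank_top, Module.finrank_fin_fun] at hdim
  have hinf : T I v1 ⊓ T I v2 = ⊥ := by
    rw [← Submodule.finrank_eq_zero (R := L)]; omega
  have disj : ∀ x, x ∈ T I v1 → x ∈ T I v2 → x = 0 := fun x hx1 hx2 => by
    have : x ∈ T I v1 ⊓ T I v2 := ⟨hx1, hx2⟩
    rw [hinf] at this; simpa using this
  have s1 := self_mem_T hI h1
  have s2 := self_mem_T hI h2
  have s3 := self_mem_T hI h3
  obtain ⟨w, hwT, hw⟩ : ∃ w ∈ T I v2, ∀ t : L, w ≠ t • v2 := by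
    by_contra hcon
    push Not at hcon
    have : T I v2 ≤ Submodule.span L {v2} := fun w hw => by
      obtain ⟨t, ht⟩ := hcon w hw
      rw [ht]; exact Submodule.smul_mem _ _ (Submodule.mem_span_singleton_self v2)
    have := Submodule.finrank_mono this
    have := finrank_span_le_one (L := L) v2
    omega
  obtain ⟨D, hD⟩ := exists_derivation hq w
  have m1 := D_mem_T D h1
  have m2 := D_mem_T D h2
  have m3 := D_mem_T D h3
  set w1 : Fin 4 → L := fun i => D (v1 i) with hw1
  set w2 : Fin 4 → L := fun i => D (v2 i) with hw2
  set w3 : Fin 4 → L := fun i => D (v3 i) with hw3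
  have eqw : w = (D a • v1 + a • w1) + (D b • v2 + b • w2) := by
    ext i
    rw [← hD i, hab]
    simp [hw1, hw2]; ring
  have e3 : w3 = D c • v1 + c • w1 + (D d • v2 + d • w2) := by
    ext i
    simp only [hw3, hcd]
    simp [hw1, hw2]; ring
  have z1 : D a • v1 + a • w1 = 0 := by
    apply disj
    · exact add_mem (Submodule.smul_mem _ _ s1) (Submodule.smul_mem _ _ m1)
    · have : D a • v1 + a • w1 = w - (D b • v2 + b • w2) := by rw [eqw]; abel
      rw [this]
      exact sub_mem hwT (add_mem (Submodule.smul_mem _ _ s2) (Submodule.smul_mem _ _ m2))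
  have ew1 : w1 = (-(D a / a)) • v1 := by
    ext i
    have := congrFun z1 i
    simp at this ⊢
    field_simp; linear_combination this
  have hw2n : ∀ t : L, w2 ≠ t • v2 := by
    intro t ht
    refine hw (D b + b * t) ?_
    rw [eqw, z1, ht]
    ext i; simp; ring
  set W := Submodule.span L {v1} ⊔ T I v2 with hW
  have hv1W : v1 ∈ W := Submodule.mem_sup_left (Submodule.mem_span_singleton_self v1)
  have hTW : T I v2 ≤ W := le_sup_right
  have hv3W : v3 ∈ W := by
    rw [hcd]; exact add_mem (Submodule.smul_mem _ _ hv1W) (Submodule.smul_mem _ _ (hTW s2))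
  have hw3W : w3 ∈ W := by
    rw [e3, ew1]
    exact add_mem (add_mem (Submodule.smul_mem _ _ hv1W) (Submodule.smul_mem _ _
      (Submodule.smul_mem _ _ hv1W))) (add_mem (Submodule.smul_mem _ _ (hTW s2))
      (Submodule.smul_mem _ _ (hTW m2)))
  by_cases hex : ∃ e : L, w3 = e • v3
  · obtain ⟨e, he⟩ := hex
    have hx : w2 = ((e * c - D c + c * (D a / a)) / d) • v1 + ((e * d - D d) / d) • v2 := by
      ext i
      have := congrFun (e3.symm.trans he) i
      rw [ew1, hcd] at this
      simp at this ⊢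
      field_simp
      field_simp at this
      linear_combination this
    set x := ((e * c - D c + c * (D a / a)) / d) • v1
    set y := ((e * d - D d) / d)
    have : x = 0 := disj x (Submodule.smul_mem _ _ s1) (by
      have : x = w2 - y • v2 := by rw [hx]; abel
      rw [this]; exact sub_mem m2 (Submodule.smul_mem _ _ s2))
    exact hw2n y (by rw [hx, this, zero_add])
  · push Not at hex
    have h := le_span_pair hT3 s3 h30 m3 hex
    have h' : T I v3 ≤ W := h.trans (Submodule.span_le.2 (by
      rintro x (rfl | rfl)
      · exact hv3W
      · exact hw3W))
    have htop : (⊤ : Submodule L (Fin 4 → L)) ≤ W := by rw [← t23]; exact sup_le hTW h'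
    have f1 := Submodule.finrank_mono htop
    have f2 := Submodule.finrank_add_le_finrank_add_finrank (Submodule.span L {v1}) (T I v2)
    have f3 := finrank_span_le_one (L := L) v1
    rw [finrank_top, Module.finrank_fin_fun, hW] at f1
    omega

end
end GP

namespace GP

section
variable {k : Type} [Field k]

open Filter in
lemma exists_ultra (B : Set (Fin 4 → k))
    (hB : ∀ G : MvPolynomial (Fin 4) k, (∀ Q ∈ B, eval Q G = 0) → G = 0) :
    ∃ (L : Type) (_ : Field L) (_ : Algebra k L) (U : Ultrafilter B) (π : (B → k) →ₐ[k] L),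
      Function.Surjective π ∧ (∀ g, π g = 0 ↔ ∀ᶠ x in (U : Filter B), g x = 0) ∧
      AlgebraicIndependent k (fun j : Fin 4 => π (fun x => x.1 j)) := by
  classical
  let F : Filter B := ⨅ G : {G : MvPolynomial (Fin 4) k // G ≠ 0},
    𝓟 {x : B | eval x.1 G.1 ≠ 0}
  have hne : F.NeBot := by
    have : Nonempty {G : MvPolynomial (Fin 4) k // G ≠ 0} := ⟨⟨1, one_ne_zero⟩⟩
    refine iInf_neBot_of_directed' (α := B) ?_ ?_
    · intro G H
      refine ⟨⟨G.1 * H.1, mul_ne_zero G.2 H.2⟩, ?_, ?_⟩ <;>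
      · change 𝓟 _ ≤ 𝓟 _
        rw [Filter.principal_mono]
        intro x hx
        simp at hx ⊢
        tauto
    · intro G
      rw [Filter.principal_neBot_iff]
      by_contra hemp
      rw [Set.not_nonempty_iff_eq_empty] at hemp
      apply G.2
      apply hB
      intro Q hQ
      by_contra hQ'
      have : (⟨Q, hQ⟩ : B) ∈ ({x : B | eval x.1 G.1 ≠ 0} : Set B) := hQ'
      rw [hemp] at this
      exact this
  let U := Ultrafilter.of F
  have hU : (U : Filter B) ≤ F := Ultrafilter.of_le F
  let L := Germ (U : Filter B) k
  let ρ : (B → k) →+* L := Germ.coeRingHom (U : Filter B)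
  let : Field L := Germ.instField
  let alg : Algebra k L := (ρ.comp (algebraMap k (B → k))).toAlgebra
  let π : (B → k) →ₐ[k] L := { ρ with commutes' := fun r => rfl }
  have hπ : ∀ g, π g = 0 ↔ ∀ᶠ x in (U : Filter B), g x = 0 := fun g => Germ.coe_eq
  refine ⟨L, inferInstance, alg, U, π, ?_, hπ, ?_⟩
  · intro y
    induction y using Germ.inductionOn with
    | h f => exact ⟨f, rfl⟩
  · rw [algebraicIndependent_iff]
    intro p hp
    by_contra hp0
    have h1 : aeval (fun j : Fin 4 => π (fun x : B => x.1 j)) p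
        = π (aeval (fun j : Fin 4 => (fun x : B => x.1 j)) p) := by
      rw [← MvPolynomial.comp_aeval_apply]
    rw [h1, hπ] at hp
    have h2 : ∀ᶠ x in (U : Filter B), eval x.1 p ≠ 0 :=
      hU (mem_iInf_of_mem (⟨p, hp0⟩ : {G : MvPolynomial (Fin 4) k // G ≠ 0})
        (mem_principal_self _))
    obtain ⟨x, hx1, hx2⟩ := (hp.and h2).exists
    apply hx2
    rw [← hx1]
    have := (MvPolynomial.comp_aeval_apply (fun j : Fin 4 => (fun x : B => x.1 j))
      (Pi.evalAlgHom k (fun _ : B => k) x) p)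
    simp only [Pi.evalAlgHom_apply] at this
    rw [this, aeval_eq_eval]

/-- bad points of type 1 -/
def Bad1 (I : Ideal (MvPolynomial (Fin 4) k)) (Q : Fin 4 → k) : Prop :=
  ∃ v, v ≠ 0 ∧ v ∈ Z k I ∧ Q ∈ T I v

/-- bad points of type 2 -/
def Bad2 (I : Ideal (MvPolynomial (Fin 4) k)) (Q : Fin 4 → k) : Prop :=
  ∃ v1 v2 : Fin 4 → k, ∃ a b : k, ∃ ξ : Fin 4 → k, v1 ≠ 0 ∧ v2 ≠ 0 ∧ v1 ∈ Z k I ∧ v2 ∈ Z k I ∧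
    Q = a • v1 + b • v2 ∧ ξ ≠ 0 ∧ (∀ w ∈ T I v1, ∑ i, ξ i * w i = 0) ∧
    (∀ w ∈ T I v2, ∑ i, ξ i * w i = 0)

/-- bad points of type 3 -/
def Bad3 (I : Ideal (MvPolynomial (Fin 4) k)) (Q : Fin 4 → k) : Prop :=
  ∃ v1 v2 v3 : Fin 4 → k, ∃ a b c d : k, v1 ≠ 0 ∧ v2 ≠ 0 ∧ v3 ≠ 0 ∧ v1 ∈ Z k I ∧ v2 ∈ Z k I ∧
    v3 ∈ Z k I ∧ Q = a • v1 + b • v2 ∧ v3 = c • v1 + d • v2 ∧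
    (∀ t : k, v3 ≠ t • v1) ∧ (∀ t : k, v3 ≠ t • v2)

section transfer
variable {B : Set (Fin 4 → k)} {L : Type} [Field L] [Algebra k L] {U : Ultrafilter B}
  {π : (B → k) →ₐ[k] L} {n : ℕ}

/-- image of a family of vectors -/
def im (π : (B → k) →ₐ[k] L) (V : B → Fin n → k) : Fin n → L := fun j => π (fun x => V x j)

lemma aeval_im (V : B → Fin n → k) (f : MvPolynomial (Fin n) k) :
    aeval (im π V) f = π (fun x => aeval (V x) f) := by
  have h1 : aeval (im π V) f = π (aeval (fun j : Fin n => (fun x : B => V x j)) f) :=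
    (MvPolynomial.comp_aeval_apply _ π f).symm
  rw [h1]
  congr 1
  ext x
  have := (MvPolynomial.comp_aeval_apply (fun j : Fin n => (fun x : B => V x j))
      (Pi.evalAlgHom k (fun _ : B => k) x) f)
  simpa only [Pi.evalAlgHom_apply] using this

lemma d1_im (V W : B → Fin n → k) (f : MvPolynomial (Fin n) k) :
    d1 f (im π V) (im π W) = π (fun x => d1 f (V x) (W x)) := by
  unfold d1
  simp only [aeval_im]
  simp only [im, ← map_mul, ← map_sum]
  congr 1
  ext x
  simp [Finset.sum_apply]

lemma im_surj (hs : Function.Surjective π) (w : Fin n → L) : ∃ W : B → Fin n → k, w = im π W := by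
  choose g hg using hs
  exact ⟨fun x j => g (w j) x, funext fun j => (hg (w j)).symm⟩

lemma im_eq_zero (h0 : ∀ g, π g = 0 ↔ ∀ᶠ x in (U : Filter B), g x = 0) (W : B → Fin n → k) :
    im π W = 0 ↔ ∀ᶠ x in (U : Filter B), W x = 0 := by
  simp only [funext_iff, im, Pi.zero_apply, h0]
  rw [Filter.eventually_all]

lemma im_mem_Z {I : Ideal (MvPolynomial (Fin n) k)} {V : B → Fin n → k} (hV : ∀ x, V x ∈ Z k I) :
    im π V ∈ Z L I := fun f hf => by
  rw [aeval_im]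
  have h : ∀ x, aeval (V x) f = (0 : k) := fun x => mem_Z.1 (hV x) f hf
  simp only [h]
  exact map_zero π

lemma ev_mem_T {I : Ideal (MvPolynomial (Fin n) k)}
    (h0 : ∀ g, π g = 0 ↔ ∀ᶠ x in (U : Filter B), g x = 0)
    {V W : B → Fin n → k} (hV : ∀ x, V x ∈ Z k I) (hW : im π W ∈ T I (im π V)) :
    ∀ᶠ x in (U : Filter B), W x ∈ T I (V x) := by
  obtain ⟨S, hS⟩ : I.FG := IsNoetherian.noetherian I
  subst hS
  have : ∀ᶠ x in (U : Filter B), ∀ f ∈ S, d1 f (V x) (W x) = 0 := by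
    rw [Filter.eventually_all_finset]
    intro f hf
    rw [← h0, ← d1_im]
    exact hW f (Ideal.subset_span hf)
  filter_upwards [this] with x hx
  exact (mem_T_span (hV x)).2 hx

lemma im_add (V W : B → Fin n → k) : im π (fun x => V x + W x) = im π V + im π W := by
  ext j; simp only [im, Pi.add_apply, ← map_add]; rfl

lemma im_smul (c : B → k) (W : B → Fin n → k) : im π (fun x => c x • W x) = π c • im π W := by
  ext j; simp only [im, Pi.smul_apply, smul_eq_mul, ← map_mul]; rfl

lemma im_eq_iff (h0 : ∀ g, π g = 0 ↔ ∀ᶠ x in (U : Filter B), g x = 0) (V W : B → Fin n → k) :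
    im π V = im π W ↔ ∀ᶠ x in (U : Filter B), V x = W x := by
  have : im π V - im π W = im π (fun x => V x - W x) := by
    ext j; simp only [im, Pi.sub_apply, ← map_sub]; rfl
  rw [← sub_eq_zero, this, im_eq_zero h0]
  simp [sub_eq_zero]

lemma im_ne_smul (hs : Function.Surjective π)
    (h0 : ∀ g, π g = 0 ↔ ∀ᶠ x in (U : Filter B), g x = 0) {V W : B → Fin n → k}
    (h : ∀ x, ∀ t : k, V x ≠ t • W x) (t : L) : im π V ≠ t • im π W := by
  obtain ⟨τ, rfl⟩ := hs t
  rw [← im_smul, Ne, im_eq_iff h0]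
  intro hx
  obtain ⟨x, hx⟩ := hx.exists
  exact h x _ hx

lemma im_ne_zero 
    (h0 : ∀ g, π g = 0 ↔ ∀ᶠ x in (U : Filter B), g x = 0) {V : B → Fin n → k}
    (h : ∀ x, V x ≠ 0) : im π V ≠ 0 := by
  rw [Ne, im_eq_zero h0]
  intro hx
  obtain ⟨x, hx⟩ := hx.exists
  exact h x hx

lemma im_finrank {I : Ideal (MvPolynomial (Fin n) k)} (hs : Function.Surjective π)
    (h0 : ∀ g, π g = 0 ↔ ∀ᶠ x in (U : Filter B), g x = 0)
    {V : B → Fin n → k} (hV : ∀ x, V x ∈ Z k I) (hT : ∀ x, Module.finrank k (T I (V x)) ≤ 2) :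
    Module.finrank L (T I (im π V)) ≤ 2 := by
  apply finrank_le_two_of
  intro w hw hli
  have := fun i => im_surj hs (w i)
  choose W hW using this
  have hev : ∀ᶠ x in (U : Filter B), ∀ i, W i x ∈ T I (V x) := by
    rw [Filter.eventually_all]
    exact fun i => ev_mem_T h0 hV (hW i ▸ hw i)
  have hdep : ∀ x, ∃ g : Fin 3 → k, (∀ i, W i x ∈ T I (V x)) → (∑ i, g i • W i x = 0 ∧ g ≠ 0) := by
    intro x
    by_cases hx : ∀ i, W i x ∈ T I (V x)
    · have hn : ¬ LinearIndependent k (fun i => (⟨W i x, hx i⟩ : T I (V x))) := by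
        intro hl
        have := hl.fintype_card_le_finrank
        have := hT x
        simp at *; omega
      rw [Fintype.not_linearIndependent_iff] at hn
      obtain ⟨g, hg, i, hi⟩ := hn
      refine ⟨g, fun _ => ⟨?_, fun h => hi (by simp [h])⟩⟩
      have := congrArg (T I (V x)).subtype hg
      simpa using this
    · exact ⟨0, fun h => absurd h hx⟩
  choose g hg using hdep
  have hz : ∑ i, im π g i • w i = 0 := by
    have h1 : ∑ i, im π g i • w i = im π (fun x => ∑ i, g x i • W i x) := by
      simp only [hW, Fin.sum_univ_three, im_add, im_smul]
      rfl
    rw [h1, im_eq_zero h0]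
    filter_upwards [hev] with x hx using (hg x hx).1
  have := Fintype.linearIndependent_iff.1 hli _ hz
  have hg0 : im π g = 0 := funext this
  rw [im_eq_zero h0] at hg0
  obtain ⟨x, hx1, hx2⟩ := (hg0.and hev).exists
  exact (hg x hx2).2 hx1

end transfer

variable [CharZero k] {I : Ideal (MvPolynomial (Fin 4) k)}

lemma bad1_proper (hI : Hom I) (hT : ∀ v ∈ Z k I, v ≠ 0 → Module.finrank k (T I v) ≤ 2) :
    ∃ G : MvPolynomial (Fin 4) k, G ≠ 0 ∧ ∀ Q, Bad1 I Q → eval Q G = 0 := by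
  by_contra hcon
  push Not at hcon
  obtain ⟨L, _, _, U, π, hs, h0, hq⟩ := exists_ultra {Q | Bad1 I Q} (by
    intro G hG
    by_contra hG0
    obtain ⟨Q, hQ, hQ'⟩ := hcon G hG0
    exact hQ' (hG Q hQ))
  choose v hv0 hvZ hvT using fun x : {Q | Bad1 I Q} => x.2
  have hZ := im_mem_Z (π := π) hvZ
  refine L1 hI hq hZ (im_ne_zero h0 hv0) (im_finrank hs h0 hvZ fun x => hT _ (hvZ x) (hv0 x)) ?_
  intro f hf
  change d1 f (im π v) (im π (fun x => x.1)) = 0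
  rw [d1_im]
  have : (fun x => d1 f (v x) x.1) = (0 : {Q | Bad1 I Q} → k) := funext fun x => hvT x f hf
  rw [this, map_zero]

lemma bad2_proper (hI : Hom I) :
    ∃ G : MvPolynomial (Fin 4) k, G ≠ 0 ∧ ∀ Q, Bad2 I Q → eval Q G = 0 := by
  by_contra hcon
  push Not at hcon
  obtain ⟨L, _, _, U, π, hs, h0, hq⟩ := exists_ultra {Q | Bad2 I Q} (by
    intro G hG
    by_contra hG0
    obtain ⟨Q, hQ, hQ'⟩ := hcon G hG0
    exact hQ' (hG Q hQ))
  choose v1 v2 a b ξ hv10 hv20 hv1Z hv2Z hQ hξ hk1 hk2 using fun x : {Q | Bad2 I Q} => x.2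
  have ht := L2 hI hq (im_mem_Z (π := π) hv1Z) (im_mem_Z (π := π) hv2Z) (a := π a) (b := π b) (by
    rw [← im_smul, ← im_smul, ← im_add]
    funext j
    simp only [im, ← hQ])
  have key : ∀ V : {Q | Bad2 I Q} → Fin 4 → k, (∀ x, V x ∈ Z k I) → 
      (∀ x, ∀ w ∈ T I (V x), ∑ i, ξ x i * w i = 0) → 
      ∀ w ∈ T I (im π V), ∑ i, im π ξ i * w i = 0 := by
    intro V hV h w hw
    obtain ⟨W, rfl⟩ := im_surj hs w
    have := ev_mem_T h0 hV hw
    simp only [im, ← map_mul, ← map_sum]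
    rw [h0]
    filter_upwards [this] with x hx
    simpa using h x _ hx
  refine im_ne_zero (π := π) h0 hξ ?_
  let φ : (Fin 4 → L) →ₗ[L] L := ∑ i, im π ξ i • LinearMap.proj i
  have hφ : ∀ w, φ w = ∑ i, im π ξ i * w i := fun w => by simp [φ]
  have hker : T I (im π v1) ⊔ T I (im π v2) ≤ LinearMap.ker φ := sup_le
    (fun w hw => by rw [LinearMap.mem_ker, hφ]; exact key v1 hv1Z hk1 w hw)
    (fun w hw => by rw [LinearMap.mem_ker, hφ]; exact key v2 hv2Z hk2 w hw)
  rw [ht] at hker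
  funext j
  have := hker (Submodule.mem_top (x := Pi.single j 1))
  rw [LinearMap.mem_ker, hφ] at this
  simpa [Pi.single_apply] using this

lemma bad3_proper (hI : Hom I) (hT : ∀ v ∈ Z k I, v ≠ 0 → Module.finrank k (T I v) ≤ 2) :
    ∃ G : MvPolynomial (Fin 4) k, G ≠ 0 ∧ ∀ Q, Bad3 I Q → eval Q G = 0 := by
  by_contra hcon
  push Not at hcon
  obtain ⟨L, _, _, U, π, hs, h0, hq⟩ := exists_ultra {Q | Bad3 I Q} (by
    intro G hG
    by_contra hG0
    obtain ⟨Q, hQ, hQ'⟩ := hcon G hG0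
    exact hQ' (hG Q hQ))
  choose v1 v2 v3 a b c d hv10 hv20 hv30 hv1Z hv2Z hv3Z hQ hcd hn1 hn2 using
    fun x : {Q | Bad3 I Q} => x.2
  have hr : ∀ V : {Q | Bad3 I Q} → Fin 4 → k, (∀ x, V x ≠ 0) → (∀ x, V x ∈ Z k I) → 
    Module.finrank L (T I (im π V)) ≤ 2 :=
    fun V h1 h2 => im_finrank hs h0 h2 fun x => hT _ (h2 x) (h1 x)
  refine L3 hI hq (im_mem_Z (π := π) hv1Z) (im_mem_Z (π := π) hv2Z) (im_mem_Z (π := π) hv3Z)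
    (im_ne_zero h0 hv20) (im_ne_zero h0 hv30) (hr v1 hv10 hv1Z) (hr v2 hv20 hv2Z) (hr v3 hv30 hv3Z)
    (a := π a) (b := π b) (c := π c) (d := π d) ?_ ?_ (im_ne_smul hs h0 hn1) (im_ne_smul hs h0 hn2)
  · rw [← im_smul, ← im_smul, ← im_add]
    funext j
    simp only [im, ← hQ]
  · rw [← im_smul, ← im_smul, ← im_add]
    funext j
    simp only [im, ← hcd]

end
end GP

namespace GP

section
variable {k : Type} [Field k] {n : ℕ}

lemma aeval_smul_hom {S : Type} [CommRing S] [Algebra k S] {f : MvPolynomial (Fin n) k} {d : ℕ}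
    (hf : f.IsHomogeneous d) (c : S) (a : Fin n → S) :
    aeval (c • a) f = c ^ d * aeval a f := by
  rw [aeval_def, aeval_def, eval₂_eq', eval₂_eq', Finset.mul_sum]
  refine Finset.sum_congr rfl fun s hs => ?_
  have hd := hf.degree_eq_sum_deg_support hs
  simp only [Pi.smul_apply, smul_eq_mul, mul_pow, Finset.prod_mul_distrib]
  have h : s.degree = ∑ i ∈ s.support, s i := rfl
  rw [Finset.prod_pow_eq_pow_sum, ← Finsupp.degree_eq_sum, h, ← hd]
  ring

lemma eval_smul_hom {f : MvPolynomial (Fin n) k} {d : ℕ}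
    (hf : f.IsHomogeneous d) (c : k) (a : Fin n → k) :
    eval (c • a) f = c ^ d * eval a f := by
  have := aeval_smul_hom hf c a
  simpa [aeval_eq_eval] using this

lemma eval_comp_zero [Infinite k] {G : MvPolynomial (Fin n) k} {Q : Fin n → k}
    (h : ∀ t : k, eval (t • Q) G = 0) (i : ℕ) : eval Q (homogeneousComponent i G) = 0 := by
  let p : Polynomial k := ∑ i ∈ Finset.range (G.totalDegree + 1),
    Polynomial.monomial i (eval Q (homogeneousComponent i G))
  have hp : p = 0 := by
    apply Polynomial.funext
    intro t
    have h1 := h t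
    conv_lhs at h1 => rw [← sum_homogeneousComponent G, map_sum]
    rw [Polynomial.eval_zero, ← h1, Polynomial.eval_finsetSum]
    refine Finset.sum_congr rfl fun i _ => ?_
    rw [eval_smul_hom (homogeneousComponent_isHomogeneous i G), Polynomial.eval_monomial, mul_comm]
  by_cases hi : i < G.totalDegree + 1
  · have := congrArg (fun p => p.coeff i) hp
    simp only [p, Polynomial.finsetSum_coeff, Polynomial.coeff_monomial, Polynomial.coeff_zero] at this
    rw [Finset.sum_ite_eq' , if_pos (Finset.mem_range.2 hi)] at this
    exact this
  · rw [homogeneousComponent_eq_zero i G (by omega), map_zero]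

lemma exists_hom_vanish [Infinite k] (B : (Fin n → k) → Prop) (hB : ∀ Q, B Q → ∀ t : k, B (t • Q))
    (h : ∃ G : MvPolynomial (Fin n) k, G ≠ 0 ∧ ∀ Q, B Q → eval Q G = 0) :
    ∃ (G : MvPolynomial (Fin n) k) (d : ℕ), G ≠ 0 ∧ G.IsHomogeneous d ∧ ∀ Q, B Q → eval Q G = 0 := by
  obtain ⟨G, hG0, hG⟩ := h
  have : ∃ i, homogeneousComponent i G ≠ 0 := by
    by_contra hc
    push Not at hc
    apply hG0
    rw [← sum_homogeneousComponent G]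
    exact Finset.sum_eq_zero fun i _ => hc i
  obtain ⟨i, hi⟩ := this
  exact ⟨_, i, hi, homogeneousComponent_isHomogeneous i G,
    fun Q hQ => eval_comp_zero (fun t => hG _ (hB Q hQ t)) i⟩

lemma exists_G0 [CharZero k] {I : Ideal (MvPolynomial (Fin 4) k)} (hI : Hom I)
    (hT : ∀ v ∈ Z k I, v ≠ 0 → Module.finrank k (T I v) ≤ 2) :
    ∃ (G : MvPolynomial (Fin 4) k) (d : ℕ), G ≠ 0 ∧ G.IsHomogeneous d ∧
      ∀ Q, eval Q G ≠ 0 → ¬ Bad1 I Q ∧ ¬ Bad2 I Q ∧ ¬ Bad3 I Q := by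
  obtain ⟨G1, d1, n1, h1, e1⟩ := exists_hom_vanish (Bad1 I) (by
    rintro Q ⟨v, h1, h2, h3⟩ t
    exact ⟨v, h1, h2, Submodule.smul_mem _ _ h3⟩) (bad1_proper hI hT)
  obtain ⟨G2, d2, n2, h2, e2⟩ := exists_hom_vanish (Bad2 I) (by
    rintro Q ⟨v1, v2, a, b, ξ, h1, h2, h3, h4, h5, h⟩ t
    exact ⟨v1, v2, t * a, t * b, ξ, h1, h2, h3, h4, by rw [h5]; simp [mul_smul], h⟩) 
    (bad2_proper hI)
  obtain ⟨G3, d3, n3, h3, e3⟩ := exists_hom_vanish (Bad3 I) (by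
    rintro Q ⟨v1, v2, v3, a, b, c, d, h1, h2, h3, h4, h5, h6, h7, h⟩ t
    exact ⟨v1, v2, v3, t * a, t * b, c, d, h1, h2, h3, h4, h5, h6, by rw [h7]; simp [mul_smul], h⟩)
    (bad3_proper hI hT)
  refine ⟨G1 * G2 * G3, _, mul_ne_zero (mul_ne_zero n1 n2) n3, (h1.mul h2).mul h3, ?_⟩
  intro Q hQ
  rw [map_mul, map_mul] at hQ
  refine ⟨fun h => hQ ?_, fun h => hQ ?_, fun h => hQ ?_⟩
  · simp [e1 Q h]
  · simp [e2 Q h]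
  · simp [e3 Q h]

lemma Hom.comp_mem {I : Ideal (MvPolynomial (Fin n) k)} (hI : Hom I) {f : MvPolynomial (Fin n) k}
    (hf : f ∈ I) (i : ℕ) : homogeneousComponent i f ∈ I := by
  let := MvPolynomial.gradedAlgebra (σ := Fin n) (R := k)
  obtain ⟨S, rfl, hS⟩ := hI
  exact homogeneousComponent_mem_of_mem (Ideal.homogeneous_span _ _ fun x hx => hS x hx) hf i

lemma smul_mem_Z {S : Type} [CommRing S] [Algebra k S] {I : Ideal (MvPolynomial (Fin n) k)}
    (hI : Hom I) {v : Fin n → S} (hv : v ∈ Z S I) (c : S) : c • v ∈ Z S I := by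
  obtain ⟨S, rfl, hS⟩ := hI
  rw [mem_Z_span] at hv ⊢
  intro f hf
  obtain ⟨d, hd⟩ := hS f hf
  rw [aeval_smul_hom hd, hv f hf, mul_zero]

/-- homogenization with respect to a linear form -/
lemma homogenize {m : MvPolynomial (Fin n) k} (hm : m.IsHomogeneous 1)
    (f : MvPolynomial (Fin n) k) : ∃ (N : ℕ) (G : MvPolynomial (Fin n) k), G.IsHomogeneous N ∧
      ∀ (E : Type) [CommRing E] [Algebra k E] (a : Fin n → E) (c : E), aeval a m = 1 →
        aeval (c • a) G = c ^ N * aeval a f := by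
  induction f using MvPolynomial.induction_on with
  | C r => exact ⟨0, C r, isHomogeneous_C _ _, fun E _ _ a c _ => by simp⟩
  | add p q hp hq =>
    obtain ⟨N, G, hG, h⟩ := hp
    obtain ⟨M, H, hH, h'⟩ := hq
    refine ⟨N + M, G * m ^ M + H * m ^ N, ?_, ?_⟩
    · refine IsHomogeneous.add ?_ ?_
      · have := hG.mul (hm.pow M); rwa [one_mul] at this
      · have := hH.mul (hm.pow N); rwa [one_mul, add_comm] at this
    · intro E _ _ a c ha
      rw [map_add, map_mul, map_mul, map_pow, map_pow, h E a c ha, h' E a c ha, 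
        aeval_smul_hom hm, ha, map_add]
      ring
  | mul_X p i hp =>
    obtain ⟨N, G, hG, h⟩ := hp
    refine ⟨N + 1, G * X i, hG.mul (isHomogeneous_X k i), fun E _ _ a c ha => ?_⟩
    rw [map_mul, h E a c ha, map_mul, aeval_X, aeval_X, Pi.smul_apply, smul_eq_mul]
    ring

end
end GP

namespace GP

section
variable {R A : Type} [CommRing R] [CommRing A] [Algebra R A] [Algebra.IsIntegral R A]

lemma dim_le_quot : ringKrullDim A ≤ ringKrullDim (R ⧸ RingHom.ker (algebraMap R A)) := by
  rw [ringKrullDim_quotient]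
  refine Order.krullDim_le_of_strictMono
    (fun q : PrimeSpectrum A => (⟨PrimeSpectrum.comap (algebraMap R A) q, ?_⟩ :
      PrimeSpectrum.zeroLocus (R := R) (RingHom.ker (algebraMap R A)))) ?_
  · intro x hx
    change algebraMap R A x ∈ q.asIdeal
    have : algebraMap R A x = 0 := hx
    rw [this]; exact zero_mem _
  · intro q q' h
    have h' : q.asIdeal < q'.asIdeal := h
    have := Ideal.IsIntegral.comap_lt_comap (R := R) h'
    exact this

lemma dim_ge_of_injective [IsDomain R] [IsDomain A] (h : Function.Injective (algebraMap R A)) :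
    ringKrullDim R ≤ ringKrullDim A := by
  refine iSup_le fun l => ?_
  obtain ⟨P, hP, hP1, hP2⟩ := Ideal.exists_ideal_over_prime_of_isIntegral_of_isPrime (S := A)
    (RelSeries.head l).asIdeal ⊥ (by
      intro x hx
      have : algebraMap R A x = 0 := by simpa using hx
      rw [(injective_iff_map_eq_zero _).1 h x this]; exact zero_mem _)
  have : P.LiesOver (RelSeries.head l).asIdeal := ⟨hP2.symm⟩
  obtain ⟨L, hL, -⟩ := Ideal.exists_ltSeries_of_hasGoingUp (S := A) l P
  rw [← hL]
  exact le_iSup (fun p : LTSeries (PrimeSpectrum A) => (p.length : WithBot ℕ∞)) L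

end

lemma dim_aux {x y z : WithBot ℕ∞} (h6 : 2 ≤ x) (h4 : x + 1 ≤ y) (h2 : y + 1 ≤ z) (hz : z = 3) :
    False := by
  subst hz
  have h7 := (add_le_add_left h6 1).trans h4
  have h8 := (add_le_add_left h7 1).trans h2
  have h9 : (((2 + 1 + 1 : ℕ) : ℕ∞) : WithBot ℕ∞) ≤ (((3 : ℕ) : ℕ∞) : WithBot ℕ∞) := by
    exact_mod_cast h8
  have h10 := WithBot.coe_le_coe.1 h9
  have h11 : (2 + 1 + 1 : ℕ) ≤ 3 := by exact_mod_cast h10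
  omega

section
variable {R A : Type} [CommRing R] [IsDomain R] [UniqueFactorizationMonoid R] [CommRing A]
  [IsDomain A] [Algebra R A] [Algebra.IsIntegral R A]

lemma dim_step (h3 : ringKrullDim R = 3) (hA : ringKrullDim A = 2) (F g : R) (hF : Prime F)
    (hFP : algebraMap R A F = 0) (hg : algebraMap R A g = 0) (hng : ¬ F ∣ g) : False := by
  have hpr : (Ideal.span {F}).IsPrime := (Ideal.span_singleton_prime hF.ne_zero).2 hF
  have h1 := dim_le_quot (R := R) (A := A)
  have h2 := ringKrullDim_quotient_succ_le_of_nonZeroDivisor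
    (mem_nonZeroDivisors_of_ne_zero hF.ne_zero)
  have hg' : (Ideal.Quotient.mk (Ideal.span {F}) g) ≠ 0 := by
    intro h
    rw [Ideal.Quotient.eq_zero_iff_mem, Ideal.mem_span_singleton] at h
    exact hng h
  have h4 := ringKrullDim_quotient_succ_le_of_nonZeroDivisor (mem_nonZeroDivisors_of_ne_zero hg')
  have hle : Ideal.span {F} ≤ RingHom.ker (algebraMap R A) :=
    (Ideal.span_singleton_le_iff_mem _).2 hFP
  let φ : (R ⧸ Ideal.span {F}) ⧸ Ideal.span {Ideal.Quotient.mk (Ideal.span {F}) g} →+* 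
      R ⧸ RingHom.ker (algebraMap R A) := Ideal.Quotient.lift _ (Ideal.Quotient.factor hle) (by
        intro a ha
        obtain ⟨c, rfl⟩ := Ideal.mem_span_singleton.1 ha
        rw [map_mul]
        have : Ideal.Quotient.factor hle (Ideal.Quotient.mk (Ideal.span {F}) g) = 0 := by
          simp only [Ideal.Quotient.factor_mk]
          rw [Ideal.Quotient.eq_zero_iff_mem]
          exact hg
        rw [this, zero_mul])
  have h5 := ringKrullDim_le_of_surjective φ (Ideal.Quotient.lift_surjective_of_surjective _ _
    (Ideal.Quotient.factor_surjective hle))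
  rw [hA] at h1
  exact dim_aux (h1.trans h5) h4 h2 h3

lemma ker_principal_aux (h3 : ringKrullDim R = 3) (hA : ringKrullDim A = 2) :
    ∃ F : R, Irreducible F ∧ ∀ g, algebraMap R A g = 0 ↔ F ∣ g := by
  have hPp : (RingHom.ker (algebraMap R A)).IsPrime := RingHom.ker_isPrime _
  have hP0 : RingHom.ker (algebraMap R A) ≠ ⊥ := by
    intro h
    have := dim_ge_of_injective (R := R) (A := A) ((RingHom.injective_iff_ker_eq_bot _).2 h)
    rw [hA, h3] at this
    have h9 : (((3 : ℕ) : ℕ∞) : WithBot ℕ∞) ≤ (((2 : ℕ) : ℕ∞) : WithBot ℕ∞) := by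
      exact_mod_cast this
    have h10 := WithBot.coe_le_coe.1 h9
    have h11 : (3 : ℕ) ≤ 2 := by exact_mod_cast h10
    omega
  obtain ⟨F, hFP, hF⟩ := hPp.exists_mem_prime_of_ne_bot hP0
  refine ⟨F, hF.irreducible, fun g => ⟨fun hg => ?_, fun hg => ?_⟩⟩
  · by_contra hng
    exact dim_step h3 hA F g hF hFP hg hng
  · obtain ⟨c, rfl⟩ := hg
    have : algebraMap R A F = 0 := hFP
    rw [map_mul, this, zero_mul]

end

lemma ker_principal {k : Type} [Field k] {A : Type} [CommRing A] [IsDomain A]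
    [Algebra (MvPolynomial (Fin 3) k) A] [Algebra.IsIntegral (MvPolynomial (Fin 3) k) A]
    (hA : ringKrullDim A = 2) : ∃ F : MvPolynomial (Fin 3) k, Irreducible F ∧
    ∀ g, algebraMap _ A g = 0 ↔ F ∣ g := by
  refine ker_principal_aux ?_ hA
  rw [MvPolynomial.ringKrullDim_of_isNoetherianRing, ringKrullDim_eq_zero_of_field]; simp

end GP

namespace GP

section
variable {k : Type} [Field k]

/-- linear map extended to points with values in an algebra -/
noncomputable def lm {E : Type} [CommRing E] [Algebra k E] {n m : ℕ}
    (l : (Fin n → k) →ₗ[k] (Fin m → k)) (b : Fin n → E) : Fin m → E :=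
  fun i => ∑ j, algebraMap k E (l (Pi.single j 1) i) * b j

/-- composition of a polynomial with a linear map -/
noncomputable def pull {n m : ℕ} (l : (Fin n → k) →ₗ[k] (Fin m → k))
    (f : MvPolynomial (Fin m) k) : MvPolynomial (Fin n) k :=
  aeval (lm l (X : Fin n → MvPolynomial (Fin n) k)) f

variable {E E' : Type} [CommRing E] [Algebra k E] [CommRing E'] [Algebra k E'] {n m q : ℕ}

lemma lm_map (l : (Fin n → k) →ₗ[k] (Fin m → k)) (b : Fin n → E) (ρ : E →ₐ[k] E') :
    (fun i => ρ (lm l b i)) = lm l (fun j => ρ (b j)) := by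
  funext i; simp [lm]

lemma lm_self (l : (Fin n → k) →ₗ[k] (Fin m → k)) (v : Fin n → k) : lm l v = l v := by
  funext i
  conv_rhs => rw [pi_eq_sum_univ' v]
  simp [lm, mul_comm]

lemma lm_smul (l : (Fin n → k) →ₗ[k] (Fin m → k)) (c : E) (b : Fin n → E) :
    lm l (c • b) = c • lm l b := by
  funext i
  simp only [lm, Pi.smul_apply, smul_eq_mul, Finset.mul_sum]
  exact Finset.sum_congr rfl fun _ _ => by ring

lemma lm_add (l : (Fin n → k) →ₗ[k] (Fin m → k)) (b b' : Fin n → E) :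
    lm l (b + b') = lm l b + lm l b' := by
  funext i
  simp only [lm, Pi.add_apply, mul_add, Finset.sum_add_distrib]

lemma lm_const (l : (Fin n → k) →ₗ[k] (Fin m → k)) (v : Fin n → k) :
    lm l (fun j => algebraMap k E (v j)) = fun i => algebraMap k E (l v i) := by
  have := lm_map l v (Algebra.ofId k E)
  rw [lm_self] at this
  exact this.symm

lemma lm_sub (l : (Fin n → k) →ₗ[k] (Fin m → k)) (b b' : Fin n → E) :
    lm l (b - b') = lm l b - lm l b' := by
  funext i
  simp only [lm, Pi.sub_apply, mul_sub, Finset.sum_sub_distrib]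

lemma lm_comp (g : (Fin m → k) →ₗ[k] (Fin q → k)) (l : (Fin n → k) →ₗ[k] (Fin m → k))
    (b : Fin n → E) : lm (g ∘ₗ l) b = lm g (lm l b) := by
  funext i
  have h : ∀ j, g (l (Pi.single j 1)) i = ∑ r, g (Pi.single r 1) i * l (Pi.single j 1) r := by
    intro j
    rw [← lm_self g]; simp [lm]
  simp only [lm, LinearMap.comp_apply, h, map_sum, map_mul, Finset.sum_mul, Finset.mul_sum]
  rw [Finset.sum_comm]
  exact Finset.sum_congr rfl fun _ _ => Finset.sum_congr rfl fun _ _ => by ring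

lemma lm_id (b : Fin n → E) : lm (LinearMap.id : (Fin n → k) →ₗ[k] (Fin n → k)) b = b := by
  funext i
  simp [lm, Pi.single_apply, apply_ite]

lemma aeval_pull (l : (Fin n → k) →ₗ[k] (Fin m → k)) (f : MvPolynomial (Fin m) k) (b : Fin n → E) :
    aeval b (pull l f) = aeval (lm l b) f := by
  have : (aeval b : MvPolynomial (Fin n) k →ₐ[k] E).comp (aeval (lm l X)) = aeval (lm l b) := by
    ext i
    have := congrFun (lm_map l X (aeval b : MvPolynomial (Fin n) k →ₐ[k] E)) i
    simp at this
    simpa using this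
  exact DFunLike.congr_fun this f

lemma eval_pull (l : (Fin n → k) →ₗ[k] (Fin m → k)) (f : MvPolynomial (Fin m) k) (b : Fin n → k) :
    eval b (pull l f) = eval (l b) f := by
  have := aeval_pull l f b
  rwa [lm_self, aeval_eq_eval, aeval_eq_eval] at this

lemma lm_hom (l : (Fin n → k) →ₗ[k] (Fin m → k)) (i : Fin m) :
    (lm l (X : Fin n → MvPolynomial (Fin n) k) i).IsHomogeneous 1 := by
  refine IsHomogeneous.sum _ _ _ fun j _ => ?_
  have := (isHomogeneous_C (Fin n) (l (Pi.single j 1) i)).mul (isHomogeneous_X k j)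
  simpa using this

lemma aeval_hom {f : MvPolynomial (Fin m) k} {d e : ℕ} (hf : f.IsHomogeneous d)
    {φ : Fin m → MvPolynomial (Fin n) k} (hφ : ∀ i, (φ i).IsHomogeneous e) :
    (aeval φ f).IsHomogeneous (e * d) := by
  exact hf.aeval φ hφ

lemma pull_hom (l : (Fin n → k) →ₗ[k] (Fin m → k)) {f : MvPolynomial (Fin m) k} {d : ℕ}
    (hf : f.IsHomogeneous d) : (pull l f).IsHomogeneous d := by
  have := aeval_hom hf (lm_hom l)
  rwa [one_mul] at this

lemma pull_pull (g : (Fin m → k) →ₗ[k] (Fin q → k)) (l : (Fin n → k) →ₗ[k] (Fin m → k))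
    (f : MvPolynomial (Fin q) k) : pull l (pull g f) = pull (g ∘ₗ l) f := by
  unfold pull
  rw [← pull, ← pull, lm_comp]
  rw [pull, aeval_pull]

lemma pull_id (f : MvPolynomial (Fin n) k) : pull LinearMap.id f = f := by
  rw [pull, lm_id]; simp

lemma pull_mul (l : (Fin n → k) →ₗ[k] (Fin m → k)) (f g : MvPolynomial (Fin m) k) :
    pull l (f * g) = pull l f * pull l g := map_mul _ _ _

lemma pull_dvd (l : (Fin n → k) →ₗ[k] (Fin m → k)) {f g : MvPolynomial (Fin m) k} (h : f ∣ g) :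
    pull l f ∣ pull l g := by
  obtain ⟨c, rfl⟩ := h; exact ⟨_, pull_mul _ _ _⟩

lemma exists_generic (I : Ideal (MvPolynomial (Fin n) k)) (hI : I.IsPrime) :
    ∃ (K : Type) (_ : Field K) (_ : Algebra k K) (ξ : Fin n → K), ∀ f, aeval ξ f = 0 ↔ f ∈ I := by
  refine ⟨FractionRing (MvPolynomial (Fin n) k ⧸ I), inferInstance, inferInstance,
    fun j => algebraMap _ _ (Ideal.Quotient.mk I (X j)), fun f => ?_⟩
  have h : (aeval fun j => algebraMap (MvPolynomial (Fin n) k ⧸ I)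
      (FractionRing (MvPolynomial (Fin n) k ⧸ I)) (Ideal.Quotient.mk I (X j))) f =
      algebraMap _ _ (Ideal.Quotient.mk I f) := by
    have : (aeval fun j => algebraMap (MvPolynomial (Fin n) k ⧸ I)
      (FractionRing (MvPolynomial (Fin n) k ⧸ I)) (Ideal.Quotient.mk I (X j))) =
      (IsScalarTower.toAlgHom k (MvPolynomial (Fin n) k ⧸ I)
        (FractionRing (MvPolynomial (Fin n) k ⧸ I))).comp (Ideal.Quotient.mkₐ k I) := by
      ext i; simp
    rw [this]; simp
  rw [h, FaithfulSMul.algebraMap_eq_zero_iff, Ideal.Quotient.eq_zero_iff_mem]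

lemma exists_normalized (I : Ideal (MvPolynomial (Fin n) k)) (hI : I.IsPrime) (hH : Hom I)
    {μ : MvPolynomial (Fin n) k} (hμ : μ.IsHomogeneous 1) (hμI : μ ∉ I) :
    ∃ (K : Type) (_ : Field K) (_ : Algebra k K) (a : Fin n → K), aeval a μ = 1 ∧ a ∈ Z K I ∧
      ∀ f d, f.IsHomogeneous d → aeval a f = 0 → f ∈ I := by
  obtain ⟨K, iK, iA, ξ, hξ⟩ := exists_generic I hI
  have h0 : aeval ξ μ ≠ 0 := fun h => hμI ((hξ μ).1 h)
  refine ⟨K, iK, iA, (aeval ξ μ)⁻¹ • ξ, ?_, ?_, ?_⟩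
  · rw [aeval_smul_hom hμ, pow_one, inv_mul_cancel₀ h0]
  · exact smul_mem_Z hH (fun f hf => (hξ f).2 hf) _
  · intro f d hf h
    rw [aeval_smul_hom hf] at h
    rcases mul_eq_zero.1 h with h | h
    · exact absurd h (pow_ne_zero _ (inv_ne_zero h0))
    · exact (hξ f).1 h

end
end GP

namespace GP

/-- degree bound and top coefficient -/
def LC {R : Type} [CommRing R] (p : Polynomial R) (d : ℕ) (c : R) : Prop :=
  p.natDegree ≤ d ∧ p.coeff d = c

section
variable {R : Type} [CommRing R]

lemma LC.mul {p q : Polynomial R} {d e : ℕ} {a b : R} (hp : LC p d a) (hq : LC q e b) :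
    LC (p * q) (d + e) (a * b) :=
  ⟨Polynomial.natDegree_mul_le_of_le hp.1 hq.1, by
    rw [Polynomial.coeff_mul_add_eq_of_natDegree_le hp.1 hq.1, hp.2, hq.2]⟩

lemma LC.one : LC (1 : Polynomial R) 0 1 := ⟨by simp, by simp⟩

lemma LC.pow {p : Polynomial R} {d : ℕ} {a : R} (hp : LC p d a) (n : ℕ) :
    LC (p ^ n) (n * d) (a ^ n) := by
  induction n with
  | zero => simpa using LC.one
  | succ n ih => rw [pow_succ, pow_succ, Nat.succ_mul]; exact ih.mul hp

lemma LC.prod {ι : Type} (s : Finset ι) (p : ι → Polynomial R) (d : ι → ℕ) (a : ι → R)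
    (h : ∀ i ∈ s, LC (p i) (d i) (a i)) : LC (∏ i ∈ s, p i) (∑ i ∈ s, d i) (∏ i ∈ s, a i) := by
  classical
  induction s using Finset.induction_on with
  | empty => simpa using LC.one
  | insert i s hi ih =>
    rw [Finset.prod_insert hi, Finset.sum_insert hi, Finset.prod_insert hi]
    exact (h i (by simp)).mul (ih fun j hj => h j (by simp [hj]))

lemma LC.sum {ι : Type} (s : Finset ι) (p : ι → Polynomial R) (d : ℕ) (a : ι → R)
    (h : ∀ i ∈ s, LC (p i) d (a i)) : LC (∑ i ∈ s, p i) d (∑ i ∈ s, a i) := by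
  refine ⟨Polynomial.natDegree_sum_le_of_forall_le _ _ fun i hi => (h i hi).1, ?_⟩
  rw [Polynomial.finsetSum_coeff]
  exact Finset.sum_congr rfl fun i hi => (h i hi).2

variable {k : Type} [Field k] [Algebra k R] {n : ℕ}

lemma LC_hom {f : MvPolynomial (Fin n) k} {d : ℕ} (hf : f.IsHomogeneous d) (b : Fin n → R)
    (c : Fin n → k) : LC (aeval (fun j => Polynomial.C (b j) + Polynomial.X *
      Polynomial.C (algebraMap k R (c j))) f) d (algebraMap k R (eval c f)) := by
  have h1 : algebraMap k R (eval c f) = aeval (fun j => algebraMap k R (c j)) f := by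
    rw [← aeval_eq_eval]
    exact (aeval_algebraMap_apply (A := k) (B := R) c f).symm
  rw [h1, aeval_def, aeval_def, eval₂_eq', eval₂_eq']
  refine LC.sum _ _ _ _ fun s hs => ?_
  have hd : d = 0 + ∑ i, s i * 1 := by
    have hd := hf.degree_eq_sum_deg_support hs
    have h : s.degree = ∑ i ∈ s.support, s i := rfl
    rw [hd, ← h, Finsupp.degree_eq_sum]; simp
  rw [hd]
  refine LC.mul ⟨?_, ?_⟩ (LC.prod _ _ _ _ fun i _ => LC.pow ⟨?_, ?_⟩ _)
  · rw [Polynomial.algebraMap_apply]; simp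
  · rw [Polynomial.algebraMap_apply]; simp
  · compute_degree
  · rw [Polynomial.coeff_add, Polynomial.coeff_C]; simp

lemma integral_of_hom {E : Type} [CommRing E] [Algebra k E] [Algebra R E] [IsScalarTower k R E]
    {f : MvPolynomial (Fin n) k} {d : ℕ} (hf : f.IsHomogeneous d) (b : Fin n → R)
    (c : Fin n → k) (hc : eval c f ≠ 0) (s : E)
    (h : aeval (fun j => algebraMap R E (b j) + s * algebraMap k E (c j)) f = 0) :
    IsIntegral R s := by
  set p : Polynomial R := aeval (fun j => Polynomial.C (b j) + Polynomial.X *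
      Polynomial.C (algebraMap k R (c j))) f with hp
  have h1 : LC p d (algebraMap k R (eval c f)) := LC_hom hf b c
  have h2 : Polynomial.aeval s p = 0 := by
    rw [← h, hp]
    have : ((Polynomial.aeval s : Polynomial R →ₐ[R] E).restrictScalars k).comp
      (aeval (fun j => Polynomial.C (b j) + Polynomial.X *
      Polynomial.C (algebraMap k R (c j))) : MvPolynomial (Fin n) k →ₐ[k] Polynomial R) =
      aeval (fun j => algebraMap R E (b j) + s * algebraMap k E (c j)) := by
      ext i
      simp [← IsScalarTower.algebraMap_apply]
      exact mul_comm _ _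
    exact DFunLike.congr_fun this f
  have h3 : LC (Polynomial.C (algebraMap k R (eval c f)⁻¹) * p) (0 + d)
      (algebraMap k R (eval c f)⁻¹ * algebraMap k R (eval c f)) := LC.mul ⟨by simp, by simp⟩ h1
  rw [← map_mul, inv_mul_cancel₀ hc, map_one] at h3
  refine ⟨Polynomial.C (algebraMap k R (eval c f)⁻¹) * p,
    Polynomial.monic_of_natDegree_le_of_coeff_eq_one _ h3.1 h3.2, ?_⟩
  rw [← Polynomial.aeval_def, map_mul, h2, mul_zero]

end

section
variable {k : Type} [Field k]

lemma lm_add_left {E : Type} [CommRing E] [Algebra k E] {n m : ℕ}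
    (l l' : (Fin n → k) →ₗ[k] (Fin m → k)) (b : Fin n → E) :
    lm (l + l') b = lm l b + lm l' b := by
  funext i
  simp [lm, add_mul, Finset.sum_add_distrib]

lemma decomp (l : (Fin 4 → k) →ₗ[k] (Fin 3 → k)) (hl : Function.Surjective l) {Q : Fin 4 → k}
    (hQ : Q ≠ 0) (hker : LinearMap.ker l = Submodule.span k {Q}) :
    ∃ (σ : (Fin 3 → k) →ₗ[k] (Fin 4 → k)) (s : (Fin 4 → k) →ₗ[k] (Fin 1 → k)),
      (∀ u, l (σ u) = u) ∧ (∀ v, v = σ (l v) + (s v 0) • Q) ∧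
      (∀ (E : Type) [CommRing E] [Algebra k E] (b : Fin 4 → E) (j : Fin 4),
        b j = lm σ (lm l b) j + lm s b 0 * algebraMap k E (Q j)) := by
  obtain ⟨σ, hσ⟩ := l.exists_rightInverse_of_surjective (LinearMap.range_eq_top.2 hl)
  have hσ' : ∀ u, l (σ u) = u := fun u => DFunLike.congr_fun hσ u
  obtain ⟨i, hi⟩ := Function.ne_iff.1 hQ
  have hi' : Q i ≠ 0 := hi
  let s : (Fin 4 → k) →ₗ[k] (Fin 1 → k) := LinearMap.pi fun _ =>
    (Q i)⁻¹ • ((LinearMap.proj i) ∘ₗ (LinearMap.id - σ ∘ₗ l))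
  have hs : ∀ v, v = σ (l v) + (s v 0) • Q := by
    intro v
    have : v - σ (l v) ∈ LinearMap.ker l := by simp [hσ']
    rw [hker, Submodule.mem_span_singleton] at this
    obtain ⟨c, hc⟩ := this
    have h2 : s v 0 = c := by
      have h3 := congrFun hc i
      simp only [Pi.smul_apply, smul_eq_mul, Pi.sub_apply] at h3
      simp only [s, LinearMap.pi_apply, LinearMap.smul_apply, LinearMap.comp_apply,
        LinearMap.sub_apply, LinearMap.proj_apply, Pi.sub_apply, LinearMap.id_apply, smul_eq_mul]
      rw [← h3]; field_simp
    rw [h2, hc]; abel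
  refine ⟨σ, s, hσ', hs, fun E _ _ b j => ?_⟩
  let q : (Fin 1 → k) →ₗ[k] (Fin 4 → k) := (LinearMap.proj 0).smulRight Q
  have h : (LinearMap.id : (Fin 4 → k) →ₗ[k] _) = σ ∘ₗ l + q ∘ₗ s := by
    ext1; ext1 
    exact hs _
  have h2 := congrFun (lm_id (k := k) b) j
  rw [h, lm_add_left, lm_comp, lm_comp] at h2
  rw [← h2]
  simp only [Pi.add_apply, add_right_inj]
  simp [lm, q, mul_comm]

end
end GP

namespace GP

section
variable {k : Type} [Field k]

lemma exists_hom_ne {n : ℕ} {I : Ideal (MvPolynomial (Fin n) k)} (hH : Hom I) {Q : Fin n → k}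
    (hQ : Q ∉ Z k I) : ∃ f d, f ∈ I ∧ f.IsHomogeneous d ∧ eval Q f ≠ 0 := by
  obtain ⟨S, rfl, hS⟩ := hH
  rw [mem_Z_span] at hQ
  push Not at hQ
  obtain ⟨f, hf, h⟩ := hQ
  obtain ⟨d, hd⟩ := hS f hf
  exact ⟨f, d, Ideal.subset_span hf, hd, by rwa [aeval_eq_eval] at h⟩

/-- decomposition data for the projection -/
structure Dec (l : (Fin 4 → k) →ₗ[k] (Fin 3 → k)) (Q : Fin 4 → k)
    (σ : (Fin 3 → k) →ₗ[k] (Fin 4 → k)) (s : (Fin 4 → k) →ₗ[k] (Fin 1 → k)) : Prop where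
  sec : ∀ u, l (σ u) = u
  eqn : ∀ v, v = σ (l v) + (s v 0) • Q
  eqnE : ∀ (E : Type) [CommRing E] [Algebra k E] (b : Fin 4 → E) (j : Fin 4),
        b j = lm σ (lm l b) j + lm s b 0 * algebraMap k E (Q j)

lemma lm_algebraMap {n m : ℕ} {R E : Type} [CommRing R] [Algebra k R] [CommRing E] [Algebra k E] [Algebra R E]
    [IsScalarTower k R E] (l : (Fin n → k) →ₗ[k] (Fin m → k)) (y : Fin n → R) (i : Fin m) :
    algebraMap R E (lm l y i) = lm l (fun j => algebraMap R E (y j)) i :=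
  congrFun (lm_map l y (IsScalarTower.toAlgHom k R E)) i

lemma integral_s {I : Ideal (MvPolynomial (Fin 4) k)} (hH : Hom I)
    {l : (Fin 4 → k) →ₗ[k] (Fin 3 → k)} {Q : Fin 4 → k} {σ : (Fin 3 → k) →ₗ[k] (Fin 4 → k)}
    {s : (Fin 4 → k) →ₗ[k] (Fin 1 → k)} (hd : Dec l Q σ s) (hQ : Q ∉ Z k I)
    {R E : Type} [CommRing R] [Algebra k R] [CommRing E] [Algebra k E] [Algebra R E]
    [IsScalarTower k R E] (y : Fin 3 → R) (ξ : Fin 4 → E) (hξ : ξ ∈ Z E I)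
    (hy : ∀ i, lm l ξ i = algebraMap R E (y i)) : IsIntegral R (lm s ξ 0) := by
  obtain ⟨f, d, hf, hfd, hfQ⟩ := exists_hom_ne hH hQ
  have hy' : lm l ξ = fun i => algebraMap R E (y i) := funext hy
  have hx : ∀ j, ξ j = algebraMap R E (lm σ y j) + lm s ξ 0 * algebraMap k E (Q j) := by
    intro j
    rw [lm_algebraMap, ← hy']
    exact hd.eqnE E ξ j
  refine integral_of_hom hfd (lm σ y) Q hfQ _ ?_
  have h0 := hξ f hf
  rw [← h0]
  congr 2
  funext j; exact (hx j).symm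

lemma integral_proj {I : Ideal (MvPolynomial (Fin 4) k)} (hH : Hom I)
    {l : (Fin 4 → k) →ₗ[k] (Fin 3 → k)} {Q : Fin 4 → k} {σ : (Fin 3 → k) →ₗ[k] (Fin 4 → k)}
    {s : (Fin 4 → k) →ₗ[k] (Fin 1 → k)} (hd : Dec l Q σ s) (hQ : Q ∉ Z k I)
    {R E : Type} [CommRing R] [Algebra k R] [CommRing E] [Algebra k E] [Algebra R E]
    [IsScalarTower k R E] (y : Fin 3 → R) (ξ : Fin 4 → E) (hξ : ξ ∈ Z E I)
    (hy : ∀ i, lm l ξ i = algebraMap R E (y i)) (j : Fin 4) : IsIntegral R (ξ j) := by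
  have h := integral_s hH hd hQ y ξ hξ hy
  have hy' : lm l ξ = fun i => algebraMap R E (y i) := funext hy
  rw [hd.eqnE E ξ j, hy', ← lm_algebraMap]
  refine IsIntegral.add isIntegral_algebraMap (h.mul ?_)
  rw [IsScalarTower.algebraMap_apply k R E]
  exact isIntegral_algebraMap

lemma pull_comp {n m : ℕ} (l : (Fin n → k) →ₗ[k] (Fin m → k)) (G : MvPolynomial (Fin m) k) (j : ℕ) :
    pull l (homogeneousComponent j G) = homogeneousComponent j (pull l G) := by
  conv_rhs => rw [← sum_homogeneousComponent G]
  have : pull l (∑ i ∈ Finset.range (G.totalDegree + 1), homogeneousComponent i G) =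
      ∑ i ∈ Finset.range (G.totalDegree + 1), pull l (homogeneousComponent i G) := map_sum _ _ _
  rw [this, map_sum]
  have h : ∀ i, homogeneousComponent j (pull l (homogeneousComponent i G)) =
      if i = j then pull l (homogeneousComponent j G) else 0 := by
    intro i
    rw [homogeneousComponent_of_mem
      (pull_hom l (homogeneousComponent_isHomogeneous i G) : _ ∈ homogeneousSubmodule _ _ i)]
    by_cases hij : i = j
    · subst hij; simp
    · rw [if_neg hij, if_neg (fun h => hij h.symm)]
  simp only [h, Finset.sum_ite_eq', Finset.mem_range]
  split_ifs with h1
  · rfl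
  · rw [homogeneousComponent_eq_zero _ _ (by omega)]
    exact map_zero _

lemma homogeneous_of_dvd {m : ℕ} {F : MvPolynomial (Fin m) k} (hF0 : F ≠ 0)
    (h : ∀ i, F ∣ homogeneousComponent i F) : F.IsHomogeneous F.totalDegree := by
  have h1 : ∀ i ∈ Finset.range (F.totalDegree + 1), i ≠ F.totalDegree →
      homogeneousComponent i F = 0 := by
    intro i hi hne
    by_contra h0
    obtain ⟨c, hc⟩ := h i
    have hc0 : c ≠ 0 := by rintro rfl; rw [mul_zero] at hc; exact h0 hc
    have h2 := (homogeneousComponent_isHomogeneous i F).totalDegree h0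
    rw [hc, totalDegree_mul_of_isDomain hF0 hc0] at h2
    have := Finset.mem_range.1 hi
    omega
  have h2 := sum_homogeneousComponent F
  rw [Finset.sum_eq_single F.totalDegree h1 (by simp)] at h2
  conv_lhs => rw [← h2]
  exact homogeneousComponent_isHomogeneous _ _

lemma exists_F {I : Ideal (MvPolynomial (Fin 4) k)} (hp : I.IsPrime) (hH : Hom I)
    (hdim : ringKrullDim (MvPolynomial (Fin 4) k ⧸ I) = 2)
    {l : (Fin 4 → k) →ₗ[k] (Fin 3 → k)} {Q : Fin 4 → k} {σ : (Fin 3 → k) →ₗ[k] (Fin 4 → k)}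
    {s : (Fin 4 → k) →ₗ[k] (Fin 1 → k)} (hd : Dec l Q σ s) (hQ : Q ∉ Z k I) :
    ∃ (F : MvPolynomial (Fin 3) k) (n : ℕ), Irreducible F ∧ F.IsHomogeneous n ∧
      ∀ G, pull l G ∈ I ↔ F ∣ G := by
  let alg : Algebra (MvPolynomial (Fin 3) k) (MvPolynomial (Fin 4) k ⧸ I) :=
    ((Ideal.Quotient.mk I).comp
      (aeval (lm l X) : MvPolynomial (Fin 3) k →ₐ[k] MvPolynomial (Fin 4) k).toRingHom).toAlgebra
  have halg : ∀ G, algebraMap (MvPolynomial (Fin 3) k) (MvPolynomial (Fin 4) k ⧸ I) G =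
    Ideal.Quotient.mk I (pull l G) := fun G => rfl
  have : IsScalarTower k (MvPolynomial (Fin 3) k) (MvPolynomial (Fin 4) k ⧸ I) := by
    refine IsScalarTower.of_algebraMap_eq fun c => ?_
    rw [halg]
    simp only [pull, MvPolynomial.algebraMap_eq, aeval_C]
    rfl
  have hae : ∀ f, aeval (fun j => Ideal.Quotient.mk I (X j)) f = Ideal.Quotient.mk I f := by
    intro f
    have : aeval (fun j => Ideal.Quotient.mk I (X j)) = Ideal.Quotient.mkₐ k I := by
      ext i; simp
    rw [this]; rfl
  have hintg : ∀ j, IsIntegral (MvPolynomial (Fin 3) k) (Ideal.Quotient.mk I (X j)) := by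
    refine integral_proj hH hd hQ (X : Fin 3 → MvPolynomial (Fin 3) k)
      (fun j => Ideal.Quotient.mk I (X j)) ?_ ?_
    · intro f hf
      rw [hae, Ideal.Quotient.eq_zero_iff_mem]; exact hf
    · intro i
      rw [halg, pull, aeval_X]
      exact (congrFun (lm_map l X (Ideal.Quotient.mkₐ k I)) i).symm
  have : Algebra.IsIntegral (MvPolynomial (Fin 3) k) (MvPolynomial (Fin 4) k ⧸ I) := by
    refine ⟨fun z => ?_⟩
    obtain ⟨f, rfl⟩ := Ideal.Quotient.mk_surjective z
    induction f using MvPolynomial.induction_on with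
    | C c =>
      have : Ideal.Quotient.mk I (C c) = algebraMap (MvPolynomial (Fin 3) k) _ (C c) := by
        rw [halg]; simp [pull]
      rw [this]; exact isIntegral_algebraMap
    | add p q hp hq => rw [map_add]; exact hp.add hq
    | mul_X p j hp => rw [map_mul]; exact hp.mul (hintg j)
  obtain ⟨F, hF, h⟩ := ker_principal (k := k) (A := MvPolynomial (Fin 4) k ⧸ I) hdim
  have h' : ∀ G, pull l G ∈ I ↔ F ∣ G := by
    intro G
    rw [← h, halg, Ideal.Quotient.eq_zero_iff_mem]
  refine ⟨F, F.totalDegree, hF, homogeneous_of_dvd hF.ne_zero fun i => ?_, h'⟩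
  rw [← h', pull_comp]
  exact hH.comp_mem ((h' F).2 dvd_rfl) i

end
end GP

namespace GP

section
variable {k : Type} [Field k]

lemma exists_functional {V : Type} [AddCommGroup V] [Module k V] (W : Submodule k V) {z : V}
    (hz : z ∉ W) : ∃ φ : V →ₗ[k] k, (∀ w ∈ W, φ w = 0) ∧ φ z ≠ 0 := by
  obtain ⟨φ, h1, h2⟩ := Submodule.exists_le_ker_of_notMem hz
  exact ⟨φ, fun w hw => h2 hw, h1⟩

/-- the tangent criterion for idempotence of a maximal ideal -/
lemma ker_idem {n : ℕ} {R : Type} [CommRing R] [Algebra k R] (a : Fin n → R)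
    (ha : ∀ z, ∃ f : MvPolynomial (Fin n) k, aeval a f = z) (ρ : R →ₐ[k] k)
    (ht : ∀ φ : R →ₗ[k] k, (∀ z ∈ RingHom.ker ρ ^ 2, φ z = 0) →
      ∀ j, φ (a j - algebraMap k R (ρ (a j))) = 0) :
    IsIdempotentElem (RingHom.ker ρ) := by
  have : RingHom.ker ρ ≤ RingHom.ker ρ ^ 2 := by
    intro z hz
    by_contra hz2
    obtain ⟨φ, h1, h2⟩ := exists_functional ((RingHom.ker ρ ^ 2).restrictScalars k) hz2
    have ht' := ht φ h1
    obtain ⟨f, rfl⟩ := ha z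
    have h3 := taylor1 (RingHom.ker ρ) a (fun j => ρ (a j)) (fun j => by
      rw [RingHom.mem_ker]; simp) f
    have h4 := h1 _ h3
    have h5 : eval (fun j => ρ (a j)) f = 0 := by
      rw [RingHom.mem_ker] at hz
      rw [← hz, ← aeval_eq_eval]
      have : aeval (fun j => ρ (a j)) = ρ.comp (aeval a) := by ext i; simp
      rw [this]; rfl
    rw [h5, map_zero, sub_zero, map_sub, map_sum] at h4
    apply h2
    rw [sub_eq_zero.1 h4]
    refine Finset.sum_eq_zero fun j _ => ?_
    rw [← Algebra.smul_def, map_smul, ht', smul_zero]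
  unfold IsIdempotentElem
  rw [← pow_two]
  exact le_antisymm (Ideal.pow_le_self two_ne_zero) this

lemma eq_zero_of_ker [IsAlgClosed k] {R : Type} [CommRing R] [Algebra k R] [Module.Finite k R]
    (h : ∀ ρ : R →ₐ[k] k, IsIdempotentElem (RingHom.ker ρ)) {z : R} (hz : ∀ ρ : R →ₐ[k] k, ρ z = 0) :
    z = 0 := by
  by_contra hz0
  have h1 : Ideal.span {z} ≠ ⊥ := by simpa using hz0
  let N : Ideal R := LinearMap.ker (LinearMap.toSpanSingleton R R z)
  have hN : ∀ r, r ∈ N ↔ r * z = 0 := fun r => by simp [N]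
  have hN1 : N ≠ ⊤ := by
    rw [Ne, Ideal.eq_top_iff_one, hN, one_mul]; exact hz0
  obtain ⟨M, hM, hNM⟩ := Ideal.exists_le_maximal N hN1
  have := Ideal.Quotient.field M
  have hbij : Function.Bijective (algebraMap k (R ⧸ M)) := by
    have : Module.Finite k (R ⧸ M) := inferInstance
    exact IsAlgClosed.algebraMap_bijective_of_isIntegral
  let e : k ≃ₐ[k] (R ⧸ M) := AlgEquiv.ofBijective (Algebra.ofId k _) hbij
  let ρ : R →ₐ[k] k := e.symm.toAlgHom.comp (Ideal.Quotient.mkₐ k M)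
  have hρ : RingHom.ker ρ = M := by
    ext r
    rw [RingHom.mem_ker]
    change e.symm (Ideal.Quotient.mk M r) = 0 ↔ _
    rw [EmbeddingLike.map_eq_zero_iff, Ideal.Quotient.eq_zero_iff_mem]
  have : IsNoetherianRing R := IsNoetherianRing.of_finite k R
  obtain ⟨e', he, heM⟩ := (Ideal.isIdempotentElem_iff_of_fg M (IsNoetherian.noetherian M)).1
    (hρ ▸ h ρ)
  have hzM : z ∈ M := by rw [← hρ, RingHom.mem_ker]; exact hz ρ
  have heM' : e' ∈ M := by rw [heM]; exact Ideal.mem_span_singleton_self _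
  rw [heM] at hzM
  obtain ⟨c, rfl⟩ := Ideal.mem_span_singleton.1 hzM
  have : 1 - e' ∈ M := by
    apply hNM
    rw [hN, ← mul_assoc, sub_mul, one_mul, he.eq, sub_self, zero_mul]
  exact hM.ne_top ((Ideal.eq_top_iff_one _).2 (by simpa using M.add_mem this heM'))

lemma core1 [IsAlgClosed k] {n : ℕ} {R : Type} [CommRing R] [Algebra k R] [Module.Finite k R]
    (a : Fin n → R)
    (ha : ∀ z, ∃ f : MvPolynomial (Fin n) k, aeval a f = z) (S : Finset (Fin n → k))
    (hS : ∀ ρ : R →ₐ[k] k, (fun j => ρ (a j)) ∈ S)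
    (ht : ∀ ρ : R →ₐ[k] k, ∀ φ : R →ₗ[k] k, (∀ z ∈ RingHom.ker ρ ^ 2, φ z = 0) →
      ∀ j, φ (a j - algebraMap k R (ρ (a j))) = 0) : Module.finrank k R ≤ S.card := by
  classical
  let Φ : R →ₗ[k] (S → k) := LinearMap.pi fun v =>
    if h : ∃ ρ : R →ₐ[k] k, (fun j => ρ (a j)) = v.1 then h.choose.toLinearMap else 0
  have hinj : Function.Injective Φ := by
    rw [← LinearMap.ker_eq_bot, LinearMap.ker_eq_bot']
    intro z hz
    refine eq_zero_of_ker (fun ρ => ker_idem a ha ρ (ht ρ)) fun ρ => ?_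
    have h1 := congrFun hz ⟨_, hS ρ⟩
    have hex : ∃ ρ' : R →ₐ[k] k, (fun j => ρ' (a j)) = (fun j => ρ (a j)) := ⟨ρ, rfl⟩
    simp only [Φ, LinearMap.pi_apply, dif_pos hex] at h1
    have h2 : hex.choose = ρ := by
      ext z
      obtain ⟨f, rfl⟩ := ha z
      have := hex.choose_spec
      have h3 : hex.choose.comp (aeval a) = ρ.comp (aeval a : MvPolynomial (Fin n) k →ₐ[k] R) := by
        ext i; simpa using congrFun this i
      exact DFunLike.congr_fun h3 f
    rw [h2] at h1
    exact h1
  have := LinearMap.finrank_le_finrank_of_injective hinj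
  simpa using this

lemma core2 {V : Type} [CommRing V] [Algebra k V] [Module.Finite k V] (y : V) (c : ℕ)
    (h : ∀ n, Module.finrank k (V ⧸ Ideal.span {y ^ n}) ≤ c) :
    (LinearMap.mulLeft k y).charpoly.natTrailingDegree ≤ c := by
  rw [← LinearMap.finrank_maxGenEigenspace_zero_eq, Module.End.maxGenEigenspace_eq]
  set N := Module.End.maxGenEigenspaceIndex (LinearMap.mulLeft k y) 0
  refine le_trans (le_of_eq ?_) (h N)
  have h1 : (LinearMap.mulLeft k y) ^ N = LinearMap.mulLeft k (y ^ N) := by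
    rw [LinearMap.pow_mulLeft]
  rw [Module.End.genEigenspace_nat, zero_smul, sub_zero, h1]
  have h2 := LinearMap.finrank_range_add_finrank_ker (LinearMap.mulLeft k (y ^ N))
  have h3 : LinearMap.range (LinearMap.mulLeft k (y ^ N)) =
      (Ideal.span {y ^ N}).restrictScalars k := by
    ext z
    simp [Ideal.mem_span_singleton', mul_comm]
  rw [h3] at h2
  have h4 := Submodule.finrank_quotient_add_finrank ((Ideal.span {y ^ N}).restrictScalars k)
  have h5 : Module.finrank k (V ⧸ (Ideal.span {y ^ N}).restrictScalars k) =
    Module.finrank k (V ⧸ Ideal.span {y ^ N}) := rfl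
  omega

end
end GP

namespace GP

section
variable {k : Type} [Field k]

lemma exists_normalized' {n : ℕ} (I : Ideal (MvPolynomial (Fin n) k)) (hI : I.IsPrime) (hH : Hom I)
    {μ : MvPolynomial (Fin n) k} (hμ : μ.IsHomogeneous 1) (hμI : μ ∉ I) :
    ∃ (A : Type) (_ : CommRing A) (_ : IsDomain A) (_ : Algebra k A) (a : Fin n → A),
      aeval a μ = 1 ∧ a ∈ Z A I ∧
      (∀ f d, f.IsHomogeneous d → aeval a f = 0 → f ∈ I) ∧
      (∀ z, ∃ f : MvPolynomial (Fin n) k, aeval a f = z) := by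
  obtain ⟨K, iK, iA, a, h1, h2, h3⟩ := exists_normalized I hI hH hμ hμI
  let A := (aeval a : MvPolynomial (Fin n) k →ₐ[k] K).range
  let a' : Fin n → A := fun j =>
    ⟨a j, ⟨(X j : MvPolynomial (Fin n) k), aeval_X a j⟩⟩
  have ha : ∀ f : MvPolynomial (Fin n) k, ((aeval a' f : A) : K) = aeval a f := by
    intro f
    have : A.val.comp (aeval a') = aeval a := by ext i; simp [a']
    exact DFunLike.congr_fun this f
  refine ⟨A, inferInstance, inferInstance, inferInstance, a', ?_, ?_, ?_, ?_⟩
  · apply Subtype.ext; rw [ha, h1]; rfl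
  · intro f hf; apply Subtype.ext; rw [ha, h2 f hf]; rfl
  · intro f d hf h
    refine h3 f d hf ?_
    rw [← ha, h]; rfl
  · rintro ⟨_, f, rfl⟩
    exact ⟨f, Subtype.ext (ha f)⟩

/-- package of hypotheses on the normalized curve -/
structure CoreHyp (I : Ideal (MvPolynomial (Fin 4) k)) (l : (Fin 4 → k) →ₗ[k] (Fin 3 → k))
    (Q : Fin 4 → k) (σ : (Fin 3 → k) →ₗ[k] (Fin 4 → k)) (s : (Fin 4 → k) →ₗ[k] (Fin 1 → k))
    (F : MvPolynomial (Fin 3) k) (n : ℕ)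
    (A : Type) [CommRing A] [Algebra k A] (a : Fin 4 → A) : Prop where
  hH : Hom I
  dec : Dec l Q σ s
  hQ : Q ∉ Z k I
  hF : F.IsHomogeneous n
  haZ : a ∈ Z A I
  h1 : lm l a 0 = 1
  hgen : ∀ z, ∃ f : MvPolynomial (Fin 4) k, aeval a f = z
  hF0 : aeval (lm l a) F = 0
  hFd : ∀ G d, G.IsHomogeneous d → aeval (lm l a) G = 0 → F ∣ G
  hp : eval (Pi.single 2 1) F ≠ 0

variable {I : Ideal (MvPolynomial (Fin 4) k)} {l : (Fin 4 → k) →ₗ[k] (Fin 3 → k)}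
    {Q : Fin 4 → k} {σ : (Fin 3 → k) →ₗ[k] (Fin 4 → k)} {s : (Fin 4 → k) →ₗ[k] (Fin 1 → k)}
    {F : MvPolynomial (Fin 3) k} {n : ℕ}
    {A : Type} [CommRing A] [Algebra k A] {a : Fin 4 → A}

lemma adjoin_top (hgen : ∀ z, ∃ f : MvPolynomial (Fin 4) k, aeval a f = z)
    (P : Type) [CommRing P] [Algebra k P] [Algebra P A] [IsScalarTower k P A] :
    Algebra.adjoin P (Set.range a) = ⊤ := by
  rw [eq_top_iff]
  intro z _
  obtain ⟨f, rfl⟩ := hgen z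
  induction f using MvPolynomial.induction_on with
  | C c =>
    rw [aeval_C, IsScalarTower.algebraMap_apply k P A]
    exact Subalgebra.algebraMap_mem _ _
  | add p q hp hq => rw [map_add]; exact add_mem (hp trivial) (hq trivial)
  | mul_X p j hp =>
    rw [map_mul, aeval_X]
    exact mul_mem (hp trivial) (Algebra.subset_adjoin ⟨j, rfl⟩)

lemma finite_of_integral (hgen : ∀ z, ∃ f : MvPolynomial (Fin 4) k, aeval a f = z)
    (P : Type) [CommRing P] [Algebra k P] [Algebra P A] [IsScalarTower k P A]
    (hintg : ∀ j, IsIntegral P (a j)) : Module.Finite P A := by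
  have h := fg_adjoin_of_finite (R := P) (Set.finite_range a) (by rintro _ ⟨j, rfl⟩; exact hintg j)
  rw [adjoin_top hgen P] at h
  exact ⟨by simpa using h⟩

section
variable [Algebra (Polynomial k) A] [IsScalarTower k (Polynomial k) A]

lemma CoreHyp.y_integral (c : CoreHyp I l Q σ s F n A a)
    (hx : algebraMap (Polynomial k) A Polynomial.X = lm l a 1) :
    IsIntegral (Polynomial k) (lm l a 2) := by
  refine integral_of_hom (R := Polynomial k) c.hF ![1, Polynomial.X, 0] (Pi.single 2 1) c.hp _ ?_
  rw [← c.hF0]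
  congr 2
  funext j
  fin_cases j
  · simp [c.h1]
  · simp [hx]
  · simp

lemma CoreHyp.finite (c : CoreHyp I l Q σ s F n A a)
    (hx : algebraMap (Polynomial k) A Polynomial.X = lm l a 1) :
    Module.Finite (Polynomial k) A := by
  have hy := c.y_integral hx
  refine finite_of_integral c.hgen (Polynomial k) fun j => ?_
  let R := integralClosure (Polynomial k) A
  have h : IsIntegral R (a j) := by
    refine integral_proj c.hH c.dec c.hQ (R := R)
      ![1, algebraMap (Polynomial k) R Polynomial.X, ⟨lm l a 2, hy⟩] a c.haZ ?_ j
    intro i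
    fin_cases i
    · simp [c.h1]
    · simp [← hx, ← IsScalarTower.algebraMap_apply]
    · rfl
  exact isIntegral_trans _ h

/-- the dehomogenized equation -/
noncomputable def Fp (F : MvPolynomial (Fin 3) k) : Polynomial (Polynomial k) :=
  aeval ![1, Polynomial.C Polynomial.X, Polynomial.X] F

lemma biv_surj (g : Polynomial (Polynomial k)) : ∃ f : MvPolynomial (Fin 3) k,
    aeval (![1, Polynomial.C Polynomial.X, Polynomial.X] : Fin 3 → Polynomial (Polynomial k)) f
      = g := by
  induction g using Polynomial.induction_on' with
  | add p q hp hq =>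
    obtain ⟨f, rfl⟩ := hp
    obtain ⟨g, rfl⟩ := hq
    exact ⟨f + g, map_add _ _ _⟩
  | monomial m p =>
    refine ⟨Polynomial.aeval (X 1) p * X 2 ^ m, ?_⟩
    rw [map_mul, map_pow, aeval_X, ← Polynomial.C_mul_X_pow_eq_monomial]
    congr 1
    have : ((aeval (![1, Polynomial.C Polynomial.X, Polynomial.X] :
        Fin 3 → Polynomial (Polynomial k)) : MvPolynomial (Fin 3) k →ₐ[k] Polynomial (Polynomial k)).comp
      (Polynomial.aeval (X 1))) = (Polynomial.CAlgHom (R := k) (A := Polynomial k)) := by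
      ext; simp
    exact DFunLike.congr_fun this p

lemma CoreHyp.biv_eval (c : CoreHyp I l Q σ s F n A a)
    (hx : algebraMap (Polynomial k) A Polynomial.X = lm l a 1) (f : MvPolynomial (Fin 3) k) :
    Polynomial.aeval (R := Polynomial k) (lm l a 2)
      (aeval (![1, Polynomial.C Polynomial.X, Polynomial.X] : Fin 3 → Polynomial (Polynomial k)) f)
      = aeval (lm l a) f := by
  have : (((Polynomial.aeval (R := Polynomial k) (lm l a 2)).restrictScalars k).comp
    (aeval (![1, Polynomial.C Polynomial.X, Polynomial.X] : Fin 3 → Polynomial (Polynomial k)) :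
      MvPolynomial (Fin 3) k →ₐ[k] Polynomial (Polynomial k))) = aeval (lm l a) := by
    ext i
    fin_cases i
    · simp [c.h1]
    · simp [hx]
    · simp
  exact DFunLike.congr_fun this f

lemma CoreHyp.Fp_dvd (c : CoreHyp I l Q σ s F n A a)
    (hx : algebraMap (Polynomial k) A Polynomial.X = lm l a 1) (g : Polynomial (Polynomial k))
    (hg : Polynomial.aeval (lm l a 2) g = 0) : Fp F ∣ g := by
  obtain ⟨f, rfl⟩ := biv_surj g
  rw [c.biv_eval hx] at hg
  obtain ⟨N, G, hG, h⟩ := homogenize (isHomogeneous_X k (0 : Fin 3)) f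
  have h1 := h A (lm l a) 1 (by rw [aeval_X, c.h1])
  rw [one_smul, one_pow, one_mul, hg] at h1
  obtain ⟨H, hH⟩ := c.hFd G N hG h1
  have h2 := h _ (![1, Polynomial.C Polynomial.X, Polynomial.X] :
    Fin 3 → Polynomial (Polynomial k)) 1 (by simp)
  rw [one_smul, one_pow, one_mul, hH, map_mul] at h2
  exact ⟨_, h2.symm⟩

lemma Fp_LC (hF : F.IsHomogeneous n) :
    LC (Fp F) n (algebraMap k (Polynomial k) (eval (Pi.single 2 1) F)) := by
  have := LC_hom (R := Polynomial k) hF ![1, Polynomial.X, 0] (Pi.single 2 1)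
  have h : (fun j => Polynomial.C ((![1, Polynomial.X, 0] : Fin 3 → Polynomial k) j) +
      Polynomial.X * Polynomial.C (algebraMap k (Polynomial k) ((Pi.single 2 1 : Fin 3 → k) j)))
      = ![1, Polynomial.C Polynomial.X, Polynomial.X] := by
    funext j
    fin_cases j <;> simp
  rw [h] at this
  exact this

lemma CoreHyp.inj (c : CoreHyp I l Q σ s F n A a) [Nontrivial A]
    (hx : algebraMap (Polynomial k) A Polynomial.X = lm l a 1) :
    Function.Injective (algebraMap (Polynomial k) A) := by
  rw [injective_iff_map_eq_zero]
  intro g hg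
  by_contra hg0
  obtain ⟨H, hH⟩ := c.Fp_dvd hx (Polynomial.C g) (by simpa using hg)
  have hF' := Fp_LC c.hF
  have hne : algebraMap k (Polynomial k) (eval (Pi.single 2 1) F) ≠ 0 := by
    simpa using c.hp
  have hdeg : (Fp F).natDegree = n :=
    le_antisymm hF'.1 (Polynomial.le_natDegree_of_ne_zero (by rw [hF'.2]; exact hne))
  have h1 : Polynomial.C g ≠ 0 := by simpa using hg0
  have hF0 : Fp F ≠ 0 := by rintro h; rw [h, zero_mul] at hH; exact h1 hH
  have hH0 : H ≠ 0 := by rintro rfl; rw [mul_zero] at hH; exact h1 hH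
  have h2 := congrArg Polynomial.natDegree hH
  rw [Polynomial.natDegree_C, Polynomial.natDegree_mul hF0 hH0, hdeg] at h2
  have hn : n = 0 := by omega
  have h3 := c.hF
  rw [hn] at h3
  rw [← totalDegree_zero_iff_isHomogeneous, totalDegree_eq_zero_iff_eq_C] at h3
  have h5 := c.hF0
  have h6 := c.hp
  rw [h3, aeval_C, FaithfulSMul.algebraMap_eq_zero_iff] at h5
  rw [h3, h5] at h6
  simp at h6

end

end
end GP

namespace GP

section
variable {k : Type} [Field k] {I : Ideal (MvPolynomial (Fin 4) k)} {l : (Fin 4 → k) →ₗ[k] (Fin 3 → k)}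
    {Q : Fin 4 → k} {σ : (Fin 3 → k) →ₗ[k] (Fin 4 → k)} {s : (Fin 4 → k) →ₗ[k] (Fin 1 → k)}
    {F : MvPolynomial (Fin 3) k} {n : ℕ}
    {A : Type} [CommRing A] [Algebra k A] {a : Fin 4 → A}

section
variable [Algebra (Polynomial k) A] [IsScalarTower k (Polynomial k) A]

lemma finite_quot {R : Type} [CommRing R] [Algebra k R] (π : A →ₐ[k] R)
    (hπ : Function.Surjective π) [Module.Finite (Polynomial k) A]
    (h0 : π (algebraMap (Polynomial k) A Polynomial.X) = 0) : Module.Finite k R := by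
  classical
  obtain ⟨t, ht⟩ := Module.Finite.fg_top (R := Polynomial k) (M := A)
  have hC : ∀ p : Polynomial k, π (algebraMap (Polynomial k) A p) = algebraMap k R (p.eval 0) := by
    intro p
    have : (π.comp (IsScalarTower.toAlgHom k (Polynomial k) A)) =
        (Algebra.ofId k R).comp (Polynomial.aeval (0 : k)) := by
      ext; simpa using h0
    have := DFunLike.congr_fun this p
    simpa [Algebra.ofId_apply, Polynomial.aeval_def, Polynomial.eval₂_eq_eval_map] using this
  refine ⟨⟨t.image π, ?_⟩⟩
  rw [eq_top_iff]
  rintro z -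
  obtain ⟨w, rfl⟩ := hπ z
  have hw : w ∈ Submodule.span (Polynomial k) (t : Set A) := by rw [ht]; trivial
  induction hw using Submodule.span_induction with
  | mem x hx => exact Submodule.subset_span (by simpa using ⟨x, hx, rfl⟩)
  | zero => rw [map_zero]; exact zero_mem _
  | add x y _ _ hx hy => rw [map_add]; exact add_mem hx hy
  | smul p x _ hx =>
    rw [Algebra.smul_def, map_mul, hC, ← Algebra.smul_def]
    exact Submodule.smul_mem _ _ hx

end

/-- points over `u`, and the tangent condition, in coordinates -/
structure PtHyp (I : Ideal (MvPolynomial (Fin 4) k)) (l : (Fin 4 → k) →ₗ[k] (Fin 3 → k))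
    (S : Finset (Fin 4 → k)) : Prop where
  mem : ∀ v ∈ Z k I, l v = Pi.single 0 1 → v ∈ S
  tan : ∀ v ∈ Z k I, l v = Pi.single 0 1 → ∀ w ∈ T I v, l w 0 = 0 → l w 1 = 0 → w = 0

lemma CoreHyp.coreR [IsAlgClosed k] (c : CoreHyp I l Q σ s F n A a) {S : Finset (Fin 4 → k)}
    (hS : PtHyp I l S) {R : Type} [CommRing R] [Algebra k R] [Module.Finite k R] (π : A →ₐ[k] R)
    (hπ : Function.Surjective π) (hx : π (lm l a 1) = 0) {m : ℕ} (hy : π (lm l a 2) ^ m = 0) :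
    Module.finrank k R ≤ S.card := by
  have hev : ∀ f : MvPolynomial (Fin 4) k, aeval (fun j => π (a j)) f = π (aeval a f) := by
    intro f
    have : aeval (fun j => π (a j)) = π.comp (aeval a) := by ext i; simp
    rw [this]; rfl
  have hev2 : ∀ (ρ : R →ₐ[k] k) (f : MvPolynomial (Fin 4) k),
      aeval (fun j => ρ (π (a j))) f = ρ (π (aeval a f)) := by
    intro ρ f
    have : aeval (fun j => ρ (π (a j))) = (ρ.comp π).comp (aeval a) := by ext i; simp
    rw [this]; rfl
  have hZ : ∀ ρ : R →ₐ[k] k, (fun j => ρ (π (a j))) ∈ Z k I := by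
    intro ρ f hf
    rw [hev2, c.haZ f hf, map_zero, map_zero]
  have hl : ∀ ρ : R →ₐ[k] k, l (fun j => ρ (π (a j))) = Pi.single 0 1 := by
    intro ρ
    rw [← lm_self]
    have := lm_map l a (ρ.comp π)
    simp only [AlgHom.comp_apply] at this
    rw [← this]
    funext i
    fin_cases i
    · simp [c.h1]
    · simp [hx]
    · have h := congrArg ρ hy
      rw [map_pow, map_zero] at h
      simpa using eq_zero_of_pow_eq_zero h
  refine core1 (fun j => π (a j)) ?_ S (fun ρ => hS.mem _ (hZ ρ) (hl ρ)) ?_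
  · intro z
    obtain ⟨w, rfl⟩ := hπ z
    obtain ⟨f, rfl⟩ := c.hgen w
    exact ⟨f, hev f⟩
  · intro ρ φ hφ
    set v : Fin 4 → k := fun j => ρ (π (a j)) with hv
    set w : Fin 4 → k := fun j => φ (π (a j) - algebraMap k R (ρ (π (a j)))) with hw
    have hwT : w ∈ T I v := by
      intro f hf
      have h3 := taylor1 (RingHom.ker ρ) (fun j => π (a j)) v (fun j => by
        rw [RingHom.mem_ker]; simp [hv]) f
      have h4 := hφ _ h3
      have h5 : eval v f = 0 := by
        have := hZ ρ f hf
        rwa [aeval_eq_eval] at this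
      rw [hev, c.haZ f hf, h5, map_zero, map_zero, sub_zero, zero_sub, map_neg, neg_eq_zero,
        map_sum] at h4
      rw [← h4, d1]
      refine Finset.sum_congr rfl fun j _ => ?_
      rw [← Algebra.smul_def, map_smul, aeval_eq_eval]
      rfl
    have hlw : ∀ i, l w i = φ (π (lm l a i) - algebraMap k R (l v i)) := by
      intro i
      have h1 : π (lm l a i) = lm l (fun j => π (a j)) i := congrFun (lm_map l a π) i
      have h2 : algebraMap k R (l v i) = lm l (fun j => algebraMap k R (v j)) i :=
        (congrFun (lm_const l v) i).symm
      rw [h1, h2, ← Pi.sub_apply, ← lm_sub, ← lm_self]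
      simp only [lm, map_sum]
      refine Finset.sum_congr rfl fun j _ => ?_
      rw [← Algebra.smul_def (A := R), map_smul]
      rfl
    have hw0 := hS.tan v (hZ ρ) (hl ρ) w hwT (by
        rw [hlw, c.h1, show l v = Pi.single 0 1 from hl ρ]; simp) (by
        rw [hlw, hx, show l v = Pi.single 0 1 from hl ρ]; simp)
    intro j
    exact congrFun hw0 j

end
end GP
open scoped TensorProduct

namespace GP

section
variable {k : Type} [Field k]

/-- The restriction of `F` to the line `u + t p`. -/
noncomputable def lineP {n : ℕ} (F : MvPolynomial (Fin n) k) (u p : Fin n → k) : Polynomial k :=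
  aeval (fun j => Polynomial.C (u j) + Polynomial.X * Polynomial.C (p j)) F

lemma charpoly_tensor {P A : Type} [CommRing P] [CommRing A] [Algebra P A] [Algebra P k]
    [Module.Finite P A] [Module.Free P A] (y : A) :
    (LinearMap.mulLeft k ((1 : k) ⊗ₜ[P] y)).charpoly =
      (LinearMap.mulLeft P y).charpoly.map (algebraMap P k) := by
  rw [← LinearMap.charpoly_baseChange]
  congr 1
  ext z
  simp

lemma charpoly_root {P A : Type} [CommRing P] [CommRing A] [Algebra P A]
    [Module.Finite P A] [Module.Free P A] (y : A) :
    Polynomial.aeval y (LinearMap.mulLeft P y).charpoly = 0 := by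
  have h := LinearMap.aeval_self_charpoly (LinearMap.mulLeft P y)
  have h2 := Polynomial.aeval_algHom_apply (Algebra.lmul P A) y (LinearMap.mulLeft P y).charpoly
  have h3 : Algebra.lmul P A y = LinearMap.mulLeft P y := rfl
  rw [h3, h] at h2
  have h4 := LinearMap.congr_fun h2 1
  simpa using h4.symm

variable {I : Ideal (MvPolynomial (Fin 4) k)} {l : (Fin 4 → k) →ₗ[k] (Fin 3 → k)}
    {Q : Fin 4 → k} {σ : (Fin 3 → k) →ₗ[k] (Fin 4 → k)} {s : (Fin 4 → k) →ₗ[k] (Fin 1 → k)}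
    {F : MvPolynomial (Fin 3) k} {n : ℕ}
    {A : Type} [CommRing A] [Algebra k A] {a : Fin 4 → A}

lemma CoreHyp.ord_aux [IsAlgClosed k] [IsDomain A] (c : CoreHyp I l Q σ s F n A a)
    {S : Finset (Fin 4 → k)} (hS : PtHyp I l S) 
    [Algebra (Polynomial k) A] [IsScalarTower k (Polynomial k) A]
    [Algebra (Polynomial k) k] [IsScalarTower k (Polynomial k) k]
    (hk : algebraMap (Polynomial k) k Polynomial.X = 0)
    (hx : algebraMap (Polynomial k) A Polynomial.X = lm l a 1) :
    ∃ g : Polynomial k, g.natTrailingDegree ≤ S.card ∧ g ≠ 0 ∧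
      (Fp F).map (algebraMap (Polynomial k) k) ∣ g := by
  have hfin := c.finite hx
  have hinj := c.inj hx
  have htf : Module.IsTorsionFree (Polynomial k) A := by
    have := (faithfulSMul_iff_algebraMap_injective (Polynomial k) A).2 hinj
    infer_instance
  have hfree : Module.Free (Polynomial k) A := Module.free_of_finite_type_torsion_free'
  have hdvd := c.Fp_dvd hx _ (charpoly_root (P := Polynomial k) (lm l a 2))
  have hdvd2 := Polynomial.map_dvd (algebraMap (Polynomial k) k) hdvd
  rw [← charpoly_tensor] at hdvd2
  refine ⟨_, ?_, (LinearMap.charpoly_monic _).ne_zero, hdvd2⟩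
  refine core2 _ _ fun m => ?_
  let V := k ⊗[Polynomial k] A
  let ι : A →ₐ[k] V :=
    { toRingHom := (Algebra.TensorProduct.includeRight : A →ₐ[Polynomial k] V).toRingHom
      commutes' := by
        intro r
        simp only [AlgHom.toRingHom_eq_coe, RingHom.toMonoidHom_eq_coe, OneHom.toFun_eq_coe,
          MonoidHom.toOneHom_coe, MonoidHom.coe_coe, RingHom.coe_coe]
        rw [IsScalarTower.algebraMap_apply k (Polynomial k) A, AlgHom.commutes,
          Algebra.TensorProduct.algebraMap_apply, Algebra.TensorProduct.algebraMap_apply,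
          ← IsScalarTower.algebraMap_apply k (Polynomial k) k] }
  have hι : ∀ z, ι z = (1 : k) ⊗ₜ[Polynomial k] z := fun z => rfl
  have hιs : Function.Surjective ι := by
    intro z
    induction z using TensorProduct.induction_on with
    | zero => exact ⟨0, map_zero _⟩
    | tmul r z =>
      refine ⟨r • z, ?_⟩
      rw [map_smul, hι, TensorProduct.smul_tmul', smul_eq_mul, mul_one]
    | add x y hx hy =>
      obtain ⟨x', rfl⟩ := hx
      obtain ⟨y', rfl⟩ := hy
      exact ⟨x' + y', map_add _ _ _⟩
  let q : V →ₐ[k] (V ⧸ Ideal.span {((1 : k) ⊗ₜ[Polynomial k] lm l a 2 : V) ^ m}) :=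
    Ideal.Quotient.mkₐ k _
  refine c.coreR hS (q.comp ι) ((Ideal.Quotient.mkₐ_surjective k _).comp hιs) ?_ (m := m) ?_
  · have : ι (lm l a 1) = 0 := by
      rw [← hx, hι, Algebra.algebraMap_eq_smul_one, ← TensorProduct.smul_tmul,
        Algebra.smul_def, hk, zero_mul, TensorProduct.zero_tmul]
    rw [AlgHom.comp_apply, this, map_zero]
  · rw [AlgHom.comp_apply, ← map_pow, hι]
    exact Ideal.Quotient.eq_zero_iff_mem.2 (Ideal.mem_span_singleton_self _)

lemma CoreHyp.ord [IsAlgClosed k] [IsDomain A] (c : CoreHyp I l Q σ s F n A a)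
    {S : Finset (Fin 4 → k)} (hS : PtHyp I l S) :
    ∃ i ≤ S.card, (lineP F (Pi.single 0 1) (Pi.single 2 1)).coeff i ≠ 0 := by
  let alg : Algebra (Polynomial k) A :=
    (Polynomial.aeval (R := k) (lm l a 1)).toRingHom.toAlgebra
  let algk : Algebra (Polynomial k) k := (Polynomial.evalRingHom (0 : k)).toAlgebra
  have hA : ∀ g, algebraMap (Polynomial k) A g = Polynomial.aeval (lm l a 1) g := fun g => rfl
  have hk : ∀ g, algebraMap (Polynomial k) k g = Polynomial.eval 0 g := fun g => rfl
  have t1 : IsScalarTower k (Polynomial k) A := IsScalarTower.of_algebraMap_eq fun r => by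
    rw [hA]; simp
  have t2 : IsScalarTower k (Polynomial k) k := IsScalarTower.of_algebraMap_eq fun r => by
    rw [hk]; simp
  obtain ⟨g, hg1, hg0, hg⟩ := c.ord_aux hS (by rw [hk]; simp) (by rw [hA]; simp)
  have h1 : (Fp F).map (algebraMap (Polynomial k) k) =
      lineP F (Pi.single 0 1) (Pi.single 2 1) := by
    have : ((Polynomial.mapAlgHom (IsScalarTower.toAlgHom k (Polynomial k) k)).comp
      (aeval (![1, Polynomial.C Polynomial.X, Polynomial.X] : Fin 3 → Polynomial (Polynomial k)) :
      MvPolynomial (Fin 3) k →ₐ[k] Polynomial (Polynomial k))) =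
      aeval (fun j => Polynomial.C ((Pi.single 0 1 : Fin 3 → k) j) +
        Polynomial.X * Polynomial.C ((Pi.single 2 1 : Fin 3 → k) j)) := by
      ext i : 1
      fin_cases i
      · simp
      · simp [hk]
      · simp
    exact DFunLike.congr_fun this F
  rw [h1] at hg
  obtain ⟨h, rfl⟩ := hg
  have hl0 : lineP F (Pi.single 0 1) (Pi.single 2 1) ≠ 0 := left_ne_zero_of_mul hg0
  rw [Polynomial.natTrailingDegree_mul hl0 (right_ne_zero_of_mul hg0)] at hg1
  refine ⟨(lineP F (Pi.single 0 1) (Pi.single 2 1)).natTrailingDegree, by omega, ?_⟩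
  exact Polynomial.trailingCoeff_nonzero_iff_nonzero.2 hl0

end
end GP

namespace GP

section
variable {k : Type} [Field k]
variable {I : Ideal (MvPolynomial (Fin 4) k)} {l : (Fin 4 → k) →ₗ[k] (Fin 3 → k)}
    {Q : Fin 4 → k} {σ : (Fin 3 → k) →ₗ[k] (Fin 4 → k)} {s : (Fin 4 → k) →ₗ[k] (Fin 1 → k)}
    {F : MvPolynomial (Fin 3) k} {n : ℕ}
    {A : Type} [CommRing A] [Algebra k A] {a : Fin 4 → A}

lemma CoreHyp.decomp_xy [IsAlgClosed k] (c : CoreHyp I l Q σ s F n A a)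
    {S : Finset (Fin 4 → k)} (hS : PtHyp I l S) (hc : S.card ≤ 1) (z : A) :
    ∃ (r : k) (z1 z2 : A), z = algebraMap k A r + lm l a 1 * z1 + lm l a 2 * z2 := by
  let alg : Algebra (Polynomial k) A :=
    (Polynomial.aeval (R := k) (lm l a 1)).toRingHom.toAlgebra
  have hA : ∀ g, algebraMap (Polynomial k) A g = Polynomial.aeval (lm l a 1) g := fun g => rfl
  have t1 : IsScalarTower k (Polynomial k) A := IsScalarTower.of_algebraMap_eq fun r => by
    rw [hA]; simp
  have hx : algebraMap (Polynomial k) A Polynomial.X = lm l a 1 := by rw [hA]; simp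
  have hfin := c.finite hx
  let J : Ideal A := Ideal.span {lm l a 1, lm l a 2}
  let π : A →ₐ[k] (A ⧸ J) := Ideal.Quotient.mkₐ k J
  have hπ : Function.Surjective π := Ideal.Quotient.mkₐ_surjective k J
  have h1 : π (lm l a 1) = 0 :=
    Ideal.Quotient.eq_zero_iff_mem.2 (Ideal.subset_span (by simp))
  have h2 : π (lm l a 2) = 0 :=
    Ideal.Quotient.eq_zero_iff_mem.2 (Ideal.subset_span (by simp))
  have hfk : Module.Finite k (A ⧸ J) := finite_quot π hπ (by rw [hx, h1])
  have hle := (c.coreR hS π hπ h1 (m := 1) (by rw [h2, pow_one])).trans hc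
  rw [finrank_le_one_iff] at hle
  obtain ⟨v, hv⟩ := hle
  have key : ∃ r : k, π z = algebraMap k _ r := by
    obtain ⟨c0, hc0⟩ := hv 1
    obtain ⟨c1, hc1⟩ := hv (π z)
    by_cases h : c0 = 0
    · refine ⟨0, ?_⟩
      rw [h, zero_smul] at hc0
      rw [map_zero, ← mul_one (π z), ← hc0, mul_zero]
    · refine ⟨c1 * c0⁻¹, ?_⟩
      rw [Algebra.algebraMap_eq_smul_one, ← hc0, smul_smul, mul_assoc, inv_mul_cancel₀ h, mul_one,
        hc1]
  obtain ⟨r, hr⟩ := key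
  have h3 : π (z - algebraMap k A r) = 0 := by rw [map_sub, hr, AlgHom.commutes, sub_self]
  have h4 : z - algebraMap k A r ∈ J := Ideal.Quotient.eq_zero_iff_mem.1 h3
  obtain ⟨z1, z2, h⟩ := Ideal.mem_span_pair.1 h4
  exact ⟨r, z1, z2, by linear_combination -h⟩

lemma CoreHyp.bir_aux [IsAlgClosed k] (c : CoreHyp I l Q σ s F n A a)
    {S : Finset (Fin 4 → k)} (hS : PtHyp I l S) (hc : S.card ≤ 1) (z : A) :
    ∃ r τ : MvPolynomial (Fin 3) k, eval (Pi.single 0 1) r = 1 ∧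
      aeval (lm l a) r * z = aeval (lm l a) τ := by
  let B := MvPolynomial (Fin 3) k
  let alg : Algebra B A := (aeval (R := k) (lm l a)).toRingHom.toAlgebra
  have hA : ∀ g : B, algebraMap B A g = aeval (lm l a) g := fun g => rfl
  have t1 : IsScalarTower k B A := IsScalarTower.of_algebraMap_eq fun r => by
    rw [hA]; simp [B]
  have hfin : Module.Finite B A := by
    refine finite_of_integral c.hgen B fun j => ?_
    refine integral_proj c.hH c.dec c.hQ (R := B) X a c.haZ ?_ j
    intro i
    rw [hA, aeval_X]
  let N : Submodule B A := LinearMap.range (Algebra.linearMap B A)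
  let m : Ideal B := RingHom.ker (eval (Pi.single 0 1 : Fin 3 → k))
  have hle : (⊤ : Submodule B (A ⧸ N)) ≤ m • ⊤ := by
    rintro w -
    obtain ⟨z, rfl⟩ := Submodule.Quotient.mk_surjective _ w
    obtain ⟨r, z1, z2, h⟩ := c.decomp_xy hS hc z
    have h' : z = algebraMap B A (C r) + (X 1 : B) • z1 + (X 2 : B) • z2 := by
      rw [h, Algebra.smul_def, Algebra.smul_def, hA, hA, hA, aeval_X, aeval_X, aeval_C]
    have hz0 : (Submodule.Quotient.mk (algebraMap B A (C r)) : A ⧸ N) = 0 :=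
      (Submodule.Quotient.mk_eq_zero N).2 ⟨C r, rfl⟩
    rw [h', Submodule.Quotient.mk_add, Submodule.Quotient.mk_add, Submodule.Quotient.mk_smul,
      Submodule.Quotient.mk_smul, hz0, zero_add]
    refine add_mem (Submodule.smul_mem_smul ?_ trivial) (Submodule.smul_mem_smul ?_ trivial)
    · show eval _ (X 1 : MvPolynomial (Fin 3) k) = 0
      rw [eval_X]; simp
    · show eval _ (X 2 : MvPolynomial (Fin 3) k) = 0
      rw [eval_X]; simp
  obtain ⟨r, hr, h⟩ := Submodule.exists_sub_one_mem_and_smul_eq_zero_of_fg_of_le_smul m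
    (⊤ : Submodule B (A ⧸ N)) Module.Finite.fg_top hle
  have h0 := h (Submodule.Quotient.mk z) trivial
  rw [← Submodule.Quotient.mk_smul, Submodule.Quotient.mk_eq_zero] at h0
  obtain ⟨τ, hτ⟩ := h0
  refine ⟨r, τ, ?_, ?_⟩
  · rw [RingHom.mem_ker, map_sub, map_one, sub_eq_zero] at hr
    exact hr
  · rw [← hA, ← Algebra.smul_def, ← hA]
    exact hτ.symm

lemma CoreHyp.bir [IsAlgClosed k] (c : CoreHyp I l Q σ s F n A a)
    {S : Finset (Fin 4 → k)} (hS : PtHyp I l S) (hc : S.card ≤ 1) :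
    ∃ (N : ℕ) (b b' : MvPolynomial (Fin 3) k), b.IsHomogeneous N ∧ b'.IsHomogeneous (N + 1) ∧
      eval (Pi.single 0 1) b ≠ 0 ∧ aeval a (lm s X 0 * pull l b - pull l b') = 0 := by
  obtain ⟨r, τ, h1, h2⟩ := c.bir_aux hS hc (lm s a 0)
  obtain ⟨N1, G1, hG1, e1⟩ := homogenize (isHomogeneous_X k (0 : Fin 3)) r
  obtain ⟨N2, G2, hG2, e2⟩ := homogenize (isHomogeneous_X k (0 : Fin 3)) τ
  refine ⟨N1 + N2, G1 * X 0 ^ N2, G2 * X 0 ^ (N1 + 1), ?_, ?_, ?_, ?_⟩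
  · simpa using hG1.mul ((isHomogeneous_X k (0 : Fin 3)).pow N2)
  · have := hG2.mul ((isHomogeneous_X k (0 : Fin 3)).pow (N1 + 1))
    rw [show N1 + N2 + 1 = N2 + 1 * (N1 + 1) by ring]
    exact this
  · have := e1 k (Pi.single 0 1) 1 (by simp)
    rw [one_smul, one_pow, one_mul, aeval_eq_eval] at this
    rw [map_mul, this, h1]
    simp
  · have f1 := e1 A (lm l a) 1 (by rw [aeval_X, c.h1])
    have f2 := e2 A (lm l a) 1 (by rw [aeval_X, c.h1])
    rw [one_smul, one_pow, one_mul] at f1 f2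
    have hs : aeval a (lm s X 0 : MvPolynomial (Fin 4) k) = lm s a 0 := by
      have := congrFun (lm_map s (X : Fin 4 → MvPolynomial (Fin 4) k) (aeval a)) 0
      rw [this]; simp
    rw [map_sub, map_mul, aeval_pull, aeval_pull, map_mul, map_mul, f1, f2, hs, map_pow, map_pow,
      aeval_X, c.h1, one_pow, one_pow, ← h2]
    ring

end
end GP

namespace GP

section
variable {k : Type} [Field k]

/-- the projected curve with its equation -/
structure Setup (I : Ideal (MvPolynomial (Fin 4) k)) (l : (Fin 4 → k) →ₗ[k] (Fin 3 → k))
    (Q : Fin 4 → k) (σ : (Fin 3 → k) →ₗ[k] (Fin 4 → k)) (s : (Fin 4 → k) →ₗ[k] (Fin 1 → k))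
    (F : MvPolynomial (Fin 3) k) (n : ℕ) : Prop where
  prime : I.IsPrime
  hH : Hom I
  dec : Dec l Q σ s
  hQ : Q ∉ Z k I
  irr : Irreducible F
  hF : F.IsHomogeneous n
  dvd : ∀ G, pull l G ∈ I ↔ F ∣ G

variable {I : Ideal (MvPolynomial (Fin 4) k)} {l : (Fin 4 → k) →ₗ[k] (Fin 3 → k)}
    {Q : Fin 4 → k} {σ : (Fin 3 → k) →ₗ[k] (Fin 4 → k)} {s : (Fin 4 → k) →ₗ[k] (Fin 1 → k)}
    {F : MvPolynomial (Fin 3) k} {n : ℕ}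

lemma exists_coord {u p : Fin 3 → k} (hu : u ≠ 0) (hp : ∀ c : k, p ≠ c • u) :
    ∃ g : (Fin 3 → k) ≃ₗ[k] (Fin 3 → k), g u = Pi.single 0 1 ∧ g p = Pi.single 2 1 := by
  have h2 : LinearIndependent k ![u, p] := by
    rw [LinearIndependent.pair_iff' hu]
    intro a h; exact hp a h.symm
  obtain ⟨q, hq⟩ := exists_not_mem (Submodule.span k (Set.range ![u, p])) (by
    rw [finrank_span_eq_card h2]; simp)
  have h3 : LinearIndependent k ![q, u, p] := linearIndependent_finCons.2 ⟨h2, hq⟩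
  let b := basisOfLinearIndependentOfCardEqFinrank h3 (by simp)
  have hb : ⇑b = ![q, u, p] := coe_basisOfLinearIndependentOfCardEqFinrank h3 (by simp)
  let b' := b.reindex (Equiv.swap 0 1)
  refine ⟨b'.equivFun, ?_, ?_⟩
  · have : b' 0 = u := by
      simp [b', hb]
    rw [← this]; funext i; rw [Module.Basis.equivFun_self]; simp [Pi.single_apply, eq_comm]
  · have : b' 2 = p := by
      simp [b', hb, Equiv.swap_apply_of_ne_of_ne]
    rw [← this]; funext i; rw [Module.Basis.equivFun_self]; simp [Pi.single_apply, eq_comm]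

lemma Dec.comp (hd : Dec l Q σ s) (g : (Fin 3 → k) ≃ₗ[k] (Fin 3 → k)) :
    Dec (g.toLinearMap ∘ₗ l) Q (σ ∘ₗ g.symm.toLinearMap) s := by
  have h : (σ ∘ₗ g.symm.toLinearMap) ∘ₗ (g.toLinearMap ∘ₗ l) = σ ∘ₗ l := by
    ext; simp
  refine ⟨?_, ?_, ?_⟩
  · intro u; simp [hd.sec]
  · intro v; simpa using hd.eqn v
  · intro E _ _ b j
    rw [← lm_comp, h, lm_comp]
    exact hd.eqnE E b j

lemma Setup.transfer (c : Setup I l Q σ s F n) {u p : Fin 3 → k} (hu : u ≠ 0)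
    (hp : ∀ c : k, p ≠ c • u) (hFu : eval u F = 0) (hFp : eval p F ≠ 0) :
    ∃ (g : (Fin 3 → k) ≃ₗ[k] (Fin 3 → k)) (A : Type) (_ : CommRing A) (_ : IsDomain A)
      (_ : Algebra k A) (a : Fin 4 → A), g u = Pi.single 0 1 ∧ g p = Pi.single 2 1 ∧
      (∀ f d, f.IsHomogeneous d → aeval a f = 0 → f ∈ I) ∧
      CoreHyp I (g.toLinearMap ∘ₗ l) Q (σ ∘ₗ g.symm.toLinearMap) s
        (pull g.symm.toLinearMap F) n A a := by
  obtain ⟨g, hgu, hgp⟩ := exists_coord hu hp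
  have hgu' : g.symm (Pi.single 0 1) = u := by rw [← hgu]; simp
  have hgp' : g.symm (Pi.single 2 1) = p := by rw [← hgp]; simp
  have hgg : g.symm.toLinearMap ∘ₗ g.toLinearMap = LinearMap.id := by ext; simp
  have hgg' : g.toLinearMap ∘ₗ g.symm.toLinearMap = LinearMap.id := by ext; simp
  have hdvd : ∀ G, pull (g.toLinearMap ∘ₗ l) G ∈ I ↔ pull g.symm.toLinearMap F ∣ G := by
    intro G
    rw [← pull_pull, c.dvd]
    constructor
    · intro h
      have := pull_dvd g.symm.toLinearMap h
      rwa [pull_pull, hgg', pull_id] at this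
    · intro h
      have := pull_dvd g.toLinearMap h
      rwa [pull_pull, hgg, pull_id] at this
  have hμ : lm (g.toLinearMap ∘ₗ l) (X : Fin 4 → MvPolynomial (Fin 4) k) 0 ∉ I := by
    intro h
    have h1 : pull (g.toLinearMap ∘ₗ l) (X 0) ∈ I := by
      rw [pull, aeval_X]; exact h
    rw [hdvd] at h1
    obtain ⟨q, hq⟩ := h1
    have := congrArg (eval (Pi.single 0 1)) hq
    rw [map_mul, eval_pull, LinearEquiv.coe_coe, hgu', hFu, zero_mul, eval_X] at this
    simp at this
  obtain ⟨A, i1, i2, i3, a, h1, h2, h3, h4⟩ := exists_normalized' I c.prime c.hH (lm_hom _ 0) hμ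
  refine ⟨g, A, i1, i2, i3, a, hgu, hgp, h3, ?_⟩
  have hev : ∀ G, aeval (lm (g.toLinearMap ∘ₗ l) a) G = aeval a (pull (g.toLinearMap ∘ₗ l) G) :=
    fun G => (aeval_pull _ _ _).symm
  exact 
  { hH := c.hH
    dec := c.dec.comp g
    hQ := c.hQ
    hF := pull_hom _ c.hF
    haZ := h2
    h1 := by
      have := hev (X 0)
      rw [aeval_X, pull, aeval_X, h1] at this
      exact this
    hgen := h4
    hF0 := by
      rw [hev]; exact h2 _ ((hdvd _).2 dvd_rfl)
    hFd := by
      intro G d hG h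
      rw [← hdvd]
      rw [hev] at h
      exact h3 _ d (pull_hom _ hG) h
    hp := by
      rw [eval_pull, LinearEquiv.coe_coe, hgp']; exact hFp }

/-- points over `u` and tangency -/
structure PtHyp' (I : Ideal (MvPolynomial (Fin 4) k)) (l : (Fin 4 → k) →ₗ[k] (Fin 3 → k))
    (u p : Fin 3 → k) (S : Finset (Fin 4 → k)) : Prop where
  mem : ∀ v ∈ Z k I, l v = u → v ∈ S
  tan : ∀ v ∈ Z k I, l v = u → ∀ w ∈ T I v, ∀ c : k, l w = c • p → w = 0

lemma PtHyp'.transfer {u p : Fin 3 → k} {S : Finset (Fin 4 → k)} (hS : PtHyp' I l u p S)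
    (g : (Fin 3 → k) ≃ₗ[k] (Fin 3 → k)) (hgu : g u = Pi.single 0 1) (hgp : g p = Pi.single 2 1) :
    PtHyp I (g.toLinearMap ∘ₗ l) S := by
  have hm : ∀ v, (g.toLinearMap ∘ₗ l) v = Pi.single 0 1 → l v = u := by
    intro v hv
    rw [LinearMap.comp_apply, LinearEquiv.coe_coe, ← hgu] at hv
    exact g.injective hv
  refine ⟨fun v hv h => hS.mem v hv (hm v h), fun v hv h w hw h0 h1 => ?_⟩
  refine hS.tan v hv (hm v h) w hw ((g (l w)) 2) ?_
  apply g.injective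
  rw [map_smul, hgp]
  funext i
  fin_cases i
  · simpa using h0
  · simpa using h1
  · simp

lemma Setup.ord [IsAlgClosed k] (c : Setup I l Q σ s F n) {u p : Fin 3 → k} (hu : u ≠ 0)
    (hp : ∀ c : k, p ≠ c • u) (hFu : eval u F = 0) (hFp : eval p F ≠ 0)
    {S : Finset (Fin 4 → k)} (hS : PtHyp' I l u p S) :
    ∃ i ≤ S.card, (lineP F u p).coeff i ≠ 0 := by
  obtain ⟨g, A, i1, i2, i3, a, hgu, hgp, h3, hc⟩ := c.transfer hu hp hFu hFp
  have := hc.ord (hS.transfer g hgu hgp)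
  have e : lineP (pull g.symm.toLinearMap F) (Pi.single 0 1) (Pi.single 2 1) = lineP F u p := by
    have hgu' : g.symm (Pi.single 0 1) = u := by rw [← hgu]; simp
    have hgp' : g.symm (Pi.single 2 1) = p := by rw [← hgp]; simp
    rw [lineP, aeval_pull, lineP]
    congr 2
    have h1 := lm_const (E := Polynomial k) g.symm.toLinearMap (Pi.single 0 1)
    have h2 := lm_const (E := Polynomial k) g.symm.toLinearMap (Pi.single 2 1)
    have h3 := lm_add g.symm.toLinearMap
      (fun j => Polynomial.C ((Pi.single 0 1 : Fin 3 → k) j))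
      ((Polynomial.X : Polynomial k) • fun j => Polynomial.C ((Pi.single 2 1 : Fin 3 → k) j))
    rw [lm_smul] at h3
    simp only [LinearEquiv.coe_coe, hgu', hgp', Polynomial.algebraMap_eq] at h1 h2
    rw [h1, h2] at h3
    exact h3
  rw [e] at this
  exact this

lemma Setup.bir [IsAlgClosed k] (c : Setup I l Q σ s F n) {u p : Fin 3 → k} (hu : u ≠ 0)
    (hp : ∀ c : k, p ≠ c • u) (hFu : eval u F = 0) (hFp : eval p F ≠ 0)
    {S : Finset (Fin 4 → k)} (hS : PtHyp' I l u p S) (hcard : S.card ≤ 1) :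
    ∃ (N : ℕ) (b b' : MvPolynomial (Fin 3) k), b.IsHomogeneous N ∧ b'.IsHomogeneous (N + 1) ∧
      pull l b ∉ I ∧ lm s X 0 * pull l b - pull l b' ∈ I := by
  obtain ⟨g, A, i1, i2, i3, a, hgu, hgp, h3, hc⟩ := c.transfer hu hp hFu hFp
  obtain ⟨N, b, b', hb, hb', hne, h⟩ := hc.bir (hS.transfer g hgu hgp) hcard
  refine ⟨N, pull g.toLinearMap b, pull g.toLinearMap b', pull_hom _ hb, pull_hom _ hb', ?_, ?_⟩
  · rw [c.dvd]
    rintro ⟨q, hq⟩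
    have := congrArg (eval u) hq
    rw [map_mul, hFu, zero_mul, eval_pull, LinearEquiv.coe_coe, hgu] at this
    exact hne this
  · rw [pull_pull, pull_pull]
    refine h3 _ (N + 1) ?_ h
    refine IsHomogeneous.sub ?_ (pull_hom _ hb')
    rw [add_comm]
    exact (lm_hom s 0).mul (pull_hom _ hb)

end
end GP

namespace GP

section
variable {k : Type} [Field k]

lemma d1_lm {n m : ℕ} (ℓ : (Fin n → k) →ₗ[k] (Fin m → k)) (i : Fin m) (v w : Fin n → k) :
    d1 (lm ℓ (X : Fin n → MvPolynomial (Fin n) k) i) v w = ℓ w i := by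
  rw [← lm_self]
  simp only [d1, lm, map_sum, algebraMap_eq, Derivation.leibniz, pderiv_C, pderiv_X, smul_eq_mul,
    mul_zero, add_zero, Pi.single_apply]
  refine Finset.sum_congr rfl fun j _ => ?_
  simp [apply_ite]

lemma aeval_lm {n m : ℕ} {E : Type} [CommRing E] [Algebra k E] (ℓ : (Fin n → k) →ₗ[k] (Fin m → k))
    (i : Fin m) (b : Fin n → E) :
    aeval b (lm ℓ (X : Fin n → MvPolynomial (Fin n) k) i) = lm ℓ b i := by
  have := aeval_pull ℓ (X i) b
  rwa [pull, aeval_X, aeval_X] at this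

lemma exists_dual {n : ℕ} {v w : Fin n → k} (hv : ∀ c : k, v ≠ c • w) :
    ∃ ℓ : (Fin n → k) →ₗ[k] (Fin 1 → k), ℓ v 0 = 1 ∧ ℓ w 0 = 0 := by
  obtain ⟨φ, h1, h2⟩ := exists_functional (Submodule.span k {w}) (z := v) (by
    rw [Submodule.mem_span_singleton]
    rintro ⟨c, h⟩
    exact hv c h.symm)
  refine ⟨LinearMap.pi fun _ => (φ v)⁻¹ • φ, ?_, ?_⟩
  · simp [h2]
  · simp [h1 w (Submodule.mem_span_singleton_self w)]

lemma second_order [CharZero k] {I : Ideal (MvPolynomial (Fin 4) k)} (hI : I.IsPrime) (hH : Hom I)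
    {v w : Fin 4 → k} (hv : v ∈ Z k I) (hT : Module.finrank k (T I v) ≤ 2) (hv0 : v ≠ 0)
    (hw : w ∈ T I v) (hvw : ∀ c : k, w ≠ c • v) {g : MvPolynomial (Fin 4) k} (hg : g ∈ I)
    (hg1 : ∀ h, d1 g v h = 0) : d2 g v w w = 0 := by
  have hspan := le_span_pair hT (self_mem_T hH hv) hv0 hw hvw
  have hw0 : w ≠ 0 := fun h => hvw 0 (by rw [h, zero_smul])
  obtain ⟨t, ht1, ht0⟩ := exists_dual hvw
  obtain ⟨ℓ, hl1, hl0⟩ := exists_dual (v := v) (w := w) (by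
    intro c h
    by_cases hc : c = 0
    · exact hv0 (by rw [h, hc, zero_smul])
    · exact hvw c⁻¹ (by rw [h, smul_smul, inv_mul_cancel₀ hc, one_smul]))
  set m : MvPolynomial (Fin 4) k := lm ℓ X 0 with hm
  have hmh : m.IsHomogeneous 1 := lm_hom ℓ 0
  have hmv : eval v m = 1 := by
    have := aeval_lm ℓ 0 v
    rw [lm_self, hl1, aeval_eq_eval] at this
    exact this
  have hmI : m ∉ I := by
    intro h
    have := hv m h
    rw [aeval_eq_eval] at this
    exact one_ne_zero (hmv.symm.trans this)
  obtain ⟨A, i1, i2, i3, a, h1, h2, h3, h4⟩ := exists_normalized' I hI hH hmh hmI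
  have hker : ∀ f : MvPolynomial (Fin 4) k, aeval a f = 0 → eval v f = 0 := by
    intro f hf
    obtain ⟨N, G, hG, e⟩ := homogenize hmh f
    have e1 := e A a 1 h1
    rw [one_smul, one_pow, one_mul, hf] at e1
    have e2 := hv G (h3 G N hG e1)
    have e3 := e k v 1 (by rw [aeval_eq_eval]; exact hmv)
    rw [one_smul, one_pow, one_mul, e2, aeval_eq_eval] at e3
    exact e3.symm
  have hnoeth : IsNoetherianRing A :=
    isNoetherianRing_of_surjective (MvPolynomial (Fin 4) k) A (aeval a).toRingHom h4
  let N : Ideal A := Ideal.map (aeval (R := k) a).toRingHom (RingHom.ker (eval v))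
  have hN : ∀ z, z ∈ N ↔ ∃ f : MvPolynomial (Fin 4) k, eval v f = 0 ∧ aeval a f = z := by
    intro z
    exact Ideal.mem_map_iff_of_surjective (aeval (R := k) a).toRingHom h4
  have hN1 : (1 : A) ∉ N := by
    rw [hN]
    rintro ⟨f, hf, hf1⟩
    have := hker (f - 1) (by rw [map_sub, hf1, map_one, sub_self])
    rw [map_sub, hf, map_one] at this
    simp at this
  have hδ : ∀ j, a j - algebraMap k A (v j) ∈ N := by
    intro j
    rw [hN]
    exact ⟨X j - C (v j), by simp, by simp⟩
  set τ : A := lm t a 0 with hτ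
  have hτN : τ ∈ N := by
    rw [hN]
    refine ⟨lm t X 0, ?_, aeval_lm t 0 a⟩
    have := aeval_lm t 0 v
    rw [lm_self, ht0, aeval_eq_eval] at this
    exact this
  -- the linear part
  have hε : ∀ j, a j - algebraMap k A (v j) - algebraMap k A (w j) * τ ∈ N ^ 2 := by
    intro j
    by_contra hcon
    obtain ⟨φ, hφ, hφ0⟩ := exists_functional ((N ^ 2).restrictScalars k) (z := _) hcon
    apply hφ0
    set w' : Fin 4 → k := fun j => φ (a j - algebraMap k A (v j)) with hw'
    have hw'T : w' ∈ T I v := by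
      intro f hf
      have e1 := hφ _ (taylor1 N a v hδ f)
      have e2 : eval v f = 0 := by
        have := hv f hf
        rwa [aeval_eq_eval] at this
      rw [h2 f hf, e2, map_zero, zero_sub, neg_zero, zero_sub, map_neg, neg_eq_zero, map_sum] at e1
      rw [← e1, d1]
      refine Finset.sum_congr rfl fun j _ => ?_
      rw [← Algebra.smul_def, map_smul, aeval_eq_eval]
      rfl
    have hlin : ∀ q : (Fin 4 → k) →ₗ[k] (Fin 1 → k),
        q w' 0 = φ (lm q a 0 - algebraMap k A (q v 0)) := by
      intro q
      have e2 : algebraMap k A (q v 0) = lm q (fun j => algebraMap k A (v j)) 0 :=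
        (congrFun (lm_const q v) 0).symm
      rw [e2, ← Pi.sub_apply, ← lm_sub, ← lm_self]
      simp only [lm, map_sum]
      refine Finset.sum_congr rfl fun j _ => ?_
      rw [← Algebra.smul_def (A := A), map_smul]
      rfl
    have hla : lm ℓ a 0 = 1 := by rw [← aeval_lm, ← hm, h1]
    have e3 := hlin ℓ
    rw [hla, hl1, map_one, sub_self, map_zero] at e3
    have e4 := hlin t
    rw [ht0, map_zero, sub_zero, ← hτ] at e4
    obtain ⟨α, β, h⟩ := Submodule.mem_span_pair.1 (hspan hw'T)
    rw [← h] at e3 e4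
    have hα : α = 0 := by simpa [hl1, hl0] using e3
    have hβ : β = φ τ := by simpa [ht1, ht0] using e4
    rw [map_sub, ← Algebra.smul_def, map_smul, ← hβ]
    have := congrFun h j
    rw [hα, zero_smul, zero_add] at this
    show w' j - _ = 0
    rw [← this]
    simp [mul_comm]
  have hN3 : ∀ x ∈ N, ∀ y ∈ N ^ 2, x * y ∈ N ^ 3 := by
    intro x hx y hy
    rw [pow_succ' N 2]
    exact Ideal.mul_mem_mul hx hy
  have hH1 : algebraMap k A (d2 g v w w) * τ ^ 2 ∈ N ^ 3 := by
    have e1 := taylor2 N a v hδ g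
    have e2 : eval v g = 0 := by
      have := hv g hg
      rwa [aeval_eq_eval] at this
    have e3 : ∀ j, eval v (pderiv j g) = 0 := by
      intro j
      have := hg1 (Pi.single j 1)
      simpa [d1, Pi.single_apply, aeval_eq_eval] using this
    simp only [h2 g hg, e2, e3, map_zero, zero_mul, mul_zero, sub_zero, Finset.sum_const_zero,
      zero_sub] at e1
    rw [neg_mem_iff] at e1
    rw [← Submodule.sub_mem_iff_left _ e1 (x := algebraMap k A (d2 g v w w) * τ ^ 2), d2, map_sum,
      Finset.sum_mul, ← Finset.sum_sub_distrib]
    refine sum_mem fun i _ => ?_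
    rw [map_sum, Finset.sum_mul, ← Finset.sum_sub_distrib]
    refine sum_mem fun j _ => ?_
    rw [aeval_eq_eval]
    have q1 := hN3 _ (hδ i) _ (hε j)
    have q2 := hN3 _ hτN _ (hε i)
    have q3 := add_mem (Ideal.mul_mem_left _ (algebraMap k A (eval v (pderiv i (pderiv j g)))) q1)
      (Ideal.mul_mem_left _ (algebraMap k A (eval v (pderiv i (pderiv j g))) *
        algebraMap k A (w j)) q2)
    have q4 := neg_mem q3
    convert! q4 using 1
    simp only [map_mul, RingHom.coe_coe]
    ring
  by_contra hne
  have hτ2 : τ ^ 2 ∈ N ^ 3 := by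
    have := Ideal.mul_mem_left _ (algebraMap k A (d2 g v w w)⁻¹) hH1
    rwa [← mul_assoc, ← map_mul, inv_mul_cancel₀ hne, map_one, one_mul] at this
  have hNτ : ∀ z ∈ N, ∃ r : k, z - algebraMap k A r * τ ∈ N ^ 2 := by
    intro z hz
    obtain ⟨f, hf, rfl⟩ := (hN z).1 hz
    have e1 := taylor1 N a v hδ f
    rw [hf, map_zero, sub_zero] at e1
    refine ⟨d1 f v w, ?_⟩
    have e2 : ∑ j, algebraMap k A (eval v (pderiv j f)) *
      (a j - algebraMap k A (v j) - algebraMap k A (w j) * τ) ∈ N ^ 2 :=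
      sum_mem fun j _ => Ideal.mul_mem_left _ _ (hε j)
    convert! add_mem e1 e2 using 1
    simp only [d1, map_sum, aeval_eq_eval, mul_sub, Finset.sum_sub_distrib, map_mul, RingHom.coe_coe,
      Finset.sum_mul, mul_assoc]
    ring
  have hle : N ^ 2 ≤ N • N ^ 2 := by
    have : N • N ^ 2 = N ^ 3 := by rw [smul_eq_mul, pow_succ' N 2]
    rw [this, pow_two, Ideal.mul_le]
    intro x hx y hy
    obtain ⟨r, hr⟩ := hNτ x hx
    obtain ⟨r', hr'⟩ := hNτ y hy
    have q1 := hN3 _ hx _ hr'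
    have q2 := hN3 _ hτN _ hr
    have q3 := add_mem (add_mem q1 (Ideal.mul_mem_left _ (algebraMap k A r') q2))
      (Ideal.mul_mem_left _ (algebraMap k A r * algebraMap k A r') hτ2)
    convert! q3 using 1
    ring
  obtain ⟨r, hr, hr0⟩ := Submodule.exists_sub_one_mem_and_smul_eq_zero_of_fg_of_le_smul N
    (N ^ 2) ((isNoetherianRing_iff_ideal_fg A).1 hnoeth _) hle
  have hr' : r ≠ 0 := by
    rintro rfl
    rw [zero_sub, neg_mem_iff] at hr
    exact hN1 hr
  have hN0 : ∀ z ∈ N, z = 0 := by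
    intro z hz
    have := hr0 (z ^ 2) (Ideal.pow_mem_pow hz 2)
    rw [smul_eq_mul] at this
    exact eq_zero_of_pow_eq_zero ((mul_eq_zero.1 this).resolve_left hr')
  apply hw0
  funext j
  have e1 := hN0 _ (hδ j)
  have e2 : X j - C (v j) * m ∈ I := by
    refine h3 _ 1 ?_ ?_
    · refine IsHomogeneous.sub (isHomogeneous_X k j) ?_
      simpa using (isHomogeneous_C (Fin 4) (v j)).mul hmh
    · rw [map_sub, map_mul, aeval_X, h1, aeval_C, mul_one, e1]
  have e3 := hw _ e2
  have e4 : d1 (X j - C (v j) * m) v w + d1 (C (v j) * m) v w = w j := by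
    rw [← d1_add, sub_add_cancel, d1_X]
  rw [e3, d1_mul, d1_C, hm, d1_lm, hl0] at e4
  simpa using e4.symm

end
end GP

namespace GP

section
variable {k : Type} [Field k]

lemma pderiv_pull {n m : ℕ} (l : (Fin n → k) →ₗ[k] (Fin m → k)) (f : MvPolynomial (Fin m) k)
    (j : Fin n) :
    pderiv j (pull l f) = ∑ i, C (l (Pi.single j 1) i) * pull l (pderiv i f) := by
  induction f using MvPolynomial.induction_on with
  | C c => simp [pull]
  | add p q hp hq =>
    have h1 : ∀ a b : MvPolynomial (Fin m) k, pull l (a + b) = pull l a + pull l b :=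
      fun a b => map_add _ _ _
    simp only [h1, map_add, hp, hq, mul_add, Finset.sum_add_distrib]
  | mul_X p r hp =>
    have h1 : ∀ a b : MvPolynomial (Fin m) k, pull l (a + b) = pull l a + pull l b :=
      fun a b => map_add _ _ _
    have hX : ∀ r, pull l (X r) = lm l X r := fun r => by rw [pull, aeval_X]
    have h2 : pderiv j (lm l (X : Fin n → MvPolynomial (Fin n) k) r) = C (l (Pi.single j 1) r) := by
      simp only [lm, map_sum, algebraMap_eq, Derivation.leibniz, pderiv_C, pderiv_X, smul_eq_mul,
        mul_zero, add_zero, Pi.single_apply]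
      simp
    simp only [pull_mul, Derivation.leibniz, smul_eq_mul, hp, hX, h2, h1, mul_add,
      Finset.sum_add_distrib, pderiv_X, Pi.single_apply]
    congr 1
    · rw [Finset.sum_eq_single r]
      · simp [pull]; ring
      · intro b _ hb; simp [pull, hb.symm]
      · simp
    · rw [Finset.mul_sum]
      exact Finset.sum_congr rfl fun i _ => by ring

lemma d1_pull {n m : ℕ} (l : (Fin n → k) →ₗ[k] (Fin m → k)) (f : MvPolynomial (Fin m) k)
    (v w : Fin n → k) : d1 (pull l f) v w = d1 f (l v) (l w) := by
  have hw : ∀ i, l w i = ∑ j, l (Pi.single j 1) i * w j := fun i => by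
    rw [← lm_self]; rfl
  simp only [d1, pderiv_pull, map_sum, map_mul, aeval_C, aeval_pull, lm_self, hw, Finset.sum_mul,
    Finset.mul_sum]
  rw [Finset.sum_comm]
  refine Finset.sum_congr rfl fun i _ => Finset.sum_congr rfl fun j _ => ?_
  simp only [Algebra.algebraMap_self, RingHom.id_apply]
  ring

lemma d1_sum {n : ℕ} {ι : Type} (t : Finset ι) (f : ι → MvPolynomial (Fin n) k) (v w : Fin n → k) :
    d1 (∑ i ∈ t, f i) v w = ∑ i ∈ t, d1 (f i) v w := by
  simp only [d1, map_sum, Finset.sum_mul]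
  rw [Finset.sum_comm]

lemma d2_pull {n m : ℕ} (l : (Fin n → k) →ₗ[k] (Fin m → k)) (f : MvPolynomial (Fin m) k)
    (v w w' : Fin n → k) : d2 (pull l f) v w w' = d2 f (l v) (l w) (l w') := by
  have hw : ∀ i, l w' i = ∑ j, l (Pi.single j 1) i * w' j := fun i => by
    rw [← lm_self]; rfl
  rw [d2_eq_d1, d2_eq_d1]
  simp only [pderiv_pull, d1_sum, d1_mul, d1_C, aeval_C, mul_zero, add_zero, d1_pull, hw,
    Finset.sum_mul, Finset.mul_sum]
  rw [Finset.sum_comm]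
  refine Finset.sum_congr rfl fun i _ => Finset.sum_congr rfl fun j _ => ?_
  simp only [Algebra.algebraMap_self, RingHom.id_apply]
  ring

lemma lineP_coeff {n : ℕ} (F : MvPolynomial (Fin n) k) (u p : Fin n → k) [CharZero k] :
    (lineP F u p).coeff 0 = eval u F ∧ (lineP F u p).coeff 1 = d1 F u p ∧
      2 * (lineP F u p).coeff 2 = d2 F u p p := by
  have h := taylor2 (Ideal.span {(Polynomial.X : Polynomial k)})
    (fun j => Polynomial.C (u j) + Polynomial.X * Polynomial.C (p j)) u (by
      intro j
      rw [Ideal.mem_span_singleton]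
      exact ⟨Polynomial.C (p j), by simp⟩) F
  rw [Ideal.span_singleton_pow, Ideal.mem_span_singleton, Polynomial.X_pow_dvd_iff] at h
  rw [← lineP] at h
  have e1 : 2 * ∑ j, algebraMap k (Polynomial k) (eval u (pderiv j F)) *
        (Polynomial.C (u j) + Polynomial.X * Polynomial.C (p j) - algebraMap k (Polynomial k) (u j))
        = Polynomial.C (2 * d1 F u p) * Polynomial.X ^ 1 := by
    simp only [Polynomial.algebraMap_eq, add_sub_cancel_left, d1, map_mul, map_sum,
      aeval_eq_eval, RingHom.coe_coe, Finset.mul_sum, Finset.sum_mul]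
    refine Finset.sum_congr rfl fun i _ => ?_
    simp only [map_ofNat]
    ring
  have e2 : ∑ i, ∑ j, algebraMap k (Polynomial k) (eval u (pderiv i (pderiv j F))) *
        (Polynomial.C (u i) + Polynomial.X * Polynomial.C (p i) - algebraMap k (Polynomial k) (u i))
        * (Polynomial.C (u j) + Polynomial.X * Polynomial.C (p j)
          - algebraMap k (Polynomial k) (u j))
        = Polynomial.C (d2 F u p p) * Polynomial.X ^ 2 := by
    simp only [Polynomial.algebraMap_eq, add_sub_cancel_left, d2, map_mul, map_sum,
      aeval_eq_eval, RingHom.coe_coe, Finset.sum_mul]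
    refine Finset.sum_congr rfl fun i _ => Finset.sum_congr rfl fun j _ => ?_
    ring
  have e3 : (2 : Polynomial k) = Polynomial.C 2 := (map_ofNat _ _).symm
  rw [e1, e2, e3, Polynomial.algebraMap_eq, ← Polynomial.C_mul] at h
  have h0 := h 0 (by norm_num)
  have h1 := h 1 (by norm_num)
  have h2 := h 2 (by norm_num)
  simp only [Polynomial.coeff_sub, Polynomial.coeff_C_mul, Polynomial.coeff_X_pow,
    Polynomial.coeff_C] at h0 h1 h2
  norm_num at h0 h1 h2
  refine ⟨?_, ?_, ?_⟩
  · have : (2 : k) * ((lineP F u p).coeff 0 - eval u F) = 0 := by linear_combination h0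
    exact sub_eq_zero.1 ((mul_eq_zero.1 this).resolve_left two_ne_zero)
  · have : (2 : k) * ((lineP F u p).coeff 1 - d1 F u p) = 0 := by linear_combination h1
    exact sub_eq_zero.1 ((mul_eq_zero.1 this).resolve_left two_ne_zero)
  · linear_combination h2

lemma dirDeriv_two {n : ℕ} (F : MvPolynomial (Fin n) k) (u w : Fin n → k) :
    dirDeriv F u w 2 = d2 F u w w := by
  unfold dirDeriv d2
  rw [← (finTwoArrowEquiv (Fin n)).symm.sum_comp, Fintype.sum_prod_type]
  refine Finset.sum_congr rfl fun i _ => Finset.sum_congr rfl fun j _ => ?_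
  simp [pderivList, List.ofFn_succ, Fin.prod_univ_two, aeval_eq_eval, mul_assoc]

end
end GP

namespace GP

section
variable {k : Type} [Field k]

/-- a general projection -/
structure Gen (I : Ideal (MvPolynomial (Fin 4) k)) (l : (Fin 4 → k) →ₗ[k] (Fin 3 → k))
    (Q : Fin 4 → k) (σ : (Fin 3 → k) →ₗ[k] (Fin 4 → k)) (s : (Fin 4 → k) →ₗ[k] (Fin 1 → k))
    (F : MvPolynomial (Fin 3) k) (n : ℕ) : Prop where
  su : Setup I l Q σ s F n
  hT : ∀ v ∈ Z k I, v ≠ 0 → Module.finrank k (T I v) ≤ 2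
  lQ : l Q = 0
  b1 : ¬ Bad1 I Q
  b2 : ¬ Bad2 I Q
  b3 : ¬ Bad3 I Q

variable {I : Ideal (MvPolynomial (Fin 4) k)} {l : (Fin 4 → k) →ₗ[k] (Fin 3 → k)}
    {Q : Fin 4 → k} {σ : (Fin 3 → k) →ₗ[k] (Fin 4 → k)} {s : (Fin 4 → k) →ₗ[k] (Fin 1 → k)}
    {F : MvPolynomial (Fin 3) k} {n : ℕ}

lemma Gen.inj (c : Gen I l Q σ s F n) {v : Fin 4 → k} (hv : v ∈ Z k I) (hv0 : v ≠ 0)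
    {w : Fin 4 → k} (hw : w ∈ T I v) (h : l w = 0) : w = 0 := by
  have e := c.su.dec.eqn w
  rw [h, map_zero, zero_add] at e
  by_cases h0 : s w 0 = 0
  · rw [e, h0, zero_smul]
  · exfalso
    refine c.b1 ⟨v, hv0, hv, ?_⟩
    have : Q = (s w 0)⁻¹ • w := by
      generalize s w 0 = r at e h0
      rw [e, smul_smul, inv_mul_cancel₀ h0, one_smul]
    rw [this]
    exact Submodule.smul_mem _ _ hw

lemma Gen.ne_zero {l : (Fin 4 → k) →ₗ[k] (Fin 3 → k)} {v : Fin 4 → k} {u : Fin 3 → k}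
    (hu : u ≠ 0) (h : l v = u) : v ≠ 0 := by
  rintro rfl; exact hu (by rw [← h, map_zero])

lemma Gen.sec (c : Gen I l Q σ s F n) {v v' : Fin 4 → k} (h : l v = l v') (hne : v ≠ v') :
    ∃ r : k, r ≠ 0 ∧ v' = v + r • Q := by
  have e := c.su.dec.eqn v
  have e' := c.su.dec.eqn v'
  refine ⟨s v' 0 - s v 0, ?_, ?_⟩
  · intro h0
    apply hne
    rw [e, e', h, sub_eq_zero.1 h0]
  · rw [← h] at e'
    generalize s v 0 = r at e ⊢
    generalize s v' 0 = r' at e' ⊢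
    generalize σ (l v) = x at e e'
    rw [e, e', sub_smul]; abel

lemma Gen.secQ (c : Gen I l Q σ s F n) {v v' : Fin 4 → k} (h : l v = l v') (hne : v ≠ v') :
    ∃ a b : k, Q = a • v + b • v' := by
  obtain ⟨r, hr, e⟩ := c.sec h hne
  refine ⟨-r⁻¹, r⁻¹, ?_⟩
  rw [e, smul_add, smul_smul, inv_mul_cancel₀ hr, one_smul, neg_smul, neg_add_cancel_left]

lemma Gen.fib_two (c : Gen I l Q σ s F n) {u : Fin 3 → k} (hu : u ≠ 0) {v v' w : Fin 4 → k}
    (hv : v ∈ Z k I) (hv' : v' ∈ Z k I) (hw : w ∈ Z k I) (h : l v = u) (h' : l v' = u)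
    (hlw : l w = u) (hne : v ≠ v') : w = v ∨ w = v' := by
  by_contra hcon
  push Not at hcon
  obtain ⟨a, b, hQ⟩ := c.secQ (h.trans h'.symm) hne
  obtain ⟨r, hr, e⟩ := c.sec (h.trans hlw.symm) hcon.1.symm
  have key : ∀ x : Fin 4 → k, l x = u → w ≠ x → ∀ t : k, w ≠ t • x := by
    intro x hx hwx t ht
    have : u = t • u := by rw [← hx, ← map_smul, ← ht, hlw, hx]
    obtain ⟨i, hi⟩ := Function.ne_iff.1 hu
    have h2 := congrFun this i
    simp only [Pi.smul_apply, smul_eq_mul] at h2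
    have : t = 1 := (mul_right_cancel₀ hi (by rw [one_mul]; exact h2)).symm
    rw [this, one_smul] at ht
    exact hwx ht
  refine c.b3 ⟨v, v', w, a, b, 1 + r * a, r * b, ne_zero hu h, ne_zero hu h', ne_zero hu hlw,
    hv, hv', hw, hQ, ?_, key v h hcon.1, key v' h' hcon.2⟩
  rw [e, hQ, smul_add, add_smul, one_smul, smul_smul, smul_smul]; abel

lemma Gen.span_top (c : Gen I l Q σ s F n) {u : Fin 3 → k} (hu : u ≠ 0) {v v' : Fin 4 → k}
    (hv : v ∈ Z k I) (hv' : v' ∈ Z k I) (h : l v = u) (h' : l v' = u) (hne : v ≠ v')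
    (φ : (Fin 3 → k) →ₗ[k] k) (h1 : ∀ w ∈ T I v, φ (l w) = 0) (h2 : ∀ w ∈ T I v', φ (l w) = 0) :
    φ = 0 := by
  obtain ⟨a, b, hQ⟩ := c.secQ (h.trans h'.symm) hne
  have hs : ∀ w : Fin 4 → k, ∑ i, φ (l (Pi.single i 1)) * w i = φ (l w) := by
    intro w
    conv_rhs => rw [pi_eq_sum_univ' w]
    simp [mul_comm]
  by_contra hφ
  refine c.b2 ⟨v, v', a, b, fun i => φ (l (Pi.single i 1)), ne_zero hu h, ne_zero hu h', hv, hv',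
    hQ, ?_, fun w hw => by rw [hs, h1 w hw], fun w hw => by rw [hs, h2 w hw]⟩
  intro h0
  apply hφ
  apply LinearMap.ext
  intro x
  rw [← c.su.dec.sec x, ← hs]
  simp [fun i => congrFun h0 i]

lemma exists_form {W : Submodule k (Fin 3 → k)} (hW : Module.finrank k W ≤ 2) :
    ∃ f : MvPolynomial (Fin 3) k, f ≠ 0 ∧ ∀ w ∈ W, eval w f = 0 := by
  obtain ⟨z, hz⟩ := exists_not_mem W (by simp; omega)
  obtain ⟨φ, h1, h2⟩ := exists_functional W hz
  have hev : ∀ w, eval w (lm (LinearMap.pi fun _ : Fin 1 => φ) X 0 : MvPolynomial (Fin 3) k)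
      = φ w := by
    intro w
    have := aeval_lm (LinearMap.pi fun _ : Fin 1 => φ) 0 w
    rw [lm_self, aeval_eq_eval] at this
    exact this
  refine ⟨lm (LinearMap.pi fun _ : Fin 1 => φ) X 0, ?_, fun w hw => by rw [hev, h1 w hw]⟩
  intro h
  apply h2
  rw [← hev, h, map_zero]

lemma exists_p [Infinite k] (hF : F ≠ 0) {W W' : Submodule k (Fin 3 → k)}
    (hW : Module.finrank k W ≤ 2) (hW' : Module.finrank k W' ≤ 2) :
    ∃ p, eval p F ≠ 0 ∧ p ∉ W ∧ p ∉ W' := by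
  obtain ⟨f, hf, h1⟩ := exists_form hW
  obtain ⟨f', hf', h1'⟩ := exists_form hW'
  have : F * f * f' ≠ 0 := mul_ne_zero (mul_ne_zero hF hf) hf'
  obtain ⟨p, hp⟩ : ∃ p, eval p (F * f * f') ≠ 0 := by
    by_contra hcon
    push Not at hcon
    exact this (MvPolynomial.funext fun x => by rw [hcon x, map_zero])
  rw [map_mul, map_mul] at hp
  refine ⟨p, left_ne_zero_of_mul (left_ne_zero_of_mul hp), fun h => ?_, fun h => ?_⟩
  · exact right_ne_zero_of_mul (left_ne_zero_of_mul hp) (h1 p h)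
  · exact right_ne_zero_of_mul hp (h1' p h)

lemma Gen.not_prop (c : Gen I l Q σ s F n) {u p : Fin 3 → k} (hFu : eval u F = 0)
    (hFp : eval p F ≠ 0) (r : k) : p ≠ r • u := by
  rintro rfl
  rw [eval_smul_hom c.su.hF, hFu, mul_zero] at hFp
  exact hFp rfl

lemma Gen.finrank_map (c : Gen I l Q σ s F n) {v : Fin 4 → k} (hv : v ∈ Z k I) (hv0 : v ≠ 0) :
    Module.finrank k ((T I v).map l) ≤ 2 :=
  (Submodule.finrank_map_le l _).trans (c.hT v hv hv0)

lemma Gen.tan (c : Gen I l Q σ s F n) {v : Fin 4 → k} (hv : v ∈ Z k I) (hv0 : v ≠ 0)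
    {p : Fin 3 → k} (hp : p ∉ (T I v).map l) {w : Fin 4 → k} (hw : w ∈ T I v) {r : k}
    (h : l w = r • p) : w = 0 := by
  refine c.inj hv hv0 hw ?_
  by_cases hr : r = 0
  · rw [h, hr, zero_smul]
  · exfalso
    apply hp
    have : p = r⁻¹ • l w := by rw [h, smul_smul, inv_mul_cancel₀ hr, one_smul]
    rw [this]
    exact Submodule.smul_mem _ _ (Submodule.mem_map_of_mem hw)

lemma Gen.fib_nonempty [IsAlgClosed k] [CharZero k] (c : Gen I l Q σ s F n) {u : Fin 3 → k}
    (hu : u ≠ 0) (hFu : eval u F = 0) : ∃ v ∈ Z k I, l v = u := by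
  by_contra hcon
  push Not at hcon
  obtain ⟨p, hp, -, -⟩ := exists_p c.su.irr.ne_zero (W := ⊥) (W' := ⊥) (by simp) (by simp)
  obtain ⟨i, hi, h⟩ := c.su.ord hu (c.not_prop hFu hp) hFu hp (S := ∅)
    ⟨fun v hv h => (hcon v hv h).elim, fun v hv h => (hcon v hv h).elim⟩
  simp only [Finset.card_empty, Nat.le_zero] at hi
  rw [hi, (lineP_coeff F u p).1] at h
  exact h hFu

lemma Gen.d1_tan (c : Gen I l Q σ s F n) {v w : Fin 4 → k} (hw : w ∈ T I v) :
    d1 F (l v) (l w) = 0 := by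
  rw [← d1_pull]
  exact hw _ ((c.su.dvd F).2 dvd_rfl)

/-- `d1` as a linear functional -/
noncomputable def d1L {n : ℕ} (F : MvPolynomial (Fin n) k) (u : Fin n → k) :
    (Fin n → k) →ₗ[k] k where
  toFun := d1 F u
  map_add' := d1_add_right F u
  map_smul' := fun c w => d1_smul_right F u w c

lemma Gen.bir_of_smooth [IsAlgClosed k] [CharZero k] (c : Gen I l Q σ s F n) {u h : Fin 3 → k}
    (hu : u ≠ 0) (hFu : eval u F = 0) (hs : d1 F u h ≠ 0) :
    ∃ (N : ℕ) (b b' : MvPolynomial (Fin 3) k), b.IsHomogeneous N ∧ b'.IsHomogeneous (N + 1) ∧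
      pull l b ∉ I ∧ lm s X 0 * pull l b - pull l b' ∈ I := by
  obtain ⟨v, hv, hlv⟩ := c.fib_nonempty hu hFu
  have huniq : ∀ w ∈ Z k I, l w = u → w = v := by
    intro w hw hlw
    by_contra hne
    have := c.span_top hu hw hv hlw hlv hne (d1L F u) (fun x hx => by
      rw [← hlw]; exact c.d1_tan hx) (fun x hx => by rw [← hlv]; exact c.d1_tan hx)
    exact hs (DFunLike.congr_fun this h)
  have hv0 := ne_zero hu hlv
  obtain ⟨p, hp, hpT, -⟩ := exists_p c.su.irr.ne_zero (c.finrank_map hv hv0) (c.finrank_map hv hv0)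
  refine c.su.bir hu (c.not_prop hFu hp) hFu hp (S := {v}) ⟨?_, ?_⟩ (by simp)
  · intro w hw hlw; rw [huniq w hw hlw]; simp
  · intro w hw hlw x hx r hr
    rw [huniq w hw hlw] at hx
    exact c.tan hv hv0 hpT hx hr

lemma Gen.node [IsAlgClosed k] [CharZero k] (c : Gen I l Q σ s F n) {u : Fin 3 → k}
    (h : IsSingularAt F u) : IsNodeAt F u := by
  obtain ⟨hu, hFu, hs⟩ := h
  have hd1 : ∀ x, d1 F u x = 0 := by
    intro x
    simp [d1, aeval_eq_eval, hs]
  obtain ⟨v, hv, hlv⟩ := c.fib_nonempty hu hFu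
  have hv0 := ne_zero hu hlv
  obtain ⟨v', hv', hlv', hne⟩ : ∃ v' ∈ Z k I, l v' = u ∧ v ≠ v' := by
    by_contra hcon
    push Not at hcon
    obtain ⟨p, hp, hpT, -⟩ := exists_p c.su.irr.ne_zero (c.finrank_map hv hv0)
      (c.finrank_map hv hv0)
    obtain ⟨i, hi, h⟩ := c.su.ord hu (c.not_prop hFu hp) hFu hp (S := {v}) ⟨fun w hw hlw => by
        rw [← hcon w hw hlw]; simp, fun w hw hlw x hx r hr => by
        rw [← hcon w hw hlw] at hx
        exact c.tan hv hv0 hpT hx hr⟩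
    rw [Finset.card_singleton] at hi
    have e := lineP_coeff F u p
    interval_cases i
    · exact h (e.1.trans hFu)
    · exact h (e.2.1.trans (hd1 p))
  have hv0' := ne_zero hu hlv'
  obtain ⟨p, hp, hpT, hpT'⟩ := exists_p c.su.irr.ne_zero (c.finrank_map hv hv0)
      (c.finrank_map hv' hv0')
  have hH : d2 F u p p ≠ 0 := by
    classical
    obtain ⟨i, hi, h⟩ := c.su.ord hu (c.not_prop hFu hp) hFu hp (S := {v, v'}) ⟨fun w hw hlw => by
        rcases c.fib_two hu hv hv' hw hlv hlv' hlw hne with rfl | rfl <;> simp,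
      fun w hw hlw x hx r hr => by
        rcases c.fib_two hu hv hv' hw hlv hlv' hlw hne with rfl | rfl
        · exact c.tan hv hv0 hpT hx hr
        · exact c.tan hv' hv0' hpT' hx hr⟩
    rw [Finset.card_pair hne] at hi
    have e := lineP_coeff F u p
    interval_cases i
    · exact (h (e.1.trans hFu)).elim
    · exact (h (e.2.1.trans (hd1 p))).elim
    · rw [← e.2.2]; exact mul_ne_zero two_ne_zero h
  have htan : ∀ x ∈ Z k I, l x = u → ∀ w ∈ T I x, d2 F u (l w) (l w) = 0 := by
    intro x hx hlx w hw
    by_cases hc : ∃ r : k, w = r • x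
    · obtain ⟨r, rfl⟩ := hc
      rw [map_smul, hlx, d2_smul_left, d2_smul_right, euler2 c.su.hF, hd1, mul_zero, mul_zero,
        mul_zero]
    · push Not at hc
      have hx0 := ne_zero hu hlx
      rw [← hlx, ← d2_pull]
      refine second_order c.su.prime c.su.hH hx (c.hT x hx hx0) hx0 hw hc
        ((c.su.dvd F).2 dvd_rfl) fun y => ?_
      rw [d1_pull, hlx, hd1]
  refine ⟨hu, hFu, ⟨?_, ?_⟩, ?_⟩
  · intro t ht
    match t, ht with
    | [], _ => exact hFu
    | [i], _ => exact hs i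
  · by_contra hcon
    push Not at hcon
    apply hH
    refine Finset.sum_eq_zero fun i _ => Finset.sum_eq_zero fun j _ => ?_
    have := hcon [i, j] rfl
    simp only [pderivList, List.foldr] at this
    rw [aeval_eq_eval, this, zero_mul, zero_mul]
  · rintro ⟨r, m, hm⟩
    simp only [dirDeriv_two] at hm
    have hr : r ≠ 0 := by
      rintro rfl
      rw [hm, zero_mul] at hH
      exact hH rfl
    let φ : (Fin 3 → k) →ₗ[k] k :=
      { toFun := fun w => ∑ i, m i * w i
        map_add' := fun x y => by simp [mul_add, Finset.sum_add_distrib]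
        map_smul' := fun t x => by
          simp only [Pi.smul_apply, smul_eq_mul, Finset.mul_sum, RingHom.id_apply]
          exact Finset.sum_congr rfl fun i _ => by ring }
    have hφ : ∀ x ∈ Z k I, l x = u → ∀ w ∈ T I x, φ (l w) = 0 := by
      intro x hx hlx w hw
      have := htan x hx hlx w hw
      rw [hm] at this
      exact eq_zero_of_pow_eq_zero ((mul_eq_zero.1 this).resolve_left hr)
    have h0 := c.span_top hu hv hv' hlv hlv' hne φ (hφ v hv hlv) (hφ v' hv' hlv')
    have h1 : ∑ i, m i * p i = 0 := DFunLike.congr_fun h0 p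
    rw [hm, h1] at hH
    simp at hH

end
end GP

namespace GP

section
variable {k : Type} [Field k]

lemma exists_smooth [IsAlgClosed k] [CharZero k] {F : MvPolynomial (Fin 3) k} {n : ℕ}
    (irr : Irreducible F) (hF : F.IsHomogeneous n) :
    ∃ u h : Fin 3 → k, u ≠ 0 ∧ eval u F = 0 ∧ d1 F u h ≠ 0 := by
  by_contra hcon
  push Not at hcon
  have hF0 : F ≠ 0 := irr.ne_zero
  have htd : F.totalDegree = n := hF.totalDegree hF0
  have hn : n ≠ 0 := by
    intro h0
    rw [h0] at htd
    have hC := totalDegree_eq_zero_iff_eq_C.1 htd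
    apply irr.not_isUnit
    rw [hC]
    refine IsUnit.map C (isUnit_iff_ne_zero.2 ?_)
    intro hz
    rw [hz, map_zero] at hC
    exact hF0 hC
  obtain ⟨i, hi⟩ : ∃ i, pderiv i F ≠ 0 := by
    by_contra hall
    push Not at hall
    have e := hF.sum_X_mul_pderiv
    simp only [hall, mul_zero, Finset.sum_const_zero] at e
    have := e.symm
    rw [nsmul_eq_mul] at this
    rcases mul_eq_zero.1 this with h | h
    · exact hn (by exact_mod_cast h)
    · exact hF0 h
  have hpr : (Ideal.span {F}).IsPrime := (Ideal.span_singleton_prime hF0).2 irr.prime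
  have hdv : ∀ j, F ∣ X j := by
    intro j
    have h1 : X j * pderiv i F ∈ Ideal.span {F} := by
      rw [← MvPolynomial.IsPrime.vanishingIdeal_zeroLocus (K := k) (Ideal.span {F}),
        mem_vanishingIdeal_iff, zeroLocus_span]
      intro x hx
      have hx' : eval x F = 0 := by simpa [aeval_eq_eval] using hx
      by_cases h0 : x = 0
      · simp [h0]
      · have := hcon x (Pi.single i 1) h0 hx'
        simp [d1, Pi.single_apply] at this
        rw [aeval_eq_eval, map_mul, this, mul_zero]
    rcases irr.prime.dvd_or_dvd (Ideal.mem_span_singleton.1 h1) with h | h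
    · exact h
    · exfalso
      obtain ⟨g, hg⟩ := h
      have hg0 : g ≠ 0 := by rintro rfl; exact hi (by rw [hg, mul_zero])
      have h2 := (hF.pderiv (i := i)).totalDegree hi
      rw [hg, totalDegree_mul_of_isDomain hF0 hg0, htd] at h2
      omega
  have hX : Irreducible (X 0 : MvPolynomial (Fin 3) k) := X_prime.irreducible
  have h3 : (X 0 : MvPolynomial (Fin 3) k) ∣ X 1 :=
    ((hX.dvd_iff.1 (hdv 0)).resolve_left irr.not_isUnit).dvd.trans (hdv 1)
  obtain ⟨c, hc⟩ := h3
  have := congrArg (eval ![0, 1, 0]) hc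
  simp at this

variable {I : Ideal (MvPolynomial (Fin 4) k)} {l : (Fin 4 → k) →ₗ[k] (Fin 3 → k)}
    {Q : Fin 4 → k} {σ : (Fin 3 → k) →ₗ[k] (Fin 4 → k)} {s : (Fin 4 → k) →ₗ[k] (Fin 1 → k)}
    {F : MvPolynomial (Fin 3) k} {n : ℕ}

lemma Gen.idealBir (c : Gen I l Q σ s F n) {N : ℕ} {b b' : MvPolynomial (Fin 3) k}
    (hb : b.IsHomogeneous N) (hb' : b'.IsHomogeneous (N + 1)) (hbI : pull l b ∉ I)
    (hr : lm s X 0 * pull l b - pull l b' ∈ I) : IdealBirEquiv I (Ideal.span {F}) := by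
  let ψ : Fin 4 → MvPolynomial (Fin 3) k := fun j => b * lm σ X j + C (Q j) * b'
  have hpull : ∀ g, bind₁ (lm l (X : Fin 4 → MvPolynomial (Fin 4) k)) g = pull l g := fun g => rfl
  have hψ : ∀ j, pull l (ψ j) = pull l b * lm σ (lm l X) j + C (Q j) * pull l b' := by
    intro j
    have h1 := congrFun (lm_map σ X (aeval (lm l (X : Fin 4 → MvPolynomial (Fin 4) k)))) j
    simp only [aeval_X] at h1
    rw [show lm σ (lm l X) j = aeval (lm l (X : Fin 4 → MvPolynomial (Fin 4) k)) (lm σ X j) from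
      h1.symm]
    simp only [ψ, pull, map_add, map_mul, algHom_C, algebraMap_eq]
  have hlam : ∀ j, pull l (ψ j) - pull l b * X j ∈ I := by
    intro j
    have h1 := c.su.dec.eqnE (MvPolynomial (Fin 4) k) X j
    have h2 : pull l (ψ j) - pull l b * X j =
        (- C (Q j)) * (lm s X 0 * pull l b - pull l b') := by
      rw [hψ]
      rw [algebraMap_eq] at h1
      generalize lm σ (lm l (X : Fin 4 → MvPolynomial (Fin 4) k)) j = A at *
      generalize lm s (X : Fin 4 → MvPolynomial (Fin 4) k) 0 = B at *
      rw [h1]; ring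
    rw [h2]; exact I.mul_mem_left _ hr
  refine ⟨lm l X, ψ, ⟨1, lm_hom l⟩, ⟨N + 1, fun j => ?_⟩, ?_, ?_, ⟨pull l b, hbI, hlam⟩,
    ⟨b, ?_, fun i => ?_⟩⟩
  · refine (hb.mul (lm_hom σ j)).add ?_
    have := (isHomogeneous_C (Fin 3) (Q j)).mul hb'
    rwa [zero_add] at this
  · intro g hg
    exact (c.su.dvd g).2 (Ideal.mem_span_singleton.1 hg)
  · intro f hf
    rw [Ideal.mem_span_singleton, ← c.su.dvd]
    have h1 : Ideal.Quotient.mkₐ k I (pull l (bind₁ ψ f)) =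
        aeval ((Ideal.Quotient.mkₐ k I (pull l b)) • (fun j => Ideal.Quotient.mkₐ k I (X j))) f := by
      have : ((Ideal.Quotient.mkₐ k I).comp
          (aeval (lm l (X : Fin 4 → MvPolynomial (Fin 4) k)))).comp (bind₁ ψ) =
        aeval ((Ideal.Quotient.mkₐ k I (pull l b)) • (fun j => Ideal.Quotient.mkₐ k I (X j))) := by
        ext j
        have h2 := hlam j
        rw [← Ideal.Quotient.eq, map_mul] at h2
        simpa [hpull] using h2
      exact DFunLike.congr_fun this f
    have hker : I ≤ RingHom.ker (aeval ((Ideal.Quotient.mkₐ k I (pull l b)) •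
        (fun j => Ideal.Quotient.mkₐ k I (X j))) : MvPolynomial (Fin 4) k →ₐ[k] _) := by
      obtain ⟨S, hS, hSh⟩ := c.su.hH
      conv_lhs => rw [hS]
      rw [Ideal.span_le]
      intro g hg
      obtain ⟨d, hd⟩ := hSh g hg
      have hgI : g ∈ I := by rw [hS]; exact Ideal.subset_span hg
      have h3 : aeval (fun j => Ideal.Quotient.mkₐ k I (X j)) g = Ideal.Quotient.mkₐ k I g := by
        have : aeval (fun j => Ideal.Quotient.mkₐ k I (X j)) = Ideal.Quotient.mkₐ k I := by
          ext j; simp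
        rw [this]
      have h4 : Ideal.Quotient.mkₐ k I g = 0 := Ideal.Quotient.eq_zero_iff_mem.2 hgI
      change aeval _ g = 0
      rw [aeval_smul_hom hd, h3, h4, mul_zero]
    have h5 := hker hf
    rw [RingHom.mem_ker, ← h1] at h5
    exact Ideal.Quotient.eq_zero_iff_mem.1 h5
  · intro h
    exact hbI ((c.su.dvd b).2 (Ideal.mem_span_singleton.1 h))
  · have h1 : bind₁ ψ (lm l X i) = b * X i := by
      have h2 := congrFun (lm_map l X (bind₁ ψ)) i
      simp only [bind₁_X_right] at h2
      rw [h2]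
      have h3 : ψ = b • lm σ X + b' • (fun j => algebraMap k (MvPolynomial (Fin 3) k) (Q j)) := by
        funext j; simp [ψ, mul_comm, algebraMap_eq]
      have h4 : l ∘ₗ σ = LinearMap.id := LinearMap.ext c.su.dec.sec
      rw [show (fun j => ψ j) = ψ from rfl, h3, lm_add, lm_smul, lm_smul, lm_const, ← lm_comp, h4,
        lm_id, c.lQ]
      simp
    rw [h1, sub_self]; exact zero_mem _

lemma Gen.genInj (c : Gen I l Q σ s F n) {N : ℕ} {b b' : MvPolynomial (Fin 3) k}
    (hb : b.IsHomogeneous N) (hb' : b'.IsHomogeneous (N + 1))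
    (hr : lm s X 0 * pull l b - pull l b' ∈ I) {v w : Fin 4 → k} (hv : v ∈ Z k I) (hw : w ∈ Z k I)
    (hwb : eval w (pull l b) ≠ 0) {t : k} (h : l w = t • l v) : w = t • v := by
  have key : ∀ x ∈ Z k I, s x 0 * eval (l x) b = eval (l x) b' := by
    intro x hx
    have h1 := hx _ hr
    rw [map_sub, map_mul, aeval_pull, aeval_pull, aeval_lm, lm_self, lm_self, aeval_eq_eval,
      sub_eq_zero] at h1
    simpa [aeval_eq_eval] using h1
  have e1 := key v hv
  have e2 := key w hw
  rw [eval_pull] at hwb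
  have e3 : s w 0 = t * s v 0 := by
    rw [h, eval_smul_hom hb'] at e2
    rw [h] at hwb
    apply mul_right_cancel₀ hwb
    rw [e2, eval_smul_hom hb, ← e1]; ring
  have ev := c.su.dec.eqn v
  have ew := c.su.dec.eqn w
  rw [h, map_smul, e3, mul_smul, ← smul_add, ← ev] at ew
  exact ew

end
end GP
/-- Projecting a smooth irreducible space curve `C = V(I) ⊂ ℙ³` from a
general point `Q ∉ C` (general: avoiding a proper closed subset of `ℙ³`) yields a plane
curve birational to `C` whose only singularities are nodes. -/
theorem generic_projection_of_smooth_space_curve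
    {k : Type} [Field k] [IsAlgClosed k] [CharZero k]
    (I : Ideal (MvPolynomial (Fin 4) k)) (hI : IsProjCurveIdeal I)
    (hsm : IsSmoothCurve I) :
    ∃ (G₀ : MvPolynomial (Fin 4) k) (d : ℕ), G₀ ≠ 0 ∧ G₀.IsHomogeneous d ∧
      ∀ Q : Fin 4 → k, Q ≠ 0 → eval Q G₀ ≠ 0 →
        Q ∉ projZeros I ∧
        ∀ (l : (Fin 4 → k) →ₗ[k] (Fin 3 → k)), Function.Surjective l →
          LinearMap.ker l = Submodule.span k {Q} →
          ∃ D : PlaneCurve k,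
            -- the projection maps C onto the plane curve D
            (∀ v ∈ projZeros I, v ≠ 0 → eval (l v) D.F = 0) ∧
            -- the plane curve D is birational to C
            IdealBirEquiv I (Ideal.span {D.F}) ∧
            -- the projection is injective on a dense open subset of C
            (∃ G : MvPolynomial (Fin 4) k, G ∉ I ∧
              ∀ v w : Fin 4 → k, v ∈ projZeros I → w ∈ projZeros I →
                eval v G ≠ 0 → eval w G ≠ 0 →
                (∃ c : k, l w = c • l v) → ∃ c : k, w = c • v) ∧
            -- and the only singular points of D are nodes
            (∀ u : Fin 3 → k, IsSingularAt D.F u → IsNodeAt D.F u) := by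
  have hH : GP.Hom I := hI.homog
  have hT : ∀ v ∈ GP.Z k I, v ≠ 0 → Module.finrank k (GP.T I v) ≤ 2 := by
    intro v hv hv0
    rw [GP.T_eq]
    rw [GP.Z_eq] at hv
    exact (hsm v hv hv0).le
  obtain ⟨G₀, d, hG0, hGd, hG⟩ := GP.exists_G0 hH hT
  refine ⟨G₀, d, hG0, hGd, fun Q hQ0 hQG => ?_⟩
  obtain ⟨b1, b2, b3⟩ := hG Q hQG
  have hQ : Q ∉ GP.Z k I := fun h => b1 ⟨Q, hQ0, h, GP.self_mem_T hH h⟩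
  refine ⟨by rwa [← GP.Z_eq], fun l hl hker => ?_⟩
  obtain ⟨σ, s, h1, h2, h3⟩ := GP.decomp l hl hQ0 hker
  have hdec : GP.Dec l Q σ s := ⟨h1, h2, h3⟩
  obtain ⟨F, n, irr, hF, hdvd⟩ := GP.exists_F hI.prime hH hI.dim hdec hQ
  have hlQ : l Q = 0 := by
    rw [← LinearMap.mem_ker, hker]
    exact Submodule.mem_span_singleton_self Q
  have c : GP.Gen I l Q σ s F n := ⟨⟨hI.prime, hH, hdec, hQ, irr, hF, hdvd⟩, hT, hlQ, b1, b2, b3⟩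
  obtain ⟨u, h, hu, hFu, hs⟩ := GP.exists_smooth irr hF
  obtain ⟨N, b, b', hb, hb', hbI, hr⟩ := c.bir_of_smooth hu hFu hs
  refine ⟨⟨n, F, hF, irr⟩, fun v hv _ => ?_, c.idealBir hb hb' hbI hr,
    ⟨GP.pull l b, hbI, fun v w hv hw _ hwG => ?_⟩, fun u hu => c.node hu⟩
  · have := hv _ ((hdvd F).2 dvd_rfl)
    rwa [GP.eval_pull] at this
  · rintro ⟨t, ht⟩
    rw [← GP.Z_eq] at hv hw
    exact ⟨t, c.genInj hb hb' hr hv hw hwG ht⟩
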